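/- arXiv:1906.01448 — 4 statements merged into one kernel-verified Lean document; each statement's English description precedes it below -/
import Mathlib

section
/- Let Ω be a finite probability space with measure μ, let I and J be finite sets, let (F_i)_{i∈I} be an independent family of sub-sigma-algebras of the sigma-algebra of Ω, let f_{i,j} be F_i-measurable real-valued functions for (i,j) ∈ I×J, let w_{i,j}: Ω → [0,1], and let p ≥ 1, 0 ≤ ε < κ ≤ 1. Write E_i for conditional expectation with respect to F_i and w ∨ ε = max(w,ε). Then E(∑_{i,j} |(w_{i,j} ∨ ε) f_{i,j}|^p)^{1/p} ≥ κ^p · 2^{−1/p'} · ‖ ⨿_i ( 1_{{E_i(w_{i,j} ∨ ε) ≥ κ}} f_{i,j} )_{j∈J} ‖_{(L^1+L^p)( ⨿_i (Ω,F_i,μ), ℓ^p(J) )}, where 1/p' = 1 − 1/p. -/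
open MeasureTheory ProbabilityTheory

lemma tang {p c x : ℝ} (hp : 1 ≤ p) (hc : 0 < c) (hx : 0 ≤ x) :
    p * c ^ (p-1) * x - (p-1) * c ^ p ≤ x ^ p := by
  have h := one_add_mul_self_le_rpow_one_add (s := x / c - 1) (by have := div_nonneg hx hc.le; linarith) hp
  have e : 1 + (x / c - 1) = x / c := by ring
  rw [e, Real.div_rpow hx hc.le, le_div_iff₀ (by positivity)] at h
  refine le_trans (le_of_eq ?_) h
  rw [Real.rpow_sub_one hc.ne']
  field_simp
  ring

lemma ptw {p κ W G : ℝ} (hp : 1 ≤ p) (hκ : 0 < κ) (hW : 0 ≤ W) (hW1 : W ≤ 1) (hG : 0 ≤ G) :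
    p * (κ / 2 ^ (1/p)) ^ (p-1) * W
      - (p-1) * (κ / 2 ^ (1/p)) ^ p * ((2:ℝ) ^ (1/p) * (1 + 1/p * ((G-1)/2)))
      ≤ W * (1+G) ^ (-(1 - 1/p)) := by
  have hp0 : 0 < p := by linarith
  set b : ℝ := (2:ℝ) ^ (1/p) with hb
  have hbp : 0 < b := by positivity
  set c := κ / b with hc
  have hcp : 0 < c := by positivity
  have hB1 : (1+G) ^ (1/p) ≤ b * (1 + 1/p * ((G-1)/2)) := by
    have := rpow_one_add_le_one_add_mul_self (s := (G-1)/2) (p := 1/p) (by linarith) (by positivity)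
      (by rw [div_le_one hp0]; exact hp)
    have e : 1 + G = 2 * (1 + (G-1)/2) := by ring
    rw [e, Real.mul_rpow (by norm_num) (by linarith)]
    gcongr
  set B := (1+G) ^ (1/p) with hB
  have hBp : 0 < B := by positivity
  have h := tang hp hcp (div_nonneg hW hBp.le)
  have h2 := mul_le_mul_of_nonneg_right h hBp.le
  have e2 : (W / B) ^ p * B = W ^ p * (1+G) ^ (-(1 - 1/p)) := by
    rw [Real.div_rpow hW hBp.le, hB, ← Real.rpow_mul (by linarith)]
    have : -(1 - 1/p) = 1/p - 1/p*p := by field_simp; ring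
    rw [this, Real.rpow_sub (by linarith)]
    ring
  have hWp : W ^ p ≤ W := by
    calc W ^ p ≤ W ^ (1:ℝ) := Real.rpow_le_rpow_of_exponent_ge_of_imp hW hW1 hp (by intro _ h; linarith)
      _ = W := Real.rpow_one W
  have e3 : (p * c ^ (p-1) * (W/B) - (p-1) * c^p) * B = p * c ^ (p-1) * W - (p-1) * c^p * B := by
    field_simp
  rw [e2, e3] at h2
  have h3 : W ^ p * (1+G) ^ (-(1 - 1/p)) ≤ W * (1+G) ^ (-(1 - 1/p)) := by gcongr
  have h4 : (p-1) * c^p * B ≤ (p-1) * c^p * (b * (1 + 1/p * ((G-1)/2))) := by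
    have : 0 ≤ p - 1 := by linarith
    gcongr
  linarith

lemma holder {K : Type*} [Fintype K] {p : ℝ} (hp : 1 ≤ p) (a v : K → ℝ) (ha : ∀ k, 0 ≤ a k)
    (hv : ∀ k, 0 ≤ v k) (hv1 : ∑ k, v k ≤ 1) :
    ∑ k, a k * v k ^ (1 - 1/p) ≤ (∑ k, a k ^ p) ^ (1/p) := by
  rcases hp.eq_or_lt with rfl | hp'
  · simp
  have hc : p.HolderConjugate (p / (p-1)) := by
    simpa [Real.conjExponent] using Real.HolderConjugate.conjExponent hp'
  have h := Real.inner_le_Lp_mul_Lq Finset.univ a (fun k => v k ^ (1-1/p)) hc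
  have e : ∀ k, |v k ^ (1 - 1/p)| ^ (p/(p-1)) = v k := by
    intro k
    rw [abs_of_nonneg (Real.rpow_nonneg (hv k) _), ← Real.rpow_mul (hv k)]
    have : (1 - 1/p) * (p/(p-1)) = 1 := by
      have : p - 1 ≠ 0 := by linarith
      field_simp
    rw [this, Real.rpow_one]
  simp only [e, abs_of_nonneg (ha _)] at h
  refine h.trans ?_
  have h0 : 0 ≤ ∑ k, v k := Finset.sum_nonneg fun k _ => hv k
  have : (∑ k, v k) ^ (1/(p/(p-1))) ≤ 1 := Real.rpow_le_one h0 hv1 (by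
    have : 0 < p - 1 := by linarith
    positivity)
  have h1 : 0 ≤ (∑ k, a k ^ p) ^ (1/p) := by
    apply Real.rpow_nonneg
    exact Finset.sum_nonneg fun k _ => Real.rpow_nonneg (ha k) _
  exact mul_le_of_le_one_right h1 this

lemma intstep {Ω : Type*} [Fintype Ω] [MeasurableSpace Ω] [MeasurableSingletonClass Ω]
    (μ : Measure Ω) [IsProbabilityMeasure μ] {p κ : ℝ} (hp : 1 ≤ p) (hκ : 0 < κ)
    (φ W G : Ω → ℝ) (hφ : ∀ x, 0 ≤ φ x) (hW : ∀ x, 0 ≤ W x) (hW1 : ∀ x, W x ≤ 1)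
    (hG : ∀ x, 0 ≤ G x) (h1 : κ * ∫ x, φ x ∂μ ≤ ∫ x, φ x * W x ∂μ)
    (h2 : ∫ x, φ x * G x ∂μ ≤ ∫ x, φ x ∂μ) :
    κ ^ p * (2:ℝ) ^ (-(1-1/p)) * ∫ x, φ x ∂μ ≤ ∫ x, φ x * (W x * (1+G x) ^ (-(1-1/p))) ∂μ := by
  have hp0 : 0 < p := by linarith
  set b : ℝ := (2:ℝ) ^ (1/p) with hb
  have hbp : 0 < b := by positivity
  set c := κ / b with hc
  have hcp : 0 < c := by positivity
  have hm : ∫ x, (p * c^(p-1) * (φ x * W x) - (p-1) * c^p * b * (1 - 1/(2*p)) * φ x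
      - (p-1) * c^p * b * (1/(2*p)) * (φ x * G x)) ∂μ
      ≤ ∫ x, φ x * (W x * (1+G x) ^ (-(1-1/p))) ∂μ := by
    apply integral_mono .of_finite .of_finite
    intro x
    have := mul_le_mul_of_nonneg_left (ptw (p := p) (κ := κ) hp hκ (hW x) (hW1 x) (hG x)) (hφ x)
    refine le_trans (le_of_eq ?_) this
    simp only [← hb, ← hc]
    field_simp
    ring
  refine le_trans ?_ hm
  rw [integral_sub .of_finite .of_finite, integral_sub .of_finite .of_finite,
    integral_const_mul, integral_const_mul, integral_const_mul]
  have e : κ ^ p * (2:ℝ) ^ (-(1-1/p)) = c ^ (p-1) * κ := by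
    rw [hc, Real.div_rpow hκ.le hbp.le, hb, ← Real.rpow_mul (by norm_num), Real.rpow_sub_one hκ.ne',
      Real.rpow_neg (by norm_num)]
    have : 1 / p * (p-1) = 1 - 1/p := by field_simp
    rw [this]
    field_simp
  have e2 : c ^ p * b = c^(p-1) * κ := by
    rw [Real.rpow_sub_one hcp.ne']
    have : κ = c * b := by rw [hc]; field_simp
    rw [this]; field_simp
  have a1 : p * c^(p-1) * (κ * ∫ x, φ x ∂μ) ≤ p * c^(p-1) * ∫ x, φ x * W x ∂μ := by gcongr
  have hp1 : 0 ≤ p - 1 := by linarith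
  have a2 : (p-1) * c^p * b * (1/(2*p)) * ∫ x, φ x * G x ∂μ
    ≤ (p-1) * c^p * b * (1/(2*p)) * ∫ x, φ x ∂μ := by gcongr
  have a3 : κ ^ p * (2:ℝ) ^ (-(1-1/p)) * ∫ x, φ x ∂μ = p * c^(p-1) * (κ * ∫ x, φ x ∂μ)
     - (p-1) * c^p * b * (1 - 1/(2*p)) * ∫ x, φ x ∂μ
      - (p-1) * c^p * b * (1/(2*p)) * ∫ x, φ x ∂μ := by
    rw [e]
    have : (p-1) * c^p * b = (p-1) * (c^(p-1) * κ) := by rw [← e2]; ring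
    rw [this]
    ring
  linarith

lemma thresh {Ω : Type*} [Fintype Ω] [MeasurableSpace Ω] [MeasurableSingletonClass Ω]
    (μ : Measure Ω) [IsProbabilityMeasure μ] {I : Type*} [Fintype I] {p : ℝ} (hp : 1 ≤ p)
    (X : I → Ω → ℝ) (hX : ∀ i x, 0 ≤ X i x) :
    ∃ t : ℝ, 0 ≤ t ∧ ∑ i, ∫ x, (if X i x ≤ t then X i x / t else 1) ^ p ∂μ ≤ 1 ∧
      (t = 0 ∨ ∑ i, ∫ x, (if X i x ≤ t then X i x / t else 1) ^ p ∂μ = 1) := by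
  have hp0 : 0 < p := by linarith
  by_cases h0 : ∑ i, ∫ x, (if X i x ≤ 0 then X i x / 0 else 1) ^ p ∂μ ≤ 1
  · exact ⟨0, le_rfl, h0, Or.inl rfl⟩
  push Not at h0
  let ψ : ℝ → ℝ := fun t => ∑ i, ∫ x, (min (X i x) t) ^ p ∂μ - t ^ p
  have hψ : Continuous ψ := by
    have : ψ = fun t => ∑ i, ∑ x, μ.real {x} * (min (X i x) t) ^ p - t ^ p := by
      funext t
      simp only [ψ]
      simp_rw [integral_fintype (Integrable.of_finite)]
      simp
    rw [this]
    have hc : Continuous fun t : ℝ => t ^ p := Real.continuous_rpow_const hp0.le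
    refine Continuous.sub ?_ hc
    refine continuous_finsetSum _ fun i _ => continuous_finsetSum _ fun x _ => ?_
    exact continuous_const.mul (hc.comp (continuous_const.min continuous_id))
  have key : ∀ t, 0 < t → ψ t = t ^ p * (∑ i, ∫ x, (if X i x ≤ t then X i x / t else 1) ^ p ∂μ - 1) := by
    intro t ht
    simp only [ψ]
    rw [mul_sub, mul_one, Finset.mul_sum]
    congr 1
    refine Finset.sum_congr rfl fun i _ => ?_
    rw [← integral_const_mul]
    congr 1; funext x
    split_ifs with h
    · rw [min_eq_left h, Real.div_rpow (hX i x) ht.le]; field_simp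
    · rw [min_eq_right (le_of_not_ge h)]; simp
  have hδ : ∃ δ : ℝ, 0 < δ ∧ ∀ i x, 0 < X i x → δ < X i x := by
    have : ∀ᶠ δ in nhdsWithin (0:ℝ) (Set.Ioi 0), 0 < δ ∧ ∀ i x, 0 < X i x → δ < X i x := by
      refine Filter.Eventually.and self_mem_nhdsWithin ?_
      refine Filter.eventually_all.2 fun i => Filter.eventually_all.2 fun x => ?_
      by_cases h : 0 < X i x
      · exact Filter.Eventually.filter_mono nhdsWithin_le_nhds
          ((eventually_lt_nhds h).mono fun y hy _ => hy)
      · exact Filter.Eventually.of_forall fun y hy => absurd hy h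
    exact this.exists
  obtain ⟨δ, hδ0, hδ⟩ := hδ
  have h1 : 0 ≤ ψ δ := by
    rw [key δ hδ0]
    refine mul_nonneg (by positivity) (sub_nonneg.2 (h0.le.trans (le_of_eq ?_)))
    refine Finset.sum_congr rfl fun i _ => ?_
    congr 1; funext x
    rcases (hX i x).eq_or_lt with h | h
    · simp [← h, hδ0.le]
    · simp [not_le.2 h, not_le.2 (hδ i x h)]
  -- large t
  obtain ⟨T, hTδ, hT⟩ : ∃ T, δ ≤ T ∧ ψ T ≤ 0 := by
    have : Filter.Tendsto (fun t : ℝ => t ^ p) Filter.atTop Filter.atTop := tendsto_rpow_atTop hp0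
    obtain ⟨T, hT1, hT2⟩ := ((this.eventually_ge_atTop (∑ i, ∫ x, (X i x) ^ p ∂μ)).and
      (Filter.eventually_ge_atTop δ)).exists
    refine ⟨T, hT2, sub_nonpos.2 (le_trans ?_ hT1)⟩
    refine Finset.sum_le_sum fun i _ => integral_mono .of_finite .of_finite fun x => ?_
    exact Real.rpow_le_rpow (le_min (hX i x) (hδ0.le.trans hT2)) (min_le_left _ _) hp0.le
  obtain ⟨t, ht, hψt⟩ := intermediate_value_Icc' hTδ hψ.continuousOn ⟨hT, h1⟩
  have htp : 0 < t := hδ0.trans_le ht.1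
  rw [key t htp] at hψt
  have : ∑ i, ∫ x, (if X i x ≤ t then X i x / t else 1) ^ p ∂μ = 1 := by
    rcases mul_eq_zero.1 hψt with h | h
    · exact absurd h (by positivity)
    · linarith
  exact ⟨t, htp.le, this.le, Or.inr this⟩

lemma meas_X {Ω J : Type*} [MeasurableSpace Ω] [Fintype J] (p : ℝ) (h : J → Ω → ℝ)
    (hh : ∀ j, Measurable (h j)) : Measurable fun x => (∑ j, |h j x| ^ p) ^ (1/p) := by
  have : ∀ j, Measurable fun x => |h j x| := fun j => measurable_abs.comp (hh j)
  fun_prop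

lemma meas_le {Ω : Type*} [MeasurableSpace Ω] (c : ℝ) (X : Ω → ℝ) (hX : Measurable X) :
    MeasurableSet {x | c ≤ X x} := measurableSet_le measurable_const hX

lemma meas_m {Ω : Type*} [MeasurableSpace Ω] (t : ℝ) (a b X : Ω → ℝ) (ha : Measurable a)
    (hb : Measurable b) (hX : Measurable X) :
    Measurable fun x => if X x ≤ t then a x else b x :=
  Measurable.ite (measurableSet_le hX measurable_const) ha hb

lemma meas_u {Ω : Type*} [MeasurableSpace Ω] (p t : ℝ) (h X : Ω → ℝ) (hh : Measurable h)
    (hX : Measurable X) :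
    Measurable fun x => |h x| ^ p / X x ^ p * (if X x ≤ t then X x / t else 1) ^ p := by
  have h1 : Measurable fun x => |h x| := measurable_abs.comp hh
  have h2 := meas_m t (fun x => X x / t) (fun _ => 1) X (by fun_prop) (by fun_prop) hX
  fun_prop

lemma meas_phi {Ω : Type*} [MeasurableSpace Ω] (q : ℝ) (h u : Ω → ℝ) (hh : Measurable h)
    (hu : Measurable u) : Measurable fun x => |h x| * u x ^ q := by
  have h1 : Measurable fun x => |h x| := measurable_abs.comp hh
  fun_prop

lemma meas_g {Ω : Type*} [MeasurableSpace Ω] (t : ℝ) (h X : Ω → ℝ) (hh : Measurable h)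
    (hX : Measurable X) :
    Measurable (fun x => if X x ≤ t then 0 else h x * (1 - t / X x)) ∧
    Measurable (fun x => if X x ≤ t then h x else h x * (t / X x)) :=
  ⟨meas_m t _ _ X (by fun_prop) (by fun_prop) hX, meas_m t _ _ X (by fun_prop) (by fun_prop) hX⟩

lemma dual {Ω : Type*} [Fintype Ω] [mΩ : MeasurableSpace Ω] [MeasurableSingletonClass Ω]
    (μ : Measure Ω) [IsProbabilityMeasure μ]
    {I J : Type*} [Fintype I] [Fintype J]
    (F : I → MeasurableSpace Ω) (hFle : ∀ i, F i ≤ mΩ)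
    (hFindep : iIndep F μ)
    (f h u : I → J → Ω → ℝ) (hh : ∀ i j, Measurable[F i] (h i j))
    (hu : ∀ i j, Measurable[F i] (u i j))
    (W : I → J → Ω → ℝ) (hW : ∀ i j x, 0 ≤ W i j x) (hW1 : ∀ i j x, W i j x ≤ 1)
    {p κ : ℝ} (hp : 1 ≤ p) (hκ : 0 < κ)
    (hhf : ∀ i j x, |h i j x| ≤ |f i j x|)
    (hhs : ∀ i j x, h i j x ≠ 0 → κ ≤ (μ[W i j | F i]) x)
    (hu0 : ∀ i j x, 0 ≤ u i j x) (hu1 : ∀ i x, ∑ j, u i j x ≤ 1)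
    (hus : ∑ i, ∫ x, ∑ j, u i j x ∂μ ≤ 1) :
    κ ^ p * (2:ℝ) ^ (-(1 - 1/p)) * ∑ i, ∑ j, ∫ x, |h i j x| * u i j x ^ (1 - 1/p) ∂μ ≤
      ∫ x, (∑ i, ∑ j, |W i j x * f i j x| ^ p) ^ (1/p) ∂μ := by
  classical
  let G : I → Ω → ℝ := fun i x => ∑ k ∈ Finset.univ.erase i, ∑ j, u k j x
  have hG0 : ∀ i x, 0 ≤ G i x := fun i x =>
    Finset.sum_nonneg fun k _ => Finset.sum_nonneg fun j _ => hu0 k j x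
  have hmeasφ : ∀ i j, Measurable[F i] fun x => |h i j x| * u i j x ^ (1 - 1/p) :=
    fun i j => @meas_phi Ω (F i) _ _ _ (hh i j) (hu i j)
  have hφ0 : ∀ i j x, 0 ≤ |h i j x| * u i j x ^ (1 - 1/p) := fun i j x =>
    mul_nonneg (abs_nonneg _) (Real.rpow_nonneg (hu0 i j x) _)
  have step : ∀ i j, κ ^ p * (2:ℝ) ^ (-(1 - 1/p)) * ∫ x, |h i j x| * u i j x ^ (1 - 1/p) ∂μ ≤
      ∫ x, |h i j x| * u i j x ^ (1 - 1/p) * (W i j x * (1 + G i x) ^ (-(1 - 1/p))) ∂μ := by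
    intro i j
    refine intstep μ hp hκ _ _ _ (hφ0 i j) (hW i j) (hW1 i j) (hG0 i) ?_ ?_
    · set φ : Ω → ℝ := fun x => |h i j x| * u i j x ^ (1 - 1/p) with hφ
      have hsm : StronglyMeasurable[F i] φ := (hmeasφ i j).stronglyMeasurable
      have hce := condExp_mul_of_stronglyMeasurable_left (μ := μ) (g := W i j) hsm .of_finite .of_finite
      have h1 : ∫ x, φ x * W i j x ∂μ = ∫ x, φ x * (μ[W i j | F i]) x ∂μ := by
        have := integral_condExp (μ := μ) (f := φ * W i j) (hFle i)
        calc ∫ x, φ x * W i j x ∂μ = ∫ x, (φ * W i j) x ∂μ := rfl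
          _ = _ := this.symm
          _ = _ := integral_congr_ae hce
      change κ * ∫ x, φ x ∂μ ≤ ∫ x, φ x * W i j x ∂μ
      rw [h1, ← integral_const_mul]
      refine integral_mono .of_finite .of_finite fun x => ?_
      by_cases hx : h i j x = 0
      · simp [hφ, hx]
      · have := mul_le_mul_of_nonneg_left (hhs i j x hx) (hφ0 i j x)
        change κ * φ x ≤ φ x * _
        rw [mul_comm κ]
        exact this
    · have hk : ∀ k ∈ Finset.univ.erase i,
          ∫ x, (|h i j x| * u i j x ^ (1 - 1/p)) * (∑ j, u k j x) ∂μ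
            = (∫ x, |h i j x| * u i j x ^ (1 - 1/p) ∂μ) * ∫ x, ∑ j, u k j x ∂μ := by
        intro k hk
        have hki : i ≠ k := (Finset.ne_of_mem_erase hk).symm
        have hmk : Measurable[F k] fun x => ∑ j, u k j x :=
          Finset.measurable_fun_sum _ fun j _ => hu k j
        refine IndepFun.integral_fun_mul_eq_mul_integral ?_ ?_ ?_
        · rw [IndepFun_iff_Indep]
          exact indep_of_indep_of_le_left (indep_of_indep_of_le_right (hFindep.indep hki)
            hmk.comap_le) (hmeasφ i j).comap_le
        · exact ((hmeasφ i j).mono (hFle i) le_rfl).aestronglyMeasurable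
        · exact (hmk.mono (hFle k) le_rfl).aestronglyMeasurable
      simp only [G, Finset.mul_sum (Finset.univ.erase i)]
      rw [integral_finsetSum _ (fun k _ => .of_finite), Finset.sum_congr rfl hk, ← Finset.mul_sum]
      refine mul_le_of_le_one_right (integral_nonneg (hφ0 i j)) (le_trans ?_ hus)
      exact Finset.sum_le_sum_of_subset_of_nonneg (Finset.erase_subset _ _) fun k _ _ =>
        integral_nonneg fun x => Finset.sum_nonneg fun j _ => hu0 k j x
  have hsum : κ ^ p * (2:ℝ) ^ (-(1 - 1/p)) * ∑ i, ∑ j, ∫ x, |h i j x| * u i j x ^ (1 - 1/p) ∂μ ≤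
      ∫ x, ∑ i, ∑ j, |h i j x| * u i j x ^ (1 - 1/p) * (W i j x * (1 + G i x) ^ (-(1 - 1/p))) ∂μ := by
    rw [integral_finsetSum _ (fun k _ => .of_finite), Finset.mul_sum]
    refine Finset.sum_le_sum fun i _ => ?_
    rw [integral_finsetSum _ (fun k _ => .of_finite), Finset.mul_sum]
    exact Finset.sum_le_sum fun j _ => step i j
  refine hsum.trans (integral_mono .of_finite .of_finite fun x => ?_)
  -- pointwise Hölder
  let v : I × J → ℝ := fun k => u k.1 k.2 x / (1 + G k.1 x)
  have hpos : ∀ i, 0 < 1 + G i x := fun i => by linarith [hG0 i x]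
  have hv0 : ∀ k, 0 ≤ v k := fun k => div_nonneg (hu0 _ _ _) (hpos _).le
  have hS : ∀ i, ∑ i, ∑ j, u i j x ≤ 1 + G i x := by
    intro i
    rw [← Finset.add_sum_erase _ _ (Finset.mem_univ i)]
    exact add_le_add (hu1 i x) le_rfl
  have hSn : 0 ≤ ∑ i, ∑ j, u i j x := Finset.sum_nonneg fun k _ => Finset.sum_nonneg fun j _ => hu0 k j x
  have hv1 : ∑ k, v k ≤ 1 := by
    have hle : ∑ k, v k ≤ (∑ i, ∑ j, u i j x) / (∑ i, ∑ j, u i j x) := by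
      rcases hSn.eq_or_lt with h0 | h0
      · rw [← h0, div_zero]
        refine Finset.sum_nonpos fun k _ => ?_
        have h1 := (Finset.sum_eq_zero_iff_of_nonneg
          (fun i _ => Finset.sum_nonneg fun j _ => hu0 i j x)).1 h0.symm k.1 (Finset.mem_univ _)
        have h2 := (Finset.sum_eq_zero_iff_of_nonneg (fun j _ => hu0 k.1 j x)).1 h1 k.2 (Finset.mem_univ _)
        simp [v, h2]
      · rw [Fintype.sum_prod_type, Finset.sum_div]
        refine Finset.sum_le_sum fun i _ => ?_
        rw [Finset.sum_div]
        exact Finset.sum_le_sum fun j _ => div_le_div_of_nonneg_left (hu0 i j x) h0 (hS i)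
    exact hle.trans (div_self_le_one _)
  have H := holder hp (fun k : I × J => |W k.1 k.2 x * f k.1 k.2 x|) v (fun k => abs_nonneg _) hv0 hv1
  rw [Fintype.sum_prod_type, Fintype.sum_prod_type] at H
  refine le_trans (Finset.sum_le_sum fun i _ => Finset.sum_le_sum fun j _ => ?_) H
  simp only [v]
  rw [Real.div_rpow (hu0 i j x) (hpos i).le, Real.rpow_neg (hpos i).le, abs_mul, abs_of_nonneg (hW i j x)]
  have : |h i j x| * (W i j x * u i j x ^ (1 - 1/p) * ((1 + G i x) ^ (1-1/p))⁻¹) ≤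
    |f i j x| * (W i j x * u i j x ^ (1 - 1/p) * ((1 + G i x) ^ (1-1/p))⁻¹) := by
    refine mul_le_mul_of_nonneg_right (hhf i j x) (mul_nonneg (mul_nonneg (hW i j x)
      (Real.rpow_nonneg (hu0 i j x) _)) (inv_nonneg.2 (Real.rpow_nonneg (hpos i).le _)))
  rw [div_eq_mul_inv (u i j x ^ (1 - 1/p))]
  refine le_trans (le_of_eq ?_) (this.trans (le_of_eq ?_)) <;> ring

lemma normscale {J : Type*} [Fintype J] {p : ℝ} (a : J → ℝ) (c : ℝ) (hc : 0 ≤ c) :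
    ∑ j, |a j * c| ^ p = (∑ j, |a j| ^ p) * c ^ p := by
  rw [Finset.sum_mul]
  refine Finset.sum_congr rfl fun j _ => ?_
  rw [abs_mul, abs_of_nonneg hc, Real.mul_rpow (abs_nonneg _) hc]

/-- pointwise facts: `X` is the `ℓ^p` norm of `a`. -/
lemma pointwise {J : Type*} [Fintype J] {p t : ℝ} (hp : 1 ≤ p) (ht : 0 ≤ t) (a : J → ℝ) (X m : ℝ)
    (hX : X = (∑ j, |a j| ^ p) ^ (1/p)) (hm : m = if X ≤ t then X / t else 1) :
    (0 ≤ m ∧ m ≤ 1) ∧ (∑ j, |a j| ^ p / X ^ p * m ^ p = m ^ p) ∧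
    ((∑ j, |if X ≤ t then 0 else a j * (1 - t / X)| ^ p) ^ (1/p) + t * m ^ p
       = ∑ j, |a j| * (|a j| ^ p / X ^ p * m ^ p) ^ (1 - 1/p)) ∧
    (∑ j, |if X ≤ t then a j else a j * (t / X)| ^ p = t ^ p * m ^ p) := by
  have hp0 : 0 < p := by linarith
  have hS : 0 ≤ ∑ j, |a j| ^ p := Finset.sum_nonneg fun j _ => by positivity
  have hX0 : 0 ≤ X := by rw [hX]; positivity
  have hXp : X ^ p = ∑ j, |a j| ^ p := by
    rw [hX, ← Real.rpow_mul hS]; simp [hp0.ne']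
  have hm0 : 0 ≤ m := by rw [hm]; split_ifs <;> positivity
  have hm1 : m ≤ 1 := by
    rw [hm]; split_ifs with h
    · exact div_le_one_of_le₀ h ht
    · rfl
  have hzero : X = 0 → ∀ j, a j = 0 := by
    intro h j
    rw [h, Real.zero_rpow hp0.ne'] at hXp
    have := (Finset.sum_eq_zero_iff_of_nonneg (fun j _ => by positivity)).1 hXp.symm j (Finset.mem_univ _)
    rw [Real.rpow_eq_zero (abs_nonneg _) hp0.ne'] at this
    simpa using this
  refine ⟨⟨hm0, hm1⟩, ?_, ?_, ?_⟩
  · rw [← Finset.sum_mul, ← Finset.sum_div, ← hXp]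
    rcases hX0.eq_or_lt with h | h
    · have : m = 0 := by rw [hm, ← h]; simp [ht]
      simp [this, Real.zero_rpow hp0.ne']
    · rw [div_self (by positivity), one_mul]
  · rcases hX0.eq_or_lt with h | h
    · have hm' : m = 0 := by rw [hm, ← h]; simp [ht]
      have := hzero h.symm
      simp [this, hm', Real.zero_rpow hp0.ne', Real.zero_rpow (inv_pos.2 hp0).ne']
    · have e : ∑ j, |a j| * (|a j| ^ p / X ^ p * m ^ p) ^ (1 - 1/p) = X * m ^ (p-1) := by
        have : ∀ j, |a j| * (|a j| ^ p / X ^ p * m ^ p) ^ (1 - 1/p) = |a j| ^ p * (m ^ (p-1) / X ^ (p-1)) := by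
          intro j
          have e1 : p * (1 - 1/p) = p - 1 := by field_simp
          rw [Real.mul_rpow (by positivity) (by positivity), Real.div_rpow (by positivity) (by positivity),
            ← Real.rpow_mul (abs_nonneg _), ← Real.rpow_mul hX0, ← Real.rpow_mul hm0, e1]
          have e2 : |a j| * |a j| ^ (p-1) = |a j| ^ p := by
            rw [← Real.rpow_one_add' (abs_nonneg _) (by linarith)]; congr 1; ring
          rw [← e2]; ring
        rw [Finset.sum_congr rfl fun j _ => this j, ← Finset.sum_mul, ← hXp, Real.rpow_sub_one h.ne']
        field_simp
      rw [e]
      by_cases hXt : X ≤ t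
      · have htp : 0 < t := h.trans_le hXt
        have hm' : m = X / t := by rw [hm, if_pos hXt]
        have hmp : 0 < m := by rw [hm']; positivity
        simp only [if_pos hXt, abs_zero, Real.zero_rpow hp0.ne', Finset.sum_const_zero]
        rw [Real.zero_rpow (by positivity), zero_add, Real.rpow_sub_one hmp.ne', hm']
        field_simp
      · have hm' : m = 1 := by rw [hm, if_neg hXt]
        simp only [if_neg hXt, hm', Real.one_rpow]
        have hc : 0 ≤ 1 - t / X := sub_nonneg.2 (div_le_one_of_le₀ (le_of_not_ge hXt) hX0)
        rw [normscale _ _ hc, Real.mul_rpow hS (by positivity), ← hX, ← Real.rpow_mul hc]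
        have : p * (1/p) = 1 := by field_simp
        rw [this, Real.rpow_one]
        field_simp
        ring
  · by_cases hXt : X ≤ t
    · simp only [if_pos hXt] at hm ⊢
      rw [← hXp, hm, Real.div_rpow hX0 ht]
      rcases ht.eq_or_lt with h | h
      · have : X = 0 := by linarith
        simp [this, ← h, Real.zero_rpow hp0.ne']
      · field_simp
    · simp only [if_neg hXt] at hm ⊢
      have h : 0 < X := by linarith
      rw [normscale _ _ (by positivity), ← hXp, hm, Real.div_rpow ht hX0]
      field_simp
      simp


/-- **Weighted inequality** (Theorem `premainlemma` of the paper): on a finite probability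
space, for an independent family `(F i)` of sub-σ-algebras, `F i`-measurable functions
`f i j`, `[0,1]`-valued weights `w i j`, `p ≥ 1` and `0 ≤ ε < κ ≤ 1`,
`E (∑_{i,j} |(w i j ∨ ε) f i j|^p)^(1/p)` dominates `κ^p 2^{-1/p'}` times the
`(L¹+Lᵖ)(⨿_i (Ω,F i,μ), ℓᵖ(J))`-norm of `⨿_i (1_{E_i(w i j ∨ ε) ≥ κ} f i j)_j`. -/
theorem weighted_inequality
    {Ω : Type*} [Fintype Ω] [MeasurableSpace Ω] [MeasurableSingletonClass Ω]
    (μ : Measure Ω) [IsProbabilityMeasure μ]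
    {I J : Type*} [Fintype I] [Fintype J]
    (F : I → MeasurableSpace Ω) (hFle : ∀ i, F i ≤ ‹MeasurableSpace Ω›)
    (hFindep : iIndep F μ)
    (f : I → J → Ω → ℝ) (hfmeas : ∀ i j, Measurable[F i] (f i j))
    (w : I → J → Ω → ℝ) (hw01 : ∀ i j x, w i j x ∈ Set.Icc (0:ℝ) 1)
    (p : ℝ) (hp : 1 ≤ p) (ε κ : ℝ) (hε : 0 ≤ ε) (hεκ : ε < κ) (hκ : κ ≤ 1) :
    κ ^ p * (2:ℝ) ^ (-(1 - 1/p)) *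
      sInf {s : ℝ | ∃ g₀ g₁ : I → J → Ω → ℝ,
        (∀ i j, Measurable[F i] (g₀ i j)) ∧ (∀ i j, Measurable[F i] (g₁ i j)) ∧
        (∀ i j, Set.indicator {x | κ ≤ (μ[fun y => max (w i j y) ε | F i]) x} (f i j)
            = g₀ i j + g₁ i j) ∧
        s = (∑ i, ∫ x, (∑ j, |g₀ i j x| ^ p) ^ (1/p) ∂μ)
            + (∑ i, ∫ x, ∑ j, |g₁ i j x| ^ p ∂μ) ^ (1/p)}
    ≤ ∫ x, (∑ i, ∑ j, |max (w i j x) ε * f i j x| ^ p) ^ (1/p) ∂μ := by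
  have hp0 : 0 < p := by linarith
  have hκ0 : 0 < κ := hε.trans_lt hεκ
  let W : I → J → Ω → ℝ := fun i j y => max (w i j y) ε
  let h : I → J → Ω → ℝ := fun i j =>
    Set.indicator {x | κ ≤ (μ[fun y => max (w i j y) ε | F i]) x} (f i j)
  have hh : ∀ i j, Measurable[F i] (h i j) := fun i j =>
    (hfmeas i j).indicator (@meas_le Ω (F i) κ _ stronglyMeasurable_condExp.measurable)
  let X : I → Ω → ℝ := fun i x => (∑ j, |h i j x| ^ p) ^ (1/p)
  have hX0 : ∀ i x, 0 ≤ X i x := fun i x =>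
    Real.rpow_nonneg (Finset.sum_nonneg fun j _ => by positivity) _
  have hXm : ∀ i, Measurable[F i] (X i) := fun i => @meas_X Ω J (F i) _ p _ (hh i)
  obtain ⟨t, ht, ht1, ht2⟩ := thresh μ hp X hX0
  let m : I → Ω → ℝ := fun i x => if X i x ≤ t then X i x / t else 1
  have P := fun i x => pointwise hp ht (fun j => h i j x) (X i x) (m i x) rfl rfl
  let u : I → J → Ω → ℝ := fun i j x => |h i j x| ^ p / X i x ^ p * m i x ^ p
  let g₀ : I → J → Ω → ℝ := fun i j x => if X i x ≤ t then 0 else h i j x * (1 - t / X i x)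
  let g₁ : I → J → Ω → ℝ := fun i j x => if X i x ≤ t then h i j x else h i j x * (t / X i x)
  have hus : ∑ i, ∫ x, ∑ j, u i j x ∂μ ≤ 1 := by
    refine le_trans (le_of_eq ?_) ht1
    refine Finset.sum_congr rfl fun i _ => ?_
    congr 1; funext x
    exact (P i x).2.1
  have D := dual μ F hFle hFindep f h u hh
    (fun i j => @meas_u Ω (F i) p t _ _ (hh i j) (hXm i)) W
    (fun i j x => le_max_of_le_right hε)
    (fun i j x => max_le (hw01 i j x).2 (hεκ.le.trans hκ)) hp hκ0
    (fun i j x => by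
      by_cases hx : κ ≤ (μ[fun y => max (w i j y) ε | F i]) x
      · simp [h, hx]
      · simp [h, hx])
    (fun i j x hx => by
      by_contra hc
      exact hx (Set.indicator_of_notMem
        (s := {x | κ ≤ (μ[fun y => max (w i j y) ε | F i]) x}) hc (f i j)))
    (fun i j x => mul_nonneg (div_nonneg (by positivity) (Real.rpow_nonneg (hX0 i x) _))
      (Real.rpow_nonneg (P i x).1.1 _))
    (fun i x => by
      have := (P i x).2.1
      simp only [u]
      rw [this]
      exact Real.rpow_le_one (P i x).1.1 (P i x).1.2 hp0.le)
    hus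
  refine le_trans (mul_le_mul_of_nonneg_left ?_ (by positivity)) D
  have hs : (∑ i, ∫ x, (∑ j, |g₀ i j x| ^ p) ^ (1/p) ∂μ)
            + (∑ i, ∫ x, ∑ j, |g₁ i j x| ^ p ∂μ) ^ (1/p) =
      ∑ i, ∑ j, ∫ x, |h i j x| * u i j x ^ (1 - 1/p) ∂μ := by
    have e1 : ∀ i, ∑ j, ∫ x, |h i j x| * u i j x ^ (1 - 1/p) ∂μ =
        ∫ x, (∑ j, |g₀ i j x| ^ p) ^ (1/p) ∂μ + t * ∫ x, m i x ^ p ∂μ := by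
      intro i
      rw [← integral_finsetSum _ (fun k _ => .of_finite), ← integral_const_mul,
        ← integral_add .of_finite .of_finite]
      congr 1; funext x
      exact (P i x).2.2.1.symm
    have e2 : ∀ i, ∫ x, ∑ j, |g₁ i j x| ^ p ∂μ = t ^ p * ∫ x, m i x ^ p ∂μ := by
      intro i
      rw [← integral_const_mul]
      congr 1; funext x
      exact (P i x).2.2.2
    rw [Finset.sum_congr rfl fun i _ => e1 i, Finset.sum_congr rfl fun i _ => e2 i,
      Finset.sum_add_distrib, ← Finset.mul_sum, ← Finset.mul_sum]
    congr 1
    rcases ht2 with h0 | h1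
    · rw [h0, Real.zero_rpow hp0.ne']
      simp [hp0.ne']
    · have h1' : ∑ i, ∫ x, m i x ^ p ∂μ = 1 := h1
      rw [h1', mul_one, mul_one, ← Real.rpow_mul ht]
      have : p * (1/p) = 1 := by field_simp
      rw [this, Real.rpow_one]
  rw [← hs]
  refine csInf_le ⟨0, ?_⟩ ⟨g₀, g₁, fun i j => (@meas_g Ω (F i) t _ _ (hh i j) (hXm i)).1,
    fun i j => (@meas_g Ω (F i) t _ _ (hh i j) (hXm i)).2, fun i j => ?_, rfl⟩
  · rintro s ⟨a, b, -, -, -, rfl⟩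
    refine add_nonneg (Finset.sum_nonneg fun i _ => integral_nonneg fun x => ?_)
      (Real.rpow_nonneg (Finset.sum_nonneg fun i _ => integral_nonneg fun x => ?_) _)
    · exact Real.rpow_nonneg (Finset.sum_nonneg fun j _ => by positivity) _
    · exact Finset.sum_nonneg fun j _ => by positivity
  · funext x
    change h i j x = g₀ i j x + g₁ i j x
    simp only [g₀, g₁]
    split_ifs
    · simp
    · ring
end

section
/- In the setting of the weighted inequality (Ω a finite probability space, I, J finite sets, (F_i)_{i∈I} independent sub-sigma-algebras, f_{i,j} F_i-measurable, p ≥ 1, 0 ≤ ε < κ ≤ 1), if additionally every weight w_{i,j} takes only the values 0 and 1, then E(∑_{i,j} |(w_{i,j} ∨ ε) f_{i,j}|^p)^{1/p} ≥ (κ − ε)^{2 − 1/p} · 2^{−1/p'} · ‖ ⨿_i ( 1_{{E_i(w_{i,j} ∨ ε) ≥ κ}} f_{i,j} )_{j∈J} ‖_{(L^1+L^p)( ⨿_i (Ω,F_i,μ), ℓ^p(J) )}. -/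
open MeasureTheory ProbabilityTheory

lemma aux_holder {I : Type*} [Fintype I] (W G L : I → ℝ) (hW : ∀ i, 0 ≤ W i) (hG : ∀ i, 0 ≤ G i)
    (hL : ∀ i, 0 ≤ L i) (p : ℝ) (hp : 1 ≤ p) (hWL : ∑ i, W i * L i ≤ 1) :
    ∑ i, W i * G i * L i ^ (1 - 1/p) ≤ (∑ i, W i * G i ^ p) ^ (1/p) := by
  rcases hp.eq_or_lt with rfl | hp
  · simp
  have hp0 : 0 < p := by linarith
  have hpc := Real.HolderConjugate.conjExponent hp
  have ha : 1 / p.conjExponent = 1 - 1/p := by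
    have := hpc.inv_add_inv_eq_one
    simp only [one_div]; linarith
  have ha0 : 0 < 1 - 1/p := by
    have : 1/p < 1 := by rw [div_lt_one hp0]; exact hp
    linarith
  have hq0 : p.conjExponent ≠ 0 := hpc.symm.pos.ne'
  have haq : (1 - 1/p) * p.conjExponent = 1 := by rw [← ha]; field_simp
  have h := Real.inner_le_Lp_mul_Lq_of_nonneg (s := Finset.univ)
    (f := fun i => W i ^ (1/p) * G i) (g := fun i => W i ^ (1-1/p) * L i ^ (1-1/p)) hpc
    (fun i _ => mul_nonneg (Real.rpow_nonneg (hW i) _) (hG i))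
    (fun i _ => mul_nonneg (Real.rpow_nonneg (hW i) _) (Real.rpow_nonneg (hL i) _))
  have e1 : ∀ i, W i ^ (1/p) * G i * (W i ^ (1-1/p) * L i ^ (1-1/p)) = W i * G i * L i ^ (1-1/p) := by
    intro i
    have : W i ^ (1/p) * W i ^ (1-1/p) = W i := by
      rw [← Real.rpow_add_of_nonneg (hW i) (by positivity) ha0.le]; simp
    calc _ = (W i ^ (1/p) * W i ^ (1-1/p)) * G i * L i ^ (1-1/p) := by ring
      _ = _ := by rw [this]
  have e2 : ∀ i, (W i ^ (1/p) * G i) ^ p = W i * G i ^ p := by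
    intro i
    rw [Real.mul_rpow (Real.rpow_nonneg (hW i) _) (hG i), ← Real.rpow_mul (hW i)]
    congr 1
    rw [one_div_mul_cancel hp0.ne', Real.rpow_one]
  have e3 : ∀ i, (W i ^ (1-1/p) * L i ^ (1-1/p)) ^ p.conjExponent = W i * L i := by
    intro i
    rw [Real.mul_rpow (Real.rpow_nonneg (hW i) _) (Real.rpow_nonneg (hL i) _),
      ← Real.rpow_mul (hW i), ← Real.rpow_mul (hL i), haq, Real.rpow_one, Real.rpow_one]
  simp only [e1, e2, e3] at h
  refine h.trans (mul_le_of_le_one_right (Real.rpow_nonneg (Finset.sum_nonneg fun i _ =>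
    mul_nonneg (hW i) (Real.rpow_nonneg (hG i) _)) _) ?_)
  exact Real.rpow_le_one (Finset.sum_nonneg fun i _ => mul_nonneg (hW i) (hL i)) hWL (by rw [ha]; exact ha0.le)

lemma aux_tangent (a s s₀ : ℝ) (ha : 0 ≤ a) (hs : 0 ≤ s) (hs₀ : 0 ≤ s₀) :
    (1 + s₀) ^ (-a) + a * (1 + s₀) ^ (-a) / (1 + s₀) * (s₀ - s) ≤ (1 + s) ^ (-a) := by
  have h0 : 0 < 1 + s₀ := by linarith
  have hr : 0 < (1 + s) / (1 + s₀) := by positivity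
  set r := (1 + s) / (1 + s₀) with hrdef
  have e : 1 + s = r * (1 + s₀) := by rw [hrdef]; field_simp
  have h1 : 1 - a * (r - 1) ≤ r ^ (-a) := by
    rw [Real.rpow_def_of_pos hr]
    have := Real.add_one_le_exp (Real.log r * -a)
    have h2 := Real.log_le_sub_one_of_pos hr
    nlinarith
  rw [e, Real.mul_rpow hr.le h0.le]
  have h3 : s₀ - s = (1 - r) * (1 + s₀) := by linarith
  have h4 : 0 < (1 + s₀) ^ (-a) := Real.rpow_pos_of_pos h0 _
  have : (1 + s₀) ^ (-a) + a * (1 + s₀) ^ (-a) / (1 + s₀) * (s₀ - s)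
     = (1 - a * (r - 1)) * (1 + s₀) ^ (-a) := by
    rw [h3]; field_simp; ring
  rw [this]
  exact mul_le_mul_of_nonneg_right h1 h4.le

/-- Existence of the norming function for `L¹ + Lᵖ`. -/
lemma aux_dual {Ω : Type*} [Fintype Ω] [MeasurableSpace Ω] [MeasurableSingletonClass Ω]
    (μ : Measure Ω) [IsProbabilityMeasure μ] {I : Type*} [Fintype I]
    (G : I → Ω → ℝ) (hG : ∀ i x, 0 ≤ G i x) (p : ℝ) (hp : 1 ≤ p) :
    ∃ (t : ℝ) (k : ℝ → ℝ), 0 ≤ t ∧ Measurable k ∧ (∀ y, 0 ≤ y → 0 ≤ k y) ∧ (∀ y, 0 ≤ y → k y ≤ 1) ∧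
      ∑ i, ∫ x, k (G i x) ∂μ ≤ 1 ∧
      (∑ i, ∫ x, (G i x - min (G i x) t) ∂μ) + (∑ i, ∫ x, (min (G i x) t) ^ p ∂μ) ^ (1/p)
        ≤ ∑ i, ∫ x, G i x * k (G i x) ^ (1 - 1/p) ∂μ := by
  have hp0 : 0 < p := by linarith
  have hip : 1/p ≠ 0 := by positivity
  by_cases hA : ∑ i, ∫ x, (Set.Ioi (0:ℝ)).indicator (fun _ => (1:ℝ)) (G i x) ∂μ ≤ 1
  · refine ⟨0, (Set.Ioi (0:ℝ)).indicator (fun _ => (1:ℝ)), le_rfl,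
      measurable_const.indicator measurableSet_Ioi, fun y _ => Set.indicator_nonneg (by simp) _,
      fun y _ => Set.indicator_le_self' (by simp) _ |>.trans le_rfl, hA, ?_⟩
    have h1 : ∀ i x, min (G i x) 0 = 0 := fun i x => min_eq_right (hG i x)
    simp only [h1, sub_zero, Real.zero_rpow hp0.ne', integral_zero, Finset.sum_const_zero,
      Real.zero_rpow hip, add_zero]
    refine Finset.sum_le_sum fun i _ => le_of_eq (integral_congr_ae (.of_forall fun x => ?_))
    rcases (hG i x).eq_or_lt with h | h
    · simp [← h]
    · simp [Set.indicator, h]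
  · push Not at hA
    -- small level
    obtain ⟨t₀, ht₀, hsm⟩ : ∃ t₀ : ℝ, 0 < t₀ ∧ ∀ i x, 0 < G i x → t₀ ≤ G i x := by
      let A : Finset ℝ := insert 1 ((Finset.univ.image (fun q : I × Ω => G q.1 q.2)).filter (0 < ·))
      have hne : A.Nonempty := Finset.insert_nonempty _ _
      refine ⟨A.min' hne, ?_, fun i x h => A.min'_le _ ?_⟩
      · have := A.min'_mem hne
        simp only [A, Finset.mem_insert, Finset.mem_filter] at this
        rcases this with h | h
        · rw [h]; norm_num
        · exact h.2
      · simp only [A, Finset.mem_insert, Finset.mem_filter, Finset.mem_image, Finset.mem_univ, true_and]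
        exact Or.inr ⟨⟨(i, x), rfl⟩, h⟩
    let ψ : ℝ → ℝ := fun t => ∑ i, ∫ x, (min (G i x) t) ^ p ∂μ - t ^ p
    have hψc : Continuous ψ := by
      have : ∀ i, Continuous fun t : ℝ => ∫ x, (min (G i x) t) ^ p ∂μ := by
        intro i
        have e : (fun t : ℝ => ∫ x, (min (G i x) t) ^ p ∂μ)
            = fun t : ℝ => ∑ x, μ.real {x} • (min (G i x) t) ^ p :=
          funext fun t => integral_fintype .of_finite
        rw [e]
        have c0 : ∀ x : Ω, Continuous fun t : ℝ => μ.real {x} * min (G i x) t ^ p := by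
          intro x
          have c1 : Continuous fun t : ℝ => min (G i x) t ^ p :=
            (continuous_const.min continuous_id).rpow_const fun _ => Or.inr hp0.le
          exact continuous_const.mul c1
        exact continuous_finsetSum _ fun x _ => c0 x
      exact (continuous_finsetSum _ fun i _ => this i).sub (continuous_id.rpow_const fun _ => Or.inr hp0.le)
    let N := ∑ i, ∫ x, (G i x) ^ p ∂μ
    have hN : 0 ≤ N := Finset.sum_nonneg fun i _ => integral_nonneg fun x => Real.rpow_nonneg (hG i x) _
    let M := t₀ + N ^ (1/p)
    have hM : t₀ ≤ M := le_add_of_nonneg_right (Real.rpow_nonneg hN _)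
    have h1 : 0 ≤ ψ t₀ := by
      have : ∀ i x, (min (G i x) t₀) ^ p = t₀ ^ p * (Set.Ioi (0:ℝ)).indicator (fun _ => (1:ℝ)) (G i x) := by
        intro i x
        rcases (hG i x).eq_or_lt with h | h
        · simp [← h, ht₀.le, Real.zero_rpow hp0.ne']
        · simp [Set.indicator, h, hsm i x h]
      simp only [ψ, this, integral_const_mul, ← Finset.mul_sum]
      have := Real.rpow_pos_of_pos ht₀ p
      nlinarith
    have h2 : ψ M ≤ 0 := by
      have a1 : ∑ i, ∫ x, (min (G i x) M) ^ p ∂μ ≤ N := by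
        refine Finset.sum_le_sum fun i _ => integral_mono .of_finite .of_finite fun x => ?_
        exact Real.rpow_le_rpow (le_min (hG i x) (ht₀.le.trans hM)) (min_le_left _ _) hp0.le
      have a2 : N ≤ M ^ p := by
        calc N = (N ^ (1/p)) ^ p := by rw [← Real.rpow_mul hN, one_div_mul_cancel hp0.ne', Real.rpow_one]
          _ ≤ _ := Real.rpow_le_rpow (Real.rpow_nonneg hN _) (by simp only [M]; linarith) hp0.le
      simp only [ψ]; linarith
    obtain ⟨t, ⟨ht1, _⟩, ht⟩ := intermediate_value_Icc' hM hψc.continuousOn ⟨h2, h1⟩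
    have htp : 0 < t := ht₀.trans_le ht1
    have hS : ∑ i, ∫ x, (min (G i x) t) ^ p ∂μ = t ^ p := by simp only [ψ] at ht; linarith
    have htpp := Real.rpow_pos_of_pos htp p
    have hk0 : ∀ y, 0 ≤ y → 0 ≤ min y t / t := fun y hy => div_nonneg (le_min hy htp.le) htp.le
    refine ⟨t, fun y => (min y t / t) ^ p, htp.le, by fun_prop, fun y hy => Real.rpow_nonneg (hk0 y hy) _,
      fun y hy => Real.rpow_le_one (hk0 y hy) (by rw [div_le_one htp]; exact min_le_right _ _) hp0.le, ?_, ?_⟩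
    · have : ∀ i x, (min (G i x) t / t) ^ p = (min (G i x) t) ^ p * (t ^ p)⁻¹ := fun i x => by
        rw [Real.div_rpow (le_min (hG i x) htp.le) htp.le, div_eq_mul_inv]
      simp only [this, integral_mul_const, ← Finset.sum_mul, hS]
      rw [mul_inv_cancel₀ htpp.ne']
    · have key : ∀ i x, G i x * ((min (G i x) t / t) ^ p) ^ (1 - 1/p)
          = (G i x - min (G i x) t) + (min (G i x) t) ^ p * (t / t ^ p) := by
        intro i x
        rw [← Real.rpow_mul (hk0 _ (hG i x))]
        have : p * (1 - 1/p) = p - 1 := by field_simp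
        rw [this]
        rcases le_total (G i x) t with h | h
        · rw [min_eq_left h]
          rcases (hG i x).eq_or_lt with h0 | h0
          · simp [← h0, Real.zero_rpow hp0.ne']
          · rw [Real.div_rpow h0.le htp.le, Real.rpow_sub_one h0.ne', Real.rpow_sub_one htp.ne']
            field_simp; ring
        · rw [min_eq_right h, div_self htp.ne', Real.one_rpow]
          field_simp; ring
      simp only [key]
      have : ∀ i, ∫ x, ((G i x - min (G i x) t) + (min (G i x) t) ^ p * (t / t ^ p)) ∂μ
          = ∫ x, (G i x - min (G i x) t) ∂μ + (∫ x, (min (G i x) t) ^ p ∂μ) * (t / t ^ p) := fun i => by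
        rw [integral_add .of_finite .of_finite, integral_mul_const]
      simp only [this, Finset.sum_add_distrib, ← Finset.sum_mul, hS]
      rw [← Real.rpow_mul htp.le, mul_one_div_cancel hp0.ne', Real.rpow_one, mul_div_cancel₀ _ htpp.ne']

lemma aux_const (δ a : ℝ) (hδ : 0 < δ) (hδ1 : δ ≤ 1) (ha : 0 ≤ a) :
    δ ^ (1 + a) * (2:ℝ) ^ (-a) ≤ (1 + 1/δ) ^ (-a) * δ := by
  have h1 : (2/δ) ^ (-a) ≤ (1 + 1/δ) ^ (-a) := by
    refine Real.rpow_le_rpow_of_nonpos (by positivity) ?_ (by linarith)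
    rw [le_div_iff₀ hδ]; field_simp; linarith
  have h2 : (2/δ) ^ (-a) = δ ^ a * (2:ℝ) ^ (-a) := by
    rw [Real.div_rpow (by norm_num) hδ.le, Real.rpow_neg hδ.le, div_inv_eq_mul, mul_comm]
  rw [Real.rpow_add hδ, Real.rpow_one]
  rw [h2] at h1
  nlinarith

lemma aux_core {Ω : Type*} [Fintype Ω] [MeasurableSpace Ω] [MeasurableSingletonClass Ω]
    (μ : Measure Ω) [IsProbabilityMeasure μ] {I : Type*} [Fintype I]
    (F : I → MeasurableSpace Ω) (hFle : ∀ i, F i ≤ ‹MeasurableSpace Ω›)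
    (hFindep : iIndep F μ)
    (G : I → Ω → ℝ) (hG : ∀ i x, 0 ≤ G i x) (hGm : ∀ i, Measurable[F i] (G i))
    (W : I → Ω → ℝ) (hW0 : ∀ i x, 0 ≤ W i x) (hW1 : ∀ i x, W i x ≤ 1)
    (δ : ℝ) (hδ : 0 < δ) (hδ1 : δ ≤ 1)
    (hW : ∀ i (R : Ω → ℝ), (∀ x, 0 ≤ R x) → Measurable[F i] R →
      δ * ∫ x, G i x * R x ∂μ ≤ ∫ x, W i x * (G i x * R x) ∂μ)
    (p : ℝ) (hp : 1 ≤ p) (k : ℝ → ℝ) (hkm : Measurable k) (hk0 : ∀ y, 0 ≤ y → 0 ≤ k y)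
    (hk1 : ∀ y, 0 ≤ y → k y ≤ 1) (hks : ∑ i, ∫ x, k (G i x) ∂μ ≤ 1) :
    δ ^ (2 - 1/p) * (2:ℝ) ^ (-(1 - 1/p)) * ∑ i, ∫ x, G i x * k (G i x) ^ (1 - 1/p) ∂μ
      ≤ ∫ x, (∑ i, W i x * G i x ^ p) ^ (1/p) ∂μ := by
  classical
  have hp0 : 0 < p := by linarith
  obtain ⟨a, ha⟩ : ∃ a, a = 1 - 1/p := ⟨_, rfl⟩
  have ha0 : 0 ≤ a := by
    have : 1/p ≤ 1 := by rw [div_le_one hp0]; exact hp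
    linarith
  have h2p : 2 - 1/p = 1 + a := by rw [ha]; ring
  rw [h2p, ← ha]
  set K : I → Ω → ℝ := fun i x => k (G i x) with hK
  have hK0 : ∀ i x, 0 ≤ K i x := fun i x => hk0 _ (hG i x)
  have hK1 : ∀ i x, K i x ≤ 1 := fun i x => hk1 _ (hG i x)
  have hKm : ∀ i, Measurable[F i] (K i) := fun i => hkm.comp (hGm i)
  set S : I → Ω → ℝ := fun i x => ∑ l ∈ Finset.univ.erase i, K l x with hSdef
  have hS0 : ∀ i x, 0 ≤ S i x := fun i x => Finset.sum_nonneg fun l _ => hK0 l x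
  set Q : I → Ω → ℝ := fun i x => G i x * K i x ^ a with hQ
  have hQ0 : ∀ i x, 0 ≤ Q i x := fun i x => mul_nonneg (hG i x) (Real.rpow_nonneg (hK0 i x) _)
  have hQm : ∀ i, Measurable[F i] (Q i) := fun i => (hGm i).mul ((hKm i).pow_const a)
  set A := (1 + 1/δ) ^ (-a) with hA
  set B := a * A / (1 + 1/δ) with hB
  have hA0 : 0 ≤ A := by positivity
  have hB0 : 0 ≤ B := by positivity
  -- pointwise bound
  have hpt : ∀ x, ∑ i, ((A + B * (1/δ)) * (W i x * Q i x) - B * (Q i x * S i x))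
      ≤ (∑ i, W i x * G i x ^ p) ^ (1/p) := by
    intro x
    have hD : ∀ i, ∑ l, K l x ≤ 1 + S i x := fun i => by
      rw [← Finset.add_sum_erase _ _ (Finset.mem_univ i)]
      have := hK1 i x
      simp only [hSdef]; linarith
    have hDn : 0 ≤ ∑ l, K l x := Finset.sum_nonneg fun l _ => hK0 l x
    have hL0 : ∀ i, 0 ≤ K i x / (1 + S i x) := fun i =>
      div_nonneg (hK0 i x) (by have := hS0 i x; linarith)
    have hL : ∑ i, W i x * (K i x / (1 + S i x)) ≤ 1 := by
      have : ∀ i, W i x * (K i x / (1 + S i x)) ≤ K i x / ∑ l, K l x := by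
        intro i
        refine (mul_le_of_le_one_left (hL0 i) (hW1 i x)).trans ?_
        rcases hDn.eq_or_lt with h | h
        · have : K i x = 0 := (Finset.sum_eq_zero_iff_of_nonneg fun l _ => hK0 l x).1 h.symm i (Finset.mem_univ i)
          simp [this]
        · exact div_le_div_of_nonneg_left (hK0 i x) h (hD i)
      refine (Finset.sum_le_sum fun i _ => this i).trans ?_
      rw [← Finset.sum_div]
      exact div_self_le_one _
    have hH := aux_holder (fun i => W i x) (fun i => G i x) (fun i => K i x / (1 + S i x))
      (fun i => hW0 i x) (fun i => hG i x) hL0 p hp hL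
    rw [← ha] at hH
    refine le_trans (Finset.sum_le_sum fun i _ => ?_) hH
    have h1S : 0 ≤ 1 + S i x := by have := hS0 i x; linarith
    rw [Real.div_rpow (hK0 i x) h1S]
    have ht := aux_tangent a (S i x) (1/δ) ha0 (hS0 i x) (by positivity)
    rw [← hA, ← hB] at ht
    have e : W i x * G i x * (K i x ^ a / (1 + S i x) ^ a) = W i x * Q i x * (1 + S i x) ^ (-a) := by
      rw [Real.rpow_neg h1S]; simp only [hQ]; ring
    rw [e]
    have h3 := mul_le_mul_of_nonneg_left ht (mul_nonneg (hW0 i x) (hQ0 i x))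
    have h4 : B * (W i x * Q i x * S i x) ≤ B * (Q i x * S i x) := by
      refine mul_le_mul_of_nonneg_left ?_ hB0
      rw [mul_assoc]
      exact mul_le_of_le_one_left (mul_nonneg (hQ0 i x) (hS0 i x)) (hW1 i x)
    nlinarith
  -- integrate
  have hQS : ∀ i, ∫ x, Q i x * S i x ∂μ ≤ ∫ x, Q i x ∂μ := by
    intro i
    have e : ∀ l ∈ Finset.univ.erase i, ∫ x, Q i x * K l x ∂μ = (∫ x, Q i x ∂μ) * ∫ x, K l x ∂μ := by
      intro l hl
      have hne : i ≠ l := (Finset.ne_of_mem_erase hl).symm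
      have hind : IndepFun (Q i) (K l) μ := by
        rw [IndepFun_iff_Indep]
        exact indep_of_indep_of_le_left (indep_of_indep_of_le_right (hFindep.indep hne)
          (hKm l).comap_le) (hQm i).comap_le
      exact hind.integral_mul_eq_mul_integral
        ((hQm i).mono (hFle i) le_rfl).aestronglyMeasurable
        ((hKm l).mono (hFle l) le_rfl).aestronglyMeasurable
    simp only [hSdef, Finset.mul_sum]
    rw [integral_finsetSum _ fun _ _ => .of_finite, Finset.sum_congr rfl e, ← Finset.mul_sum]
    refine mul_le_of_le_one_right (integral_nonneg (hQ0 i)) (le_trans ?_ hks)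
    exact Finset.sum_le_sum_of_subset_of_nonneg (Finset.erase_subset _ _)
      fun l _ _ => integral_nonneg (hK0 l)
  have hint := integral_mono (μ := μ) (Integrable.of_finite) (Integrable.of_finite) hpt
  refine le_trans ?_ hint
  rw [integral_finsetSum _ fun _ _ => .of_finite, Finset.mul_sum]
  refine Finset.sum_le_sum fun i _ => ?_
  rw [integral_sub .of_finite .of_finite, integral_const_mul, integral_const_mul]
  have h1 : δ * ∫ x, Q i x ∂μ ≤ ∫ x, W i x * Q i x ∂μ :=
    hW i (fun x => K i x ^ a) (fun x => Real.rpow_nonneg (hK0 i x) _) ((hKm i).pow_const a)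
  have h2 := hQS i
  have h3 : 0 ≤ ∫ x, Q i x ∂μ := integral_nonneg (hQ0 i)
  have h4 := aux_const δ a hδ hδ1 ha0
  rw [← hA] at h4
  have h5 := mul_le_mul_of_nonneg_left h1 (show 0 ≤ A + B * (1/δ) by positivity)
  have h6 := mul_le_mul_of_nonneg_left h2 hB0
  have h7 := mul_le_mul_of_nonneg_right h4 h3
  have h8 : (A + B * (1/δ)) * (δ * ∫ x, Q i x ∂μ) = A * δ * (∫ x, Q i x ∂μ) + B * ∫ x, Q i x ∂μ := by
    field_simp
  linarith

/-- **Weighted inequality, `{0,1}`-valued weights**: under the hypotheses of the weighted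
inequality, if moreover every weight `w i j` takes only the values `0` and `1`, then the
conclusion holds with the improved constant `(κ - ε)^(2 - 1/p) · 2^{-1/p'}`. -/
theorem weighted_inequality_boolean_weights
    {Ω : Type*} [Fintype Ω] [MeasurableSpace Ω] [MeasurableSingletonClass Ω]
    (μ : Measure Ω) [IsProbabilityMeasure μ]
    {I J : Type*} [Fintype I] [Fintype J]
    (F : I → MeasurableSpace Ω) (hFle : ∀ i, F i ≤ ‹MeasurableSpace Ω›)
    (hFindep : iIndep F μ)
    (f : I → J → Ω → ℝ) (hfmeas : ∀ i j, Measurable[F i] (f i j))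
    (w : I → J → Ω → ℝ) (hw01 : ∀ i j x, w i j x ∈ Set.Icc (0:ℝ) 1)
    (hwbool : ∀ i j x, w i j x = 0 ∨ w i j x = 1)
    (p : ℝ) (hp : 1 ≤ p) (ε κ : ℝ) (hε : 0 ≤ ε) (hεκ : ε < κ) (hκ : κ ≤ 1) :
    (κ - ε) ^ (2 - 1/p) * (2:ℝ) ^ (-(1 - 1/p)) *
      sInf {s : ℝ | ∃ g₀ g₁ : I → J → Ω → ℝ,
        (∀ i j, Measurable[F i] (g₀ i j)) ∧ (∀ i j, Measurable[F i] (g₁ i j)) ∧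
        (∀ i j, Set.indicator {x | κ ≤ (μ[fun y => max (w i j y) ε | F i]) x} (f i j)
            = g₀ i j + g₁ i j) ∧
        s = (∑ i, ∫ x, (∑ j, |g₀ i j x| ^ p) ^ (1/p) ∂μ)
            + (∑ i, ∫ x, ∑ j, |g₁ i j x| ^ p ∂μ) ^ (1/p)}
    ≤ ∫ x, (∑ i, ∑ j, |max (w i j x) ε * f i j x| ^ p) ^ (1/p) ∂μ := by
  have hp0 : 0 < p := by linarith
  have hip : 1/p ≠ 0 := by positivity
  set h : I → J → Ω → ℝ := fun i j =>
    Set.indicator {x | κ ≤ (μ[fun y => max (w i j y) ε | F i]) x} (f i j) with hh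
  have hhm : ∀ i j, Measurable[F i] (h i j) := fun i j =>
    (hfmeas i j).indicator (measurableSet_le measurable_const stronglyMeasurable_condExp.measurable)
  set T : I → Ω → ℝ := fun i x => ∑ j, |h i j x| ^ p with hT
  have hT0 : ∀ i x, 0 ≤ T i x := fun i x => Finset.sum_nonneg fun j _ => by positivity
  have hTm : ∀ i, Measurable[F i] (T i) := fun i =>
    Finset.measurable_fun_sum _ fun j _ => (measurable_abs.comp (hhm i j)).pow_const p
  set G : I → Ω → ℝ := fun i x => T i x ^ (1/p) with hGdef
  have hG0 : ∀ i x, 0 ≤ G i x := fun i x => Real.rpow_nonneg (hT0 i x) _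
  have hGm : ∀ i, Measurable[F i] (G i) := fun i => (hTm i).pow_const _
  have hGp : ∀ i x, G i x ^ p = T i x := fun i x => by
    simp only [hGdef]
    rw [← Real.rpow_mul (hT0 i x), one_div_mul_cancel hp0.ne', Real.rpow_one]
  have hTG : ∀ i x, G i x ≠ 0 → T i x ≠ 0 := fun i x hg ht => hg (by
    simp only [hGdef, ht]; exact Real.zero_rpow hip)
  obtain ⟨t, k, ht, hkm, hk0, hk1, hks, hdual⟩ := aux_dual μ G hG0 p hp
  set W : I → Ω → ℝ := fun i x => (∑ j, w i j x * |h i j x| ^ p) / T i x with hWdef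
  have hnum : ∀ i x, ∑ j, w i j x * |h i j x| ^ p ≤ T i x := fun i x =>
    Finset.sum_le_sum fun j _ => mul_le_of_le_one_left (by positivity) (hw01 i j x).2
  have hnum0 : ∀ i x, 0 ≤ ∑ j, w i j x * |h i j x| ^ p := fun i x =>
    Finset.sum_nonneg fun j _ => mul_nonneg (hw01 i j x).1 (by positivity)
  have hW0 : ∀ i x, 0 ≤ W i x := fun i x => div_nonneg (hnum0 i x) (hT0 i x)
  have hW1 : ∀ i x, W i x ≤ 1 := fun i x => div_le_one_of_le₀ (hnum i x) (hT0 i x)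
  have hWG : ∀ i x, W i x * G i x ^ p = ∑ j, w i j x * |h i j x| ^ p := fun i x => by
    rw [hGp]
    rcases (hT0 i x).eq_or_lt with h0 | h0
    · have := hnum i x
      have := hnum0 i x
      rw [← h0, mul_zero]; linarith
    · simp only [hWdef]; field_simp
  -- conditional expectation bound
  have hcond : ∀ i j (R : Ω → ℝ), (∀ x, 0 ≤ R x) → Measurable[F i] R →
      (∀ x, R x ≠ 0 → κ ≤ (μ[fun y => max (w i j y) ε | F i]) x) →
      (κ - ε) * ∫ x, R x ∂μ ≤ ∫ x, w i j x * R x ∂μ := by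
    intro i j R hR0 hRm hRs
    have h1 : ∫ x, max (w i j x) ε * R x ∂μ = ∫ x, (μ[fun y => max (w i j y) ε | F i]) x * R x ∂μ := by
      have := condExp_mul_of_stronglyMeasurable_right (μ := μ) (m := F i)
        (f := fun y => max (w i j y) ε) (g := R) hRm.stronglyMeasurable .of_finite .of_finite
      rw [← integral_condExp (hFle i)]
      exact integral_congr_ae this
    have h2 : κ * ∫ x, R x ∂μ ≤ ∫ x, max (w i j x) ε * R x ∂μ := by
      rw [h1, ← integral_const_mul]
      refine integral_mono .of_finite .of_finite fun x => ?_
      by_cases hx : R x = 0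
      · simp [hx]
      · exact mul_le_mul_of_nonneg_right (hRs x hx) (hR0 x)
    have h3 : ∫ x, max (w i j x) ε * R x ∂μ ≤ ∫ x, (w i j x * R x + ε * R x) ∂μ := by
      refine integral_mono .of_finite .of_finite fun x => ?_
      simp only [← add_mul]
      refine mul_le_mul_of_nonneg_right (max_le ?_ ?_) (hR0 x) <;> have := (hw01 i j x).1 <;> linarith
    rw [integral_add .of_finite .of_finite, integral_const_mul] at h3
    linarith
  have hWint : ∀ i (R : Ω → ℝ), (∀ x, 0 ≤ R x) → Measurable[F i] R →
      (κ - ε) * ∫ x, G i x * R x ∂μ ≤ ∫ x, W i x * (G i x * R x) ∂μ := by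
    intro i R hR0 hRm
    have e1 : ∀ x, G i x * R x = ∑ j, |h i j x| ^ p * (G i x * R x / T i x) := fun x => by
      rw [← Finset.sum_mul]
      change _ = T i x * _
      by_cases hg : G i x = 0
      · simp [hg]
      · have := hTG i x hg
        field_simp
    have e2 : ∀ x, W i x * (G i x * R x) = ∑ j, w i j x * (|h i j x| ^ p * (G i x * R x / T i x)) := fun x => by
      simp only [← mul_assoc (w i _ x)]
      rw [← Finset.sum_mul]
      simp only [hWdef]; ring
    rw [integral_congr_ae (.of_forall e1), integral_congr_ae (.of_forall e2),
      integral_finsetSum _ fun _ _ => .of_finite, integral_finsetSum _ fun _ _ => .of_finite,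
      Finset.mul_sum]
    refine Finset.sum_le_sum fun j _ => hcond i j _ (fun x => ?_) ?_ fun x hx => ?_
    · exact mul_nonneg (by positivity) (div_nonneg (mul_nonneg (hG0 i x) (hR0 x)) (hT0 i x))
    · exact ((measurable_abs.comp (hhm i j)).pow_const p).mul (((hGm i).mul hRm).div (hTm i))
    · by_contra hc
      apply hx
      have : h i j x = 0 := by
        simp only [hh, Set.indicator, Set.mem_ofPred_eq, if_neg hc]
      simp [this, Real.zero_rpow hp0.ne']
  have hcore := aux_core μ F hFle hFindep G hG0 hGm W hW0 hW1 (κ - ε) (by linarith) (by linarith)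
    hWint p hp k hkm hk0 hk1 hks
  -- right-hand side
  have hrhs : ∫ x, (∑ i, W i x * G i x ^ p) ^ (1/p) ∂μ
      ≤ ∫ x, (∑ i, ∑ j, |max (w i j x) ε * f i j x| ^ p) ^ (1/p) ∂μ := by
    refine integral_mono .of_finite .of_finite fun x => ?_
    simp only [hWG]
    refine Real.rpow_le_rpow (Finset.sum_nonneg fun i _ => hnum0 i x) ?_ (by positivity)
    refine Finset.sum_le_sum fun i _ => Finset.sum_le_sum fun j _ => ?_
    have hhf : |h i j x| ≤ |f i j x| := by
      simp only [hh, Set.indicator]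
      split_ifs <;> simp
    rcases hwbool i j x with hw | hw
    · rw [hw, zero_mul]; positivity
    · rw [hw, max_eq_left (by linarith), one_mul, one_mul]
      exact Real.rpow_le_rpow (abs_nonneg _) hhf hp0.le
  refine le_trans (mul_le_mul_of_nonneg_left ?_ ?_) (hcore.trans hrhs)
  swap
  · have : 0 < κ - ε := by linarith
    positivity
  refine le_trans (csInf_le ⟨0, ?_⟩ ?_) hdual
  · rintro s ⟨g₀, g₁, -, -, -, rfl⟩
    refine add_nonneg (Finset.sum_nonneg fun i _ => integral_nonneg fun x => ?_)
      (Real.rpow_nonneg (Finset.sum_nonneg fun i _ => integral_nonneg fun x => ?_) _)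
    · exact Real.rpow_nonneg (Finset.sum_nonneg fun j _ => by positivity) _
    · exact Finset.sum_nonneg fun j _ => by positivity
  · have hm0 : ∀ i x, 0 ≤ min (G i x) t := fun i x => le_min (hG0 i x) ht
    have hr0 : ∀ i x, 0 ≤ min (G i x) t / G i x := fun i x => div_nonneg (hm0 i x) (hG0 i x)
    have hr1 : ∀ i x, min (G i x) t / G i x ≤ 1 := fun i x =>
      div_le_one_of_le₀ (min_le_left _ _) (hG0 i x)
    have hrm : ∀ i, Measurable[F i] fun x => min (G i x) t / G i x := fun i =>
      ((hGm i).min measurable_const).div (hGm i)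
    refine ⟨fun i j x => h i j x * (1 - min (G i x) t / G i x),
      fun i j x => h i j x * (min (G i x) t / G i x), fun i j => (hhm i j).mul (measurable_const.sub (hrm i)),
      fun i j => (hhm i j).mul (hrm i), fun i j => ?_, ?_⟩
    · funext x
      simp only [Pi.add_apply]; ring
    · have key : ∀ i x (c : ℝ), 0 ≤ c → ∑ j, |h i j x * c| ^ p = (G i x * c) ^ p := by
        intro i x c hc
        rw [Real.mul_rpow (hG0 i x) hc, hGp]
        simp only [hT, Finset.sum_mul]
        refine Finset.sum_congr rfl fun j _ => ?_
        rw [abs_mul, abs_of_nonneg hc, Real.mul_rpow (abs_nonneg _) hc]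
      have k2 : ∀ i x, G i x * (min (G i x) t / G i x) = min (G i x) t := by
        intro i x
        by_cases hg : G i x = 0
        · simp [hg, ht]
        · field_simp
      have k1 : ∀ i x, G i x * (1 - min (G i x) t / G i x) = G i x - min (G i x) t := by
        intro i x
        rw [mul_sub, k2, mul_one]
      have k3 : ∀ i x, ((G i x - min (G i x) t) ^ p) ^ (1/p) = G i x - min (G i x) t := by
        intro i x
        rw [← Real.rpow_mul (sub_nonneg.2 (min_le_left _ _)), mul_one_div_cancel hp0.ne', Real.rpow_one]
      simp only [key _ _ _ (hr0 _ _), key _ _ _ (sub_nonneg.2 (hr1 _ _)), k1, k2, k3]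
end

section
/- Let 1 ≤ p ≤ 2, let (Ω, μ) be a probability space, and let f_1,…,f_n ∈ L^p(Ω) each have mean zero. Then (∫_{Ω^n} |∑_i f_i(x_i)|^p dx)^{1/p} is equivalent, with constants depending only on p, to inf{ (∑_i ∫_Ω |g_i|^2 dμ)^{1/2} + (∑_i ∫_Ω |h_i|^p dμ)^{1/p} : f_i = g_i + h_i for all i }; moreover the infimum is unchanged up to constants if one additionally requires every g_i and h_i to have mean zero. -/
open MeasureTheory
open scoped ENNReal

universe u

/-- The set of values `(∑ i ∫ |g i|²)^(1/2) + (∑ i ∫ |h i|^p)^(1/p)` over all decompositions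
`f i = g i + h i` (with all `g i, h i` of mean zero when `mz = true`). -/
noncomputable def decompVals (p : ℝ) {Ω : Type u} [MeasurableSpace Ω] (μ : Measure Ω)
    {n : ℕ} (f : Fin n → Ω → ℝ) (mz : Bool) : Set ℝ≥0∞ :=
  {s | ∃ g h : Fin n → Ω → ℝ,
    (∀ i, Measurable (g i)) ∧ (∀ i, Measurable (h i)) ∧
    (∀ i, f i = g i + h i) ∧
    (mz = true → (∀ i, ∫ ω, g i ω ∂μ = 0) ∧ (∀ i, ∫ ω, h i ω ∂μ = 0)) ∧
    s = (∑ i, ∫⁻ ω, ENNReal.ofReal (g i ω ^ 2) ∂μ) ^ ((1:ℝ)/2)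
        + (∑ i, ∫⁻ ω, ENNReal.ofReal (|h i ω| ^ p) ∂μ) ^ (1/p)}

open ProbabilityTheory

/-- tangent line inequality for `|1+t|^p`. -/
lemma js_bern (p : ℝ) (hp1 : 1 ≤ p) (t : ℝ) : 1 + p * t ≤ |1 + t| ^ p := by
  rcases le_or_gt (-1) t with h | h
  · rw [abs_of_nonneg (by linarith)]
    exact one_add_mul_self_le_rpow_one_add h hp1
  · have : 0 ≤ |1 + t| ^ p := by positivity
    nlinarith

lemma js_bern_up (p : ℝ) (hp1 : 1 ≤ p) (hp2 : p ≤ 2) (t : ℝ) :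
    |1 + t| ^ p ≤ 1 + p * t + 6 * |t| ^ p := by
  rcases le_or_gt |t| 1 with h | h
  · have h' := abs_le.1 h
    have h0 : 0 ≤ 1 + t := by linarith
    have h1 : |1 + t| ^ p ≤ 1 + p * t + (p - 1) * t ^ 2 := by
      rw [abs_of_nonneg h0]
      have e : (1 + t) ^ p = (1 + t) * (1 + t) ^ (p - 1) := by
        rcases eq_or_lt_of_le h0 with h2 | h2
        · rw [← h2, Real.zero_rpow (by linarith), zero_mul]
        · rw [Real.rpow_sub h2, Real.rpow_one]; field_simp
      have h3 := rpow_one_add_le_one_add_mul_self (s := t) (p := p - 1) (by linarith)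
        (by linarith) (by linarith)
      rw [e]
      nlinarith
    have h2 : t ^ 2 ≤ |t| ^ p := by
      have := Real.rpow_le_rpow_of_exponent_ge' (abs_nonneg t) h (by linarith) hp2
      simpa using this
    have := sq_nonneg t
    nlinarith
  · have h1 : |1 + t| ^ p ≤ 4 * |t| ^ p := by
      calc |1 + t| ^ p ≤ (2 * |t|) ^ p := by
            apply Real.rpow_le_rpow (abs_nonneg _) _ (by linarith)
            have := abs_add_le 1 t
            simp at this; linarith
        _ = 2 ^ p * |t| ^ p := by rw [Real.mul_rpow (by norm_num) (abs_nonneg _)]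
        _ ≤ 4 * |t| ^ p := by
            gcongr
            have := Real.rpow_le_rpow_of_exponent_le (x := 2) (by norm_num) hp2
            norm_num at this; linarith
    have h2 : |t| ≤ |t| ^ p := by
      simpa using Real.rpow_le_rpow_of_exponent_le h.le hp1
    have := neg_abs_le t
    nlinarith [abs_nonneg t]

noncomputable def jsG (p a : ℝ) : ℝ := p * a * |a| ^ (p - 2)

lemma jsG_mul (p a b : ℝ) (ha : a ≠ 0) : jsG p a * b = |a| ^ p * (p * (b / a)) := by
  have h : 0 < |a| := abs_pos.2 ha
  unfold jsG
  rw [Real.rpow_sub h, Real.rpow_two, sq_abs]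
  field_simp

lemma js_abs_add (p a b : ℝ) (ha : a ≠ 0) : |a + b| ^ p = |a| ^ p * |1 + b / a| ^ p := by
  rw [← Real.mul_rpow (abs_nonneg _) (abs_nonneg _), ← abs_mul]
  congr 2; field_simp

lemma js_lower (p : ℝ) (hp1 : 1 ≤ p) (a b : ℝ) :
    |a| ^ p + jsG p a * b ≤ |a + b| ^ p := by
  rcases eq_or_ne a 0 with rfl | ha
  · have : 0 ≤ |b| ^ p := by positivity
    simpa [jsG, Real.zero_rpow (show p ≠ 0 by linarith)] using this
  · rw [jsG_mul p a b ha, js_abs_add p a b ha]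
    have := js_bern p hp1 (b / a)
    have h0 : 0 ≤ |a| ^ p := by positivity
    nlinarith

lemma js_upper (p : ℝ) (hp1 : 1 ≤ p) (hp2 : p ≤ 2) (a b : ℝ) :
    |a + b| ^ p ≤ |a| ^ p + jsG p a * b + 6 * |b| ^ p := by
  rcases eq_or_ne a 0 with rfl | ha
  · have : 0 ≤ |b| ^ p := by positivity
    simp [jsG, Real.zero_rpow (show p ≠ 0 by linarith)]; linarith
  · rw [jsG_mul p a b ha, js_abs_add p a b ha]
    have := js_bern_up p hp1 hp2 (b / a)
    have h0 : 0 ≤ |a| ^ p := by positivity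
    have h1 : |a| ^ p * |b / a| ^ p = |b| ^ p := by
      rw [← Real.mul_rpow (abs_nonneg _) (abs_nonneg _), ← abs_mul]
      congr 2; field_simp
    nlinarith

lemma jsG_bound (p : ℝ) (hp1 : 1 ≤ p) (hp2 : p ≤ 2) (a : ℝ) :
    |jsG p a| ≤ 2 * (1 + |a| ^ p) := by
  rcases eq_or_ne a 0 with rfl | ha
  · simp [jsG]; positivity
  · have h : 0 < |a| := abs_pos.2 ha
    have e : |jsG p a| = p * |a| ^ (p - 1) := by
      unfold jsG
      rw [abs_mul, abs_mul, abs_of_nonneg (by linarith : 0 ≤ p), abs_of_nonneg (by positivity :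
        0 ≤ |a| ^ (p - 2)), mul_assoc]
      congr 1
      rw [show p - 1 = 1 + (p - 2) by ring, Real.rpow_add h, Real.rpow_one]
    have h2 : |a| ^ (p - 1) ≤ 1 + |a| ^ p := by
      rcases le_or_gt |a| 1 with h1 | h1
      · have := Real.rpow_le_one h.le h1 (show 0 ≤ p - 1 by linarith)
        have : 0 ≤ |a| ^ p := by positivity
        linarith
      · have := Real.rpow_le_rpow_of_exponent_le h1.le (show p - 1 ≤ p by linarith)
        linarith
    rw [e]
    have : 0 ≤ |a| ^ (p - 1) := by positivity
    nlinarith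

lemma jsG_meas (p : ℝ) : Measurable (jsG p) := by
  unfold jsG; fun_prop

/-- the strictly convex function -/
noncomputable def jsF (p a : ℝ) : ℝ := (1 + a ^ 2) ^ (p / 2)
noncomputable def jsD (p a : ℝ) : ℝ := p * a * (1 + a ^ 2) ^ (p / 2 - 1)
noncomputable def jsK (p b : ℝ) : ℝ := min (b ^ 2) (|b| ^ p)

lemma sq_rpow_half (p x : ℝ) : (x ^ 2) ^ (p / 2) = |x| ^ p := by
  rw [← sq_abs, ← Real.rpow_two, ← Real.rpow_mul (abs_nonneg _)]
  congr 1; ring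

lemma jsF_norm (p a b : ℝ) : jsF p (a + b) =
    jsF p a * (1 + 2 * (a * b / (1 + a ^ 2)) + b ^ 2 / (1 + a ^ 2)) ^ (p / 2) := by
  have h : 0 < 1 + a ^ 2 := by positivity
  have e : (1 + 2 * (a * b / (1 + a ^ 2)) + b ^ 2 / (1 + a ^ 2)) =
    (1 + (a + b) ^ 2) / (1 + a ^ 2) := by field_simp; ring
  rw [e]
  unfold jsF
  rw [← Real.mul_rpow h.le (by positivity)]
  congr 1; field_simp

lemma jsD_norm (p a b : ℝ) : jsD p a * b = jsF p a * (p * (a * b / (1 + a ^ 2))) := by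
  have h : 0 < 1 + a ^ 2 := by positivity
  unfold jsD jsF
  rw [Real.rpow_sub h, Real.rpow_one]
  field_simp

lemma jsF_one_le (p a : ℝ) (hp1 : 1 ≤ p) : 1 ≤ jsF p a :=
  Real.one_le_rpow (by nlinarith [sq_nonneg a]) (by linarith)

lemma jsF_convex (p : ℝ) (hp1 : 1 ≤ p) (a b : ℝ) : jsF p a + jsD p a * b ≤ jsF p (a + b) := by
  rw [jsF_norm, jsD_norm]
  have h0 := jsF_one_le p a hp1
  have h : 0 < 1 + a ^ 2 := by positivity
  set α := a * b / (1 + a ^ 2) with hα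
  have h1 : 1 + p * α ≤ (1 + 2 * α + b ^ 2 / (1 + a ^ 2)) ^ (p / 2) := by
    refine (js_bern p hp1 α).trans ?_
    rw [← sq_rpow_half]
    apply Real.rpow_le_rpow (by positivity) _ (by linarith)
    have : α ^ 2 ≤ b ^ 2 / (1 + a ^ 2) := by
      rw [hα, div_pow, div_le_div_iff₀ (by positivity) h]
      nlinarith [mul_nonneg (sq_nonneg b) h.le]
    nlinarith
  nlinarith

/-- increments of the concave power -/
lemma js_concave (r x g : ℝ) (hr0 : 1 / 2 ≤ r) (hr1 : r ≤ 1) (hx : 0 ≤ x) (hg : 0 ≤ g)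
    (hxg : x ≤ 2 + 2 * g) : x ^ r + (1 / 10) * min g (g ^ r) ≤ (x + g) ^ r := by
  rcases eq_or_lt_of_le hg with rfl | hg
  · rw [Real.zero_rpow (by linarith)]; simp
  have hy : 0 < x + g := by linarith
  have h1 : x ^ r ≤ (x + g) ^ r - r * g * (x + g) ^ (r - 1) := by
    have := rpow_one_add_le_one_add_mul_self (s := x / (x + g) - 1) (p := r)
      (by have : 0 ≤ x / (x + g) := by positivity
          linarith) (by linarith) hr1
    rw [show 1 + (x / (x + g) - 1) = x / (x + g) by ring, Real.div_rpow hx hy.le,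
      div_le_iff₀ (by positivity)] at this
    refine this.trans (le_of_eq ?_)
    rw [Real.rpow_sub hy, Real.rpow_one]
    field_simp
    ring
  have h5 : (1 : ℝ) / 5 ≤ 5 ^ (r - 1) := by
    have := Real.rpow_le_rpow_of_exponent_le (x := 5) (by norm_num) (show (-1 : ℝ) ≤ r - 1 by linarith)
    rw [Real.rpow_neg_one] at this
    linarith
  have h2 : (1 / 10) * min g (g ^ r) ≤ r * g * (x + g) ^ (r - 1) := by
    rcases le_or_gt g 1 with h | h
    · have h3 : (5 : ℝ) ^ (r - 1) ≤ (x + g) ^ (r - 1) :=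
        Real.rpow_le_rpow_of_nonpos hy (by linarith) (by linarith)
      have h4 := min_le_left g (g ^ r)
      have h6 : 1 / 5 ≤ (x + g) ^ (r - 1) := h5.trans h3
      have h7 : 1 / 10 ≤ r * (x + g) ^ (r - 1) := by nlinarith
      nlinarith
    · have h3 : (5 * g : ℝ) ^ (r - 1) ≤ (x + g) ^ (r - 1) :=
        Real.rpow_le_rpow_of_nonpos hy (by linarith) (by linarith)
      rw [Real.mul_rpow (by norm_num) hg.le] at h3
      have h4 := min_le_right g (g ^ r)
      have h8 : g ^ r = g * g ^ (r - 1) := by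
        rw [Real.rpow_sub hg, Real.rpow_one]; field_simp
      have h9 : 0 < g ^ (r - 1) := by positivity
      have h6 : 1 / 5 * g ^ (r - 1) ≤ (x + g) ^ (r - 1) := by nlinarith
      have h7 : 1 / 10 * g ^ (r - 1) ≤ r * (x + g) ^ (r - 1) := by nlinarith
      nlinarith
  linarith

lemma jsF_strict (p : ℝ) (hp1 : 1 ≤ p) (hp2 : p ≤ 2) (a b : ℝ) (ha : |a| ≤ 1) :
    jsF p a + jsD p a * b + 1 / 40 * jsK p b ≤ jsF p (a + b) := by
  rw [jsF_norm, jsD_norm]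
  have h0 := jsF_one_le p a hp1
  have h : 0 < 1 + a ^ 2 := by positivity
  have ha2 : a ^ 2 ≤ 1 := by rwa [sq_le_one_iff_abs_le_one]
  set α := a * b / (1 + a ^ 2) with hα
  set β := b ^ 2 / (1 + a ^ 2) with hβ
  have hβ0 : 0 ≤ β := by positivity
  have hαβ : 2 * α ^ 2 ≤ β := by
    rw [hα, hβ, div_pow, ← mul_div_assoc, div_le_div_iff₀ (by positivity) h]
    nlinarith [mul_nonneg (mul_nonneg (sq_nonneg b) h.le) (sub_nonneg.2 ha2)]
  have h1 := js_bern p hp1 α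
  have h2 := js_concave (p / 2) ((1 + α) ^ 2) (β / 2) (by linarith) (by linarith)
    (by positivity) (by positivity) (by nlinarith [sq_nonneg (1 - α)])
  rw [sq_rpow_half] at h2
  have h3 : ((1 + α) ^ 2 + β / 2) ^ (p / 2) ≤ (1 + 2 * α + β) ^ (p / 2) := by
    apply Real.rpow_le_rpow (by positivity) _ (by linarith)
    nlinarith
  have h4 : b ^ 2 / 4 ≤ β / 2 := by
    rw [hβ, div_div, div_le_div_iff₀ (by norm_num) (by positivity)]
    nlinarith [mul_nonneg (sq_nonneg b) (sub_nonneg.2 ha2)]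
  have h5 : 1 / 4 * jsK p b ≤ min (β / 2) ((β / 2) ^ (p / 2)) := by
    apply le_min
    · have := min_le_left (b ^ 2) (|b| ^ p)
      unfold jsK; linarith
    · have h6 : (b ^ 2 / 4) ^ (p / 2) ≤ (β / 2) ^ (p / 2) :=
        Real.rpow_le_rpow (by positivity) h4 (by linarith)
      rw [Real.div_rpow (by positivity) (by norm_num), sq_rpow_half] at h6
      have h7 : (4 : ℝ) ^ (p / 2) ≤ 4 := by
        simpa using Real.rpow_le_rpow_of_exponent_le (x := 4) (by norm_num)
          (show p / 2 ≤ 1 by linarith)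
      have h8 : |b| ^ p / 4 ≤ |b| ^ p / 4 ^ (p / 2) := by gcongr
      have := min_le_right (b ^ 2) (|b| ^ p)
      unfold jsK; linarith
  have h6 : 0 ≤ jsK p b := le_min (by positivity) (by positivity)
  have h7 : 1 + p * α + 1 / 40 * jsK p b ≤ (1 + 2 * α + β) ^ (p / 2) := by linarith
  nlinarith

lemma jsF_main (p : ℝ) (hp1 : 1 ≤ p) (hp2 : p ≤ 2) (a b : ℝ) :
    jsF p a + jsD p a * b + (1 - |a| ^ p) * (1 / 40 * jsK p b) ≤ jsF p (a + b) := by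
  have h6 : 0 ≤ jsK p b := le_min (by positivity) (by positivity)
  have h7 : 0 ≤ |a| ^ p := by positivity
  rcases le_or_gt |a| 1 with h | h
  · have := jsF_strict p hp1 hp2 a b h
    nlinarith
  · have := jsF_convex p hp1 a b
    have h8 : 1 ≤ |a| ^ p := Real.one_le_rpow h.le (by linarith)
    nlinarith

lemma jsF_le (p : ℝ) (hp1 : 1 ≤ p) (hp2 : p ≤ 2) (a : ℝ) : jsF p a ≤ 1 + |a| ^ p := by
  unfold jsF
  have := Real.rpow_add_le_add_rpow (a := 1) (b := a ^ 2) (p := p / 2) (by norm_num) (by positivity)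
    (by linarith) (by linarith)
  rwa [sq_rpow_half, Real.one_rpow] at this

lemma jsD_bound (p : ℝ) (hp1 : 1 ≤ p) (hp2 : p ≤ 2) (a : ℝ) : |jsD p a| ≤ 2 * (1 + |a| ^ p) := by
  have h : 0 < 1 + a ^ 2 := by positivity
  refine le_trans ?_ (mul_le_mul_of_nonneg_left (jsF_le p hp1 hp2 a) (by norm_num))
  have e : |jsD p a| = p * |a| / (1 + a ^ 2) * jsF p a := by
    unfold jsD jsF
    rw [abs_mul, abs_mul, abs_of_nonneg (by linarith : 0 ≤ p), abs_of_nonneg (by positivity :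
        0 ≤ (1 + a ^ 2) ^ (p / 2 - 1)), Real.rpow_sub h, Real.rpow_one]
    field_simp
  have := jsF_one_le p a hp1
  rw [e]
  gcongr
  rw [div_le_iff₀ h]
  nlinarith [sq_nonneg (|a| - 1), sq_abs a, abs_nonneg a]

lemma jsD_meas (p : ℝ) : Measurable (jsD p) := by
  unfold jsD; fun_prop
lemma jsF_meas (p : ℝ) : Measurable (jsF p) := by
  unfold jsF; fun_prop
lemma jsK_meas (p : ℝ) : Measurable (jsK p) := by
  unfold jsK; fun_prop

section prob
variable {Ω' : Type*} [MeasurableSpace Ω'] {P : Measure Ω'}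

lemma js_int {p : ℝ} (hp1 : 1 ≤ p) {X : Ω' → ℝ} (hX : MemLp X (ENNReal.ofReal p) P) :
    Integrable (fun ω => |X ω| ^ p) P := by
  have h := hX.integrable_norm_rpow (by simp; linarith) (by simp)
  rw [ENNReal.toReal_ofReal (by linarith)] at h
  simpa using h

lemma js_generic {X Y : Ω' → ℝ} (hXY : IndepFun X Y P) (hYi : Integrable Y P)
    (hY0 : ∫ ω, Y ω ∂P = 0) {F G H K : ℝ → ℝ} (hG : Measurable G) (hH : Measurable H)
    (hK : Measurable K) (iF : Integrable (fun ω => F (X ω)) P)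
    (iF' : Integrable (fun ω => F (X ω + Y ω)) P)
    (iG : Integrable (fun ω => G (X ω)) P) (iH : Integrable (fun ω => H (X ω)) P)
    (iK : Integrable (fun ω => K (Y ω)) P)
    (hb : ∀ a b, F a + G a * b + H a * K b ≤ F (a + b)) :
    ∫ ω, F (X ω) ∂P + (∫ ω, H (X ω) ∂P) * (∫ ω, K (Y ω) ∂P) ≤ ∫ ω, F (X ω + Y ω) ∂P := by
  have ind1 : IndepFun (fun ω => G (X ω)) Y P := hXY.comp hG measurable_id
  have ind2 : IndepFun (fun ω => H (X ω)) (fun ω => K (Y ω)) P := hXY.comp hH hK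
  have i1 : Integrable (fun ω => G (X ω) * Y ω) P := ind1.integrable_mul iG hYi
  have i2 : Integrable (fun ω => H (X ω) * K (Y ω)) P := ind2.integrable_mul iH iK
  have e1 := ind1.integral_fun_mul_eq_mul_integral iG.1 hYi.1
  have e2 := ind2.integral_fun_mul_eq_mul_integral iH.1 iK.1
  have := integral_mono ((iF.add i1).add i2) iF' (fun ω => hb (X ω) (Y ω))
  rw [integral_add' (iF.add i1) i2, integral_add' iF i1, e1, e2, hY0, mul_zero, add_zero] at this
  exact this

variable [IsProbabilityMeasure P]

lemma js_int_of_bound {p C : ℝ} (hp1 : 1 ≤ p) {X : Ω' → ℝ} (hX : MemLp X (ENNReal.ofReal p) P)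
    (hXm : Measurable X) {G : ℝ → ℝ} (hG : Measurable G) (hb : ∀ a, |G a| ≤ C * (1 + |a| ^ p)) :
    Integrable (fun ω => G (X ω)) P := by
  refine Integrable.mono' (((integrable_const 1).add (js_int hp1 hX)).const_mul C)
    (hG.comp hXm).aestronglyMeasurable (Filter.Eventually.of_forall fun ω => ?_)
  simpa using hb (X ω)

lemma js_jensen {p : ℝ} (hp1 : 1 ≤ p) (hp2 : p ≤ 2) {X Y : Ω' → ℝ} (hXY : IndepFun X Y P)
    (hXm : Measurable X)
    (hX : MemLp X (ENNReal.ofReal p) P) (hY : MemLp Y (ENNReal.ofReal p) P)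
    (hYi : Integrable Y P) (hY0 : ∫ ω, Y ω ∂P = 0) :
    ∫ ω, |X ω| ^ p ∂P ≤ ∫ ω, |X ω + Y ω| ^ p ∂P := by
  have := js_generic hXY hYi hY0 (F := fun a => |a| ^ p) (G := jsG p) (H := fun _ => 0)
    (K := fun _ => 0) (jsG_meas p) measurable_const measurable_const (js_int hp1 hX)
    (js_int hp1 (hX.add hY)) (js_int_of_bound hp1 hX hXm (jsG_meas p) (jsG_bound p hp1 hp2))
    (integrable_const 0) (integrable_const 0)
    (fun a b => by simpa using js_lower p hp1 a b)
  simpa using this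

lemma js_vbe_step {p : ℝ} (hp1 : 1 ≤ p) (hp2 : p ≤ 2) {X Y : Ω' → ℝ} (hXY : IndepFun X Y P)
    (hXm : Measurable X)
    (hX : MemLp X (ENNReal.ofReal p) P) (hY : MemLp Y (ENNReal.ofReal p) P)
    (hYi : Integrable Y P) (hY0 : ∫ ω, Y ω ∂P = 0) :
    ∫ ω, |X ω + Y ω| ^ p ∂P ≤ ∫ ω, |X ω| ^ p ∂P + 6 * ∫ ω, |Y ω| ^ p ∂P := by
  have := js_generic hXY hYi hY0 (F := fun a => -|a| ^ p) (G := fun a => - jsG p a)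
    (H := fun _ => -6)
    (K := fun a => |a| ^ p) (jsG_meas p).neg measurable_const (by fun_prop) (js_int hp1 hX).neg
    (js_int hp1 (hX.add hY)).neg
    (js_int_of_bound hp1 hX hXm (jsG_meas p) (jsG_bound p hp1 hp2)).neg
    (integrable_const _) (js_int hp1 hY)
    (fun a b => by have := js_upper p hp1 hp2 a b; linarith)
  simp only [integral_neg, integral_const, probReal_univ, one_smul] at this
  linarith

lemma js_F_step {p : ℝ} (hp1 : 1 ≤ p) (hp2 : p ≤ 2) {X Y : Ω' → ℝ} (hXY : IndepFun X Y P)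
    (hXm : Measurable X) (hYm : Measurable Y)
    (hX : MemLp X (ENNReal.ofReal p) P) (hY : MemLp Y (ENNReal.ofReal p) P)
    (hYi : Integrable Y P) (hY0 : ∫ ω, Y ω ∂P = 0) (hs : ∫ ω, |X ω| ^ p ∂P ≤ 1 / 2) :
    ∫ ω, jsF p (X ω) ∂P + 1 / 80 * ∫ ω, jsK p (Y ω) ∂P ≤ ∫ ω, jsF p (X ω + Y ω) ∂P := by
  have bF : ∀ a, |jsF p a| ≤ 1 * (1 + |a| ^ p) := fun a => by
    have := jsF_one_le p a hp1
    rw [abs_of_nonneg (by linarith), one_mul]; exact jsF_le p hp1 hp2 a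
  have bK : ∀ a, |jsK p a| ≤ 1 * (1 + |a| ^ p) := fun a => by
    have : 0 ≤ jsK p a := le_min (by positivity) (by positivity)
    rw [abs_of_nonneg (by linarith), one_mul]
    have : jsK p a ≤ |a| ^ p := min_le_right _ _
    linarith
  have := js_generic hXY hYi hY0 (F := jsF p) (G := jsD p) (H := fun a => 1 - |a| ^ p)
    (K := fun b => 1 / 40 * jsK p b) (jsD_meas p) (by fun_prop) ((jsK_meas p).const_mul _)
    (js_int_of_bound hp1 hX hXm (jsF_meas p) bF)
    (js_int_of_bound hp1 (hX.add hY) (hXm.add hYm) (jsF_meas p) bF)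
    (js_int_of_bound hp1 hX hXm (jsD_meas p) (jsD_bound p hp1 hp2))
    ((integrable_const 1).sub (js_int hp1 hX))
    ((js_int_of_bound hp1 hY hYm (jsK_meas p) bK).const_mul _)
    (fun a b => jsF_main p hp1 hp2 a b)
  rw [integral_sub (integrable_const 1) (js_int hp1 hX), integral_const_mul] at this
  simp only [integral_const, probReal_univ, one_smul] at this
  have hK0 : 0 ≤ ∫ ω, jsK p (Y ω) ∂P :=
    integral_nonneg fun ω => le_min (by positivity) (by positivity)
  nlinarith

variable {ι : Type*}

lemma js_vbe {p : ℝ} (hp1 : 1 ≤ p) (hp2 : p ≤ 2) {X : ι → Ω' → ℝ} (hind : iIndepFun X P)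
    (hm : ∀ i, Measurable (X i)) (hX : ∀ i, MemLp (X i) (ENNReal.ofReal p) P)
    (hi : ∀ i, Integrable (X i) P) (h0 : ∀ i, ∫ ω, X i ω ∂P = 0) (s : Finset ι) :
    ∫ ω, |∑ i ∈ s, X i ω| ^ p ∂P ≤ 6 * ∑ i ∈ s, ∫ ω, |X i ω| ^ p ∂P := by
  classical
  induction s using Finset.induction_on with
  | empty => simp [Real.zero_rpow (show p ≠ 0 by linarith)]
  | insert a s ha ih =>
    have ind := hind.indepFun_finsetSum_of_notMem hm ha
    have e : (∑ j ∈ s, X j) = fun ω => ∑ j ∈ s, X j ω := by ext; simp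
    rw [e] at ind
    have := js_vbe_step hp1 hp2 ind (Finset.measurable_sum s fun i _ => hm i)
      (memLp_finsetSum s fun i _ => hX i) (hX a) (hi a) (h0 a)
    simp only [Finset.sum_insert ha]
    simp only [add_comm (X a _)]
    linarith

lemma js_low {p : ℝ} (hp1 : 1 ≤ p) (hp2 : p ≤ 2) {X : ι → Ω' → ℝ} (hind : iIndepFun X P)
    (hm : ∀ i, Measurable (X i)) (hX : ∀ i, MemLp (X i) (ENNReal.ofReal p) P)
    (hi : ∀ i, Integrable (X i) P) (h0 : ∀ i, ∫ ω, X i ω ∂P = 0) (s : Finset ι)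
    (hs : ∫ ω, |∑ i ∈ s, X i ω| ^ p ∂P ≤ 1 / 2) :
    1 + 1 / 80 * ∑ i ∈ s, ∫ ω, jsK p (X i ω) ∂P ≤ ∫ ω, jsF p (∑ i ∈ s, X i ω) ∂P := by
  classical
  induction s using Finset.induction_on with
  | empty => simp [jsF]
  | insert a s ha ih =>
    have ind := hind.indepFun_finsetSum_of_notMem hm ha
    have e : (∑ j ∈ s, X j) = fun ω => ∑ j ∈ s, X j ω := by ext; simp
    rw [e] at ind
    simp only [Finset.sum_insert ha] at hs ⊢
    simp only [add_comm (X a _)] at hs ⊢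
    have m := Finset.measurable_sum s fun i _ => hm i
    have l := memLp_finsetSum s fun i _ => hX i
    have h1 := (js_jensen hp1 hp2 ind m l (hX a) (hi a) (h0 a)).trans hs
    have := js_F_step hp1 hp2 ind m (hm a) l (hX a) (hi a) (h0 a) h1
    have := ih h1
    linarith

lemma js_low' {p : ℝ} (hp1 : 1 ≤ p) (hp2 : p ≤ 2) {X : ι → Ω' → ℝ} (hind : iIndepFun X P)
    (hm : ∀ i, Measurable (X i)) (hX : ∀ i, MemLp (X i) (ENNReal.ofReal p) P)
    (hi : ∀ i, Integrable (X i) P) (h0 : ∀ i, ∫ ω, X i ω ∂P = 0) (s : Finset ι)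
    (hs : ∫ ω, |∑ i ∈ s, X i ω| ^ p ∂P ≤ 1 / 2) :
    ∑ i ∈ s, ∫ ω, jsK p (X i ω) ∂P ≤ 40 := by
  have h1 := js_low hp1 hp2 hind hm hX hi h0 s hs
  have l := memLp_finsetSum s fun i _ => hX i
  have m := Finset.measurable_sum s fun i _ => hm i
  have bF : ∀ a, |jsF p a| ≤ 1 * (1 + |a| ^ p) := fun a => by
    have := jsF_one_le p a hp1
    rw [abs_of_nonneg (by linarith), one_mul]; exact jsF_le p hp1 hp2 a
  have h2 : ∫ ω, jsF p (∑ i ∈ s, X i ω) ∂P ≤ ∫ ω, (1 + |∑ i ∈ s, X i ω| ^ p) ∂P :=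
    integral_mono (js_int_of_bound hp1 l m (jsF_meas p) bF)
      ((integrable_const 1).add (js_int hp1 l)) (fun ω => jsF_le p hp1 hp2 _)
  rw [integral_add (integrable_const 1) (js_int hp1 l)] at h2
  simp only [integral_const, probReal_univ, one_smul] at h2
  linarith

end prob

open scoped ENNReal

section final
variable {Ω : Type*} [MeasurableSpace Ω] {μ : Measure Ω}

lemma js_ofReal_eq (q : ℝ) (hq : 1 ≤ q) (x : ℝ) : ENNReal.ofReal (|x| ^ q) = ‖x‖ₑ ^ q := by
  rw [← ENNReal.ofReal_rpow_of_nonneg (abs_nonneg _) (by linarith), ← Real.enorm_eq_ofReal_abs]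

lemma js_norm_eq (q : ℝ) (hq : 1 ≤ q) (f : Ω → ℝ) :
    (∫⁻ ω, ENNReal.ofReal (|f ω| ^ q) ∂μ) ^ (1 / q) = eLpNorm f (ENNReal.ofReal q) μ := by
  rw [eLpNorm_eq_lintegral_rpow_enorm_toReal (by simp; linarith) (by simp),
    ENNReal.toReal_ofReal (by linarith)]
  simp only [js_ofReal_eq q hq]

lemma js_memLp (q : ℝ) (hq : 1 ≤ q) {f : Ω → ℝ} (hf : Measurable f)
    (h : ∫⁻ ω, ENNReal.ofReal (|f ω| ^ q) ∂μ < ⊤) : MemLp f (ENNReal.ofReal q) μ := by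
  refine ⟨hf.aestronglyMeasurable, ?_⟩
  rw [← js_norm_eq q hq]
  exact ENNReal.rpow_lt_top_of_nonneg (by positivity) h.ne

lemma js_lint_eq (q : ℝ) (hq : 1 ≤ q) {f : Ω → ℝ} (h : MemLp f (ENNReal.ofReal q) μ) :
    ∫⁻ ω, ENNReal.ofReal (|f ω| ^ q) ∂μ = ENNReal.ofReal (∫ ω, |f ω| ^ q ∂μ) :=
  (ofReal_integral_eq_lintegral_ofReal (js_int hq h)
    (Filter.Eventually.of_forall fun _ => by positivity)).symm

variable [IsProbabilityMeasure μ]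

/-- centering costs at most a constant -/
lemma js_center (q : ℝ) (hq : 1 ≤ q) (hq2 : q ≤ 2) {f : Ω → ℝ} (hf : Measurable f)
    (h : ∫⁻ ω, ENNReal.ofReal (|f ω| ^ q) ∂μ < ⊤) :
    ∫⁻ ω, ENNReal.ofReal (|f ω - ∫ x, f x ∂μ| ^ q) ∂μ
      ≤ 4 * ∫⁻ ω, ENNReal.ofReal (|f ω| ^ q) ∂μ := by
  have hm := js_memLp q hq hf h
  have h1 : eLpNorm (fun ω => f ω - ∫ x, f x ∂μ) (ENNReal.ofReal q) μ
      ≤ 2 * eLpNorm f (ENNReal.ofReal q) μ := by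
    refine (eLpNorm_sub_le hm.1 aestronglyMeasurable_const (by simpa using hq)).trans ?_
    rw [two_mul]
    gcongr
    rw [eLpNorm_const _ (by simp; linarith) (IsProbabilityMeasure.ne_zero μ)]
    simp only [measure_univ, ENNReal.one_rpow, mul_one]
    refine (enorm_integral_le_lintegral_enorm f).trans ?_
    rw [← eLpNorm_one_eq_lintegral_enorm]
    exact eLpNorm_le_eLpNorm_of_exponent_le (by simpa using hq) hm.1
  rw [← js_norm_eq q hq, ← js_norm_eq q hq] at h1
  have h2 := ENNReal.rpow_le_rpow h1 (show 0 ≤ q by linarith)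
  rw [ENNReal.mul_rpow_of_nonneg _ _ (by linarith), ← ENNReal.rpow_mul, ← ENNReal.rpow_mul,
    one_div_mul_cancel (by linarith), ENNReal.rpow_one, ENNReal.rpow_one] at h2
  refine h2.trans ?_
  gcongr
  have := ENNReal.rpow_le_rpow_of_exponent_le (x := 2) (by norm_num) hq2
  refine this.trans ?_
  norm_num

lemma js_pi_indep {n : ℕ} {f : Fin n → Ω → ℝ} (hm : ∀ i, Measurable (f i)) :
    iIndepFun (fun i (x : Fin n → Ω) => f i (x i)) (Measure.pi fun _ => μ) :=
  iIndepFun_pi fun i => (hm i).aemeasurable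

lemma js_pi_vbe (q : ℝ) (hq : 1 ≤ q) (hq2 : q ≤ 2) {n : ℕ} {f : Fin n → Ω → ℝ}
    (hm : ∀ i, Measurable (f i)) (hi : ∀ i, Integrable (f i) μ) (h0 : ∀ i, ∫ ω, f i ω ∂μ = 0)
    (h : ∀ i, ∫⁻ ω, ENNReal.ofReal (|f i ω| ^ q) ∂μ < ⊤) :
    eLpNorm (fun x : Fin n → Ω => ∑ i, f i (x i)) (ENNReal.ofReal q) (Measure.pi fun _ => μ)
      ≤ 6 * (∑ i, ∫⁻ ω, ENNReal.ofReal (|f i ω| ^ q) ∂μ) ^ (1 / q) := by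
  have hL := fun i => js_memLp q hq (hm i) (h i)
  have hL' : ∀ i, MemLp (fun x : Fin n → Ω => f i (x i)) (ENNReal.ofReal q)
      (Measure.pi fun _ => μ) := fun i =>
    (hL i).comp_measurePreserving (measurePreserving_eval (fun _ => μ) i)
  have key := js_vbe hq hq2 (js_pi_indep (μ := μ) hm)
    (fun i => (hm i).comp (measurable_pi_apply i)) hL'
    (fun i => (measurePreserving_eval (fun _ => μ) i).integrable_comp_of_integrable (hi i))
    (fun i => by rw [integral_comp_eval (μ := fun _ : Fin n => μ) (hi i).1]; exact h0 i) Finset.univ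
  have e : ∀ i, ∫ x : Fin n → Ω, |f i (x i)| ^ q ∂(Measure.pi fun _ => μ)
      = ∫ ω, |f i ω| ^ q ∂μ := fun i =>
    integral_comp_eval (μ := fun _ : Fin n => μ) (f := fun ω => |f i ω| ^ q) (js_int hq (hL i)).1
  simp only [e] at key
  rw [← js_norm_eq q hq, js_lint_eq q hq (memLp_finsetSum _ fun i _ => hL' i)]
  simp only [fun i => js_lint_eq q hq (hL i)]
  rw [← ENNReal.ofReal_sum_of_nonneg (fun i _ => integral_nonneg fun ω => by positivity)]
  refine (ENNReal.rpow_le_rpow (ENNReal.ofReal_le_ofReal key) (by positivity)).trans ?_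
  rw [ENNReal.ofReal_mul (by norm_num), ENNReal.mul_rpow_of_nonneg _ _ (by positivity)]
  gcongr
  have : (1 : ℝ) / q ≤ 1 := by rw [div_le_one (by linarith)]; exact hq
  have := ENNReal.rpow_le_rpow_of_exponent_le (x := 6) (by norm_num) this
  simpa using this

lemma js_scale (a : ℝ≥0∞) (x : ℝ≥0∞) (ha : 1 ≤ a) (q : ℝ) (hq : 1 ≤ q) :
    (a * x) ^ (1 / q) ≤ a * x ^ (1 / q) := by
  rw [ENNReal.mul_rpow_of_nonneg _ _ (by positivity)]
  gcongr
  have : (1 : ℝ) / q ≤ 1 := by rw [div_le_one (by linarith)]; exact hq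
  simpa using ENNReal.rpow_le_rpow_of_exponent_le ha this

lemma js_sq (x : ℝ) : x ^ 2 = |x| ^ (2 : ℝ) := by simp

lemma js_sum_lt_top {n : ℕ} {a : Fin n → ℝ≥0∞} {q : ℝ} (hq : 1 ≤ q)
    (h : (∑ i, a i) ^ (1 / q) ≠ ⊤) (i : Fin n) : a i < ⊤ := by
  have h1 : ∑ i, a i ≠ ⊤ := fun h' => h (by rw [h']; exact ENNReal.top_rpow_of_pos (by positivity))
  exact lt_of_le_of_lt (Finset.single_le_sum (fun _ _ => bot_le) (Finset.mem_univ i))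
    (lt_top_iff_ne_top.2 h1)

/-- centering a decomposition, and the upper bound for it. -/
lemma js_decomp (p : ℝ) (hp1 : 1 ≤ p) (hp2 : p ≤ 2) {n : ℕ} {f : Fin n → Ω → ℝ}
    (h0 : ∀ i, ∫ ω, f i ω ∂μ = 0) {s : ℝ≥0∞} (hs : s ∈ decompVals p μ f false) (hst : s ≠ ⊤) :
    ∃ t ∈ decompVals p μ f true, t ≤ 4 * s ∧
      (∫⁻ x : Fin n → Ω, ENNReal.ofReal (|∑ i, f i (x i)| ^ p)
              ∂Measure.pi fun _ => μ) ^ (1/p) ≤ 6 * t := by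
  obtain ⟨g, h, hg, hh, hf, -, rfl⟩ := hs
  rw [ENNReal.add_ne_top] at hst
  simp only [js_sq] at hst
  have tg := js_sum_lt_top (by norm_num) hst.1
  have th := js_sum_lt_top hp1 hst.2
  have ig : ∀ i, Integrable (g i) μ := fun i =>
    (js_memLp 2 (by norm_num) (hg i) (tg i)).integrable (by simp)
  have ih : ∀ i, Integrable (h i) μ := fun i =>
    (js_memLp p hp1 (hh i) (th i)).integrable (by simpa using hp1)
  set g' : Fin n → Ω → ℝ := fun i ω => g i ω - ∫ x, g i x ∂μ with hg'
  set h' : Fin n → Ω → ℝ := fun i ω => h i ω - ∫ x, h i x ∂μ with hh'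
  have mg' : ∀ i, Measurable (g' i) := fun i => (hg i).sub_const _
  have mh' : ∀ i, Measurable (h' i) := fun i => (hh i).sub_const _
  have ig' : ∀ i, Integrable (g' i) μ := fun i => (ig i).sub (integrable_const _)
  have ih' : ∀ i, Integrable (h' i) μ := fun i => (ih i).sub (integrable_const _)
  have zg' : ∀ i, ∫ ω, g' i ω ∂μ = 0 := fun i => by
    simp only [hg']; rw [integral_sub (ig i) (integrable_const _)]; simp
  have zh' : ∀ i, ∫ ω, h' i ω ∂μ = 0 := fun i => by
    simp only [hh']; rw [integral_sub (ih i) (integrable_const _)]; simp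
  have hf' : ∀ i, f i = g' i + h' i := fun i => by
    have e : ∫ x, g i x ∂μ + ∫ x, h i x ∂μ = 0 := by
      rw [← h0 i, hf i, ← integral_add (ig i) (ih i)]; rfl
    ext ω
    rw [hf i]
    simp only [hg', hh', Pi.add_apply]
    linarith
  have cg := fun i => js_center 2 (by norm_num) (by norm_num) (hg i) (tg i)
  have ch := fun i => js_center p hp1 hp2 (hh i) (th i)
  have tg' : ∀ i, ∫⁻ ω, ENNReal.ofReal (|g' i ω| ^ (2 : ℝ)) ∂μ < ⊤ := fun i =>
    (cg i).trans_lt (ENNReal.mul_lt_top (by norm_num) (tg i))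
  have th' : ∀ i, ∫⁻ ω, ENNReal.ofReal (|h' i ω| ^ p) ∂μ < ⊤ := fun i =>
    (ch i).trans_lt (ENNReal.mul_lt_top (by norm_num) (th i))
  refine ⟨_, ⟨g', h', mg', mh', hf', fun _ => ⟨zg', zh'⟩, rfl⟩, ?_, ?_⟩
  · simp only [js_sq]
    rw [mul_add]
    refine add_le_add ?_ ?_
    · refine le_trans ?_ (js_scale 4 _ (by norm_num) 2 (by norm_num))
      rw [Finset.mul_sum]
      exact ENNReal.rpow_le_rpow (Finset.sum_le_sum fun i _ => cg i) (by norm_num)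
    · refine le_trans ?_ (js_scale 4 _ (by norm_num) p hp1)
      rw [Finset.mul_sum]
      exact ENNReal.rpow_le_rpow (Finset.sum_le_sum fun i _ => ch i) (by positivity)
  · rw [js_norm_eq p hp1]
    have e : (fun x : Fin n → Ω => ∑ i, f i (x i)) =
        (fun x => ∑ i, g' i (x i)) + (fun x => ∑ i, h' i (x i)) := by
      ext x
      simp only [Pi.add_apply, ← Finset.sum_add_distrib]
      refine Finset.sum_congr rfl fun i _ => ?_
      rw [hf' i]; rfl
    have sg : Measurable (fun x : Fin n → Ω => ∑ i, g' i (x i)) :=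
      Finset.measurable_sum _ fun i _ => (mg' i).comp (measurable_pi_apply i)
    have sh : Measurable (fun x : Fin n → Ω => ∑ i, h' i (x i)) :=
      Finset.measurable_sum _ fun i _ => (mh' i).comp (measurable_pi_apply i)
    rw [e]
    refine (eLpNorm_add_le sg.aestronglyMeasurable sh.aestronglyMeasurable
      (by simpa using hp1)).trans ?_
    rw [mul_add]
    refine add_le_add ?_ ?_
    · simp only [js_sq]
      exact (eLpNorm_le_eLpNorm_of_exponent_le (ENNReal.ofReal_le_ofReal hp2)
        sg.aestronglyMeasurable).trans
        (js_pi_vbe 2 (by norm_num) (by norm_num) mg' ig' zg' tg')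
    · exact js_pi_vbe p hp1 hp2 mh' ih' zh' th'

lemma js_lower_final (p : ℝ) (hp1 : 1 ≤ p) (hp2 : p ≤ 2) {n : ℕ} {f : Fin n → Ω → ℝ}
    (hm : ∀ i, Measurable (f i)) (hi : ∀ i, Integrable (f i) μ)
    (h0 : ∀ i, ∫ ω, f i ω ∂μ = 0)
    (h : ∀ i, ∫⁻ ω, ENNReal.ofReal (|f i ω| ^ p) ∂μ < ⊤) (l : ℝ) (hl : 0 < l)
    (hS : ∫⁻ x : Fin n → Ω, ENNReal.ofReal (|∑ i, f i (x i)| ^ p) ∂(Measure.pi fun _ => μ)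
      ≤ ENNReal.ofReal (l ^ p / 2)) :
    sInf (decompVals p μ f false) ≤ ENNReal.ofReal (80 * l) := by
  have hL := fun i => js_memLp p hp1 (hm i) (h i)
  have hL' : ∀ i, MemLp (fun x : Fin n → Ω => f i (x i)) (ENNReal.ofReal p)
      (Measure.pi fun _ => μ) := fun i =>
    (hL i).comp_measurePreserving (measurePreserving_eval (fun _ => μ) i)
  have hlp : 0 < l ^ p := by positivity
  have hS' : ∫ x : Fin n → Ω, |∑ i, f i (x i) / l| ^ p ∂(Measure.pi fun _ => μ) ≤ 1 / 2 := by
    rw [js_lint_eq p hp1 (memLp_finsetSum _ fun i _ => hL' i),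
      ENNReal.ofReal_le_ofReal_iff (by positivity)] at hS
    simp only [← Finset.sum_div, abs_div, abs_of_pos hl,
      Real.div_rpow (abs_nonneg _) hl.le, integral_div]
    rw [div_le_iff₀ hlp]; linarith
  have key := js_low' hp1 hp2 (js_pi_indep (μ := μ) (f := fun i ω => f i ω / l)
      fun i => (hm i).div_const l)
    (fun i => ((hm i).comp (measurable_pi_apply i)).div_const l)
    (fun i => by simpa only [div_eq_mul_inv] using (hL' i).mul_const l⁻¹)
    (fun i => ((measurePreserving_eval (fun _ => μ) i).integrable_comp_of_integrable
      (hi i)).div_const l)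
    (fun i => by
      rw [integral_div, integral_comp_eval (μ := fun _ : Fin n => μ) (hi i).1, h0 i, zero_div])
    Finset.univ hS'
  have e : ∀ i, ∫ x : Fin n → Ω, jsK p (f i (x i) / l) ∂(Measure.pi fun _ => μ)
      = ∫ ω, jsK p (f i ω / l) ∂μ := fun i =>
    integral_comp_eval (μ := fun _ : Fin n => μ) (f := fun ω => jsK p (f i ω / l))
      ((jsK_meas p).comp ((hm i).div_const l)).aestronglyMeasurable
  simp only [e] at key
  have K0 : ∀ b, 0 ≤ jsK p b := fun b => le_min (by positivity) (by positivity)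
  have iK : ∀ i, Integrable (fun ω => jsK p (f i ω / l)) μ := fun i => by
    refine js_int_of_bound (C := 1) hp1 (X := fun ω => f i ω / l)
      (by simpa only [div_eq_mul_inv] using (hL i).mul_const l⁻¹)
      ((hm i).div_const l) (jsK_meas p) (fun a => ?_)
    rw [abs_of_nonneg (K0 a)]
    have : jsK p a ≤ |a| ^ p := min_le_right _ _
    linarith
  have key2 : ∑ i, ∫⁻ ω, ENNReal.ofReal (jsK p (f i ω / l)) ∂μ ≤ 40 := by
    have e2 : ∀ i, ∫⁻ ω, ENNReal.ofReal (jsK p (f i ω / l)) ∂μ =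
        ENNReal.ofReal (∫ ω, jsK p (f i ω / l) ∂μ) := fun i =>
      (ofReal_integral_eq_lintegral_ofReal (iK i) (Filter.Eventually.of_forall fun _ => K0 _)).symm
    simp only [e2]
    rw [← ENNReal.ofReal_sum_of_nonneg (fun i _ => integral_nonneg fun _ => K0 _)]
    refine (ENNReal.ofReal_le_ofReal key).trans ?_
    norm_num
  -- the truncation bound
  have trunc : ∀ q : ℝ, 1 ≤ q → ∀ g : Fin n → Ω → ℝ,
      (∀ i ω, |g i ω| ^ q ≤ l ^ q * jsK p (f i ω / l)) →
      (∑ i, ∫⁻ ω, ENNReal.ofReal (|g i ω| ^ q) ∂μ) ^ (1 / q) ≤ ENNReal.ofReal (40 * l) := by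
    intro q hq g hg
    have h1 : ∑ i, ∫⁻ ω, ENNReal.ofReal (|g i ω| ^ q) ∂μ ≤ 40 * ENNReal.ofReal (l ^ q) := by
      calc _ ≤ ∑ i, ∫⁻ ω, ENNReal.ofReal (l ^ q) * ENNReal.ofReal (jsK p (f i ω / l)) ∂μ := by
            refine Finset.sum_le_sum fun i _ => lintegral_mono fun ω => ?_
            rw [← ENNReal.ofReal_mul (by positivity)]
            exact ENNReal.ofReal_le_ofReal (hg i ω)
        _ = ENNReal.ofReal (l ^ q) * ∑ i, ∫⁻ ω, ENNReal.ofReal (jsK p (f i ω / l)) ∂μ := by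
            rw [Finset.mul_sum]
            refine Finset.sum_congr rfl fun i _ => lintegral_const_mul' _ _ (by simp)
        _ ≤ ENNReal.ofReal (l ^ q) * 40 := by gcongr
        _ = _ := mul_comm _ _
    refine (ENNReal.rpow_le_rpow h1 (by positivity)).trans ?_
    refine (js_scale 40 _ (by norm_num) q hq).trans ?_
    rw [← ENNReal.ofReal_rpow_of_pos hl, ← ENNReal.rpow_mul, mul_one_div_cancel (by linarith),
      ENNReal.rpow_one, ENNReal.ofReal_mul (by norm_num)]
    simp
  have hset : ∀ i, MeasurableSet {ω | |f i ω| ≤ l} := fun i =>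
    measurableSet_le (hm i).abs measurable_const
  have kscale : ∀ x : ℝ, |x / l| ≤ 1 → x ^ 2 = l ^ 2 * jsK p (x / l) := by
    intro x hx
    have h1 : |x / l| ^ (2 : ℝ) ≤ |x / l| ^ p :=
      Real.rpow_le_rpow_of_exponent_ge' (abs_nonneg _) hx (by linarith) hp2
    rw [← js_sq] at h1
    rw [jsK, min_eq_left h1]; field_simp
  have kscale' : ∀ x : ℝ, 1 ≤ |x / l| → |x| ^ p = l ^ p * jsK p (x / l) := by
    intro x hx
    have h1 : |x / l| ^ p ≤ |x / l| ^ (2 : ℝ) :=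
      Real.rpow_le_rpow_of_exponent_le hx hp2
    rw [← js_sq] at h1
    rw [jsK, min_eq_right h1, abs_div, abs_of_pos hl, Real.div_rpow (abs_nonneg _) hl.le]
    field_simp
  have hdiv : ∀ x : ℝ, |x / l| = |x| / l := fun x => by rw [abs_div, abs_of_pos hl]
  have hmem : _ ∈ decompVals p μ f false := ⟨fun i => {ω | |f i ω| ≤ l}.indicator (f i),
    fun i => {ω | |f i ω| ≤ l}ᶜ.indicator (f i), fun i => (hm i).indicator (hset i),
    fun i => (hm i).indicator (hset i).compl,
    fun i => (Set.indicator_self_add_compl _ _).symm, by simp, rfl⟩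
  refine (sInf_le hmem).trans ?_
  rw [show 80 * l = 40 * l + 40 * l by ring, ENNReal.ofReal_add (by positivity) (by positivity)]
  refine add_le_add ?_ ?_
  · simp only [js_sq]
    refine trunc 2 (by norm_num) _ fun i ω => ?_
    rw [← js_sq]
    by_cases hω : |f i ω| ≤ l
    · rw [Set.indicator_of_mem (by exact hω), kscale _ (by rw [hdiv, div_le_one hl]; exact hω)]
      simp
    · rw [Set.indicator_of_notMem (by exact hω)]
      have := K0 (f i ω / l)
      simp only [ne_eq, OfNat.ofNat_ne_zero, not_false_eq_true, zero_pow]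
      positivity
  · refine trunc p hp1 _ fun i ω => ?_
    by_cases hω : |f i ω| ≤ l
    · rw [Set.indicator_of_notMem (by simpa using hω)]
      have := K0 (f i ω / l)
      rw [abs_zero, Real.zero_rpow (by linarith)]
      positivity
    · rw [Set.indicator_of_mem (by exact hω)]
      exact (kscale' _ (by rw [hdiv, one_le_div hl]; exact (not_le.1 hω).le)).le

end final

/-- **Johnson–Schechtman inequality, mean-zero form** (Corollary `1varmzmz` of the paper):
for `1 ≤ p ≤ 2` and mean-zero `f i ∈ L^p(Ω)`, the norm `(∫_{Ω^n} |∑ i f i (x i)|^p dx)^(1/p)`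
is equivalent, with constants depending only on `p`, to
`inf { (∑ i ∫ |g i|²)^(1/2) + (∑ i ∫ |h i|^p)^(1/p) : f i = g i + h i }`,
and the infimum is unchanged up to constants when all `g i`, `h i` are required
to be of mean zero. -/
theorem johnson_schechtman_mean_zero (p : ℝ) (hp1 : 1 ≤ p) (hp2 : p ≤ 2) :
    ∃ c C : ℝ, 0 < c ∧ 0 < C ∧
      ∀ (Ω : Type u) [MeasurableSpace Ω] (μ : Measure Ω) [IsProbabilityMeasure μ]
        (n : ℕ) (f : Fin n → Ω → ℝ),
        (∀ i, Measurable (f i)) →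
        (∀ i, Integrable (f i) μ) →
        (∀ i, ∫ ω, f i ω ∂μ = 0) →
        (∀ i, ∫⁻ ω, ENNReal.ofReal (|f i ω| ^ p) ∂μ < ⊤) →
        (ENNReal.ofReal c * sInf (decompVals p μ f false)
            ≤ (∫⁻ x : Fin n → Ω, ENNReal.ofReal (|∑ i, f i (x i)| ^ p)
                ∂Measure.pi fun _ => μ) ^ (1/p)) ∧
        ((∫⁻ x : Fin n → Ω, ENNReal.ofReal (|∑ i, f i (x i)| ^ p)
              ∂Measure.pi fun _ => μ) ^ (1/p)
            ≤ ENNReal.ofReal C * sInf (decompVals p μ f false)) ∧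
        sInf (decompVals p μ f true) ≤ ENNReal.ofReal C * sInf (decompVals p μ f false) := by
  refine ⟨1 / 160, 24, by norm_num, by norm_num, ?_⟩
  intro Ω _ μ _ n f hm hi h0 hp
  refine ⟨?_, ?_, ?_⟩
  · refine le_of_forall_gt_imp_ge_of_dense fun x hx => ?_
    rcases eq_or_ne x ⊤ with rfl | hxt
    · exact le_top
    have hl : 0 < x.toReal := ENNReal.toReal_pos (ne_bot_of_gt hx) hxt
    have hS : ∫⁻ x : Fin n → Ω, ENNReal.ofReal (|∑ i, f i (x i)| ^ p) ∂(Measure.pi fun _ => μ)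
      ≤ ENNReal.ofReal ((2 * x.toReal) ^ p / 2) := by
      have h1 := ENNReal.rpow_le_rpow hx.le (show 0 ≤ p by linarith)
      rw [← ENNReal.rpow_mul, one_div_mul_cancel (by linarith), ENNReal.rpow_one] at h1
      refine h1.trans ?_
      nth_rewrite 1 [← ENNReal.ofReal_toReal hxt]
      rw [ENNReal.ofReal_rpow_of_pos hl]
      apply ENNReal.ofReal_le_ofReal
      rw [Real.mul_rpow (by norm_num) hl.le]
      have h2 : (2 : ℝ) ≤ 2 ^ p := by
        simpa using Real.rpow_le_rpow_of_exponent_le (x := 2) (by norm_num) hp1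
      have h3 : 0 < x.toReal ^ p := by positivity
      nlinarith
    have := js_lower_final p hp1 hp2 hm hi h0 hp (2 * x.toReal) (by positivity) hS
    calc _ ≤ ENNReal.ofReal (1 / 160) * ENNReal.ofReal (80 * (2 * x.toReal)) := by gcongr
      _ = ENNReal.ofReal x.toReal := by
        rw [← ENNReal.ofReal_mul (by norm_num)]; congr 1; ring
      _ = x := ENNReal.ofReal_toReal hxt
  · have e : ENNReal.ofReal 24 = 24 := by norm_num
    rw [e, mul_comm, ← ENNReal.div_le_iff_le_mul (by simp) (by simp)]
    refine le_sInf fun s hs => ?_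
    rw [ENNReal.div_le_iff_le_mul (by simp) (by simp)]
    rcases eq_or_ne s ⊤ with rfl | hst
    · simp
    obtain ⟨t, -, ht, h⟩ := js_decomp p hp1 hp2 h0 hs hst
    refine h.trans ?_
    calc 6 * t ≤ 6 * (4 * s) := by gcongr
      _ = s * 24 := by ring
  · have e : ENNReal.ofReal 24 = 24 := by norm_num
    rw [e, mul_comm, ← ENNReal.div_le_iff_le_mul (by simp) (by simp)]
    refine le_sInf fun s hs => ?_
    rw [ENNReal.div_le_iff_le_mul (by simp) (by simp)]
    rcases eq_or_ne s ⊤ with rfl | hst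
    · simp
    obtain ⟨t, ht', ht, -⟩ := js_decomp p hp1 hp2 h0 hs hst
    refine (sInf_le ht').trans (ht.trans ?_)
    rw [mul_comm]
    gcongr
    norm_num
end

section
/- Let (Ω, μ) be a probability space, 1 ≤ p < ∞, M ≥ 0, and f ∈ V^p_{≤M}(Ω^n) with Hoeffding components P_{i_1,…,i_m} f (x) = f_{i_1,…,i_m}(x_{i_1},…,x_{i_m}) for each m ≤ M and indices 1 ≤ i_1 < ⋯ < i_m ≤ n. Then ‖f‖_{L^p(Ω^n)}^p is equivalent, with constants depending only on M and p, to ∑_{m ≤ M} ∫_{Ω^n} ⋯ ∫_{Ω^n} ( ∑_{1 ≤ i_1 < ⋯ < i_m ≤ n} f_{i_1,…,i_m}(x^{(1)}_{i_1},…,x^{(m)}_{i_m})² )^{p/2} dx^{(1)} ⋯ dx^{(m)}, where x^{(1)},…,x^{(m)} are m independent variables in Ω^n. -/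
open MeasureTheory
open scoped ENNReal

universe u

set_option linter.unusedSectionVars false

section Cube
variable {B : Type*} [Fintype B] [DecidableEq B]

noncomputable def hdSgn (b : Bool) : ℝ := if b then 1 else -1
noncomputable def hdChi (S : Finset B) (ε : B → Bool) : ℝ := ∏ b ∈ S, hdSgn (ε b)
noncomputable def hdAv (F : (B → Bool) → ℝ) : ℝ := (∑ ε, F ε) / (Fintype.card (B → Bool))
def hdFlip (a : B) (ε : B → Bool) : B → Bool := Function.update ε a (!ε a)

lemma hdFlip_flip (a : B) (ε : B → Bool) : hdFlip a (hdFlip a ε) = ε := by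
  ext b
  by_cases h : b = a
  · subst h; simp [hdFlip]
  · simp [hdFlip, h]

lemma hdChi_flip_mem {a : B} {S : Finset B} (h : a ∈ S) (ε : B → Bool) :
    hdChi S (hdFlip a ε) = - hdChi S ε := by
  unfold hdChi
  rw [← Finset.mul_prod_erase _ _ h, ← Finset.mul_prod_erase _ _ h, ← neg_mul]
  congr 1
  · simp only [hdFlip, hdSgn, Function.update_self]
    cases ε a <;> simp
  · refine Finset.prod_congr rfl fun b hb => ?_
    simp [hdFlip, (Finset.mem_erase.1 hb).1]

lemma hdChi_flip_not_mem {a : B} {S : Finset B} (h : a ∉ S) (ε : B → Bool) :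
    hdChi S (hdFlip a ε) = hdChi S ε := by
  unfold hdChi
  refine Finset.prod_congr rfl fun b hb => ?_
  have : b ≠ a := fun h' => h (h' ▸ hb)
  simp [hdFlip, this]

lemma hdSum_flip (a : B) (F : (B → Bool) → ℝ) : ∑ ε, F (hdFlip a ε) = ∑ ε, F ε := by
  refine Finset.sum_nbij' (hdFlip a) (hdFlip a) ?_ ?_ ?_ ?_ ?_ <;> simp [hdFlip_flip]

lemma hdChi_sq (S : Finset B) (ε : B → Bool) : hdChi S ε * hdChi S ε = 1 := by
  unfold hdChi
  rw [← Finset.prod_mul_distrib]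
  refine Finset.prod_eq_one fun b _ => ?_
  unfold hdSgn; split_ifs <;> norm_num

lemma hdAv_mono {F G : (B → Bool) → ℝ} (h : ∀ ε, F ε ≤ G ε) : hdAv F ≤ hdAv G := by
  unfold hdAv
  gcongr
  exact h _

lemma hdAv_flip (a : B) (F : (B → Bool) → ℝ) : hdAv (fun ε => F (hdFlip a ε)) = hdAv F := by
  simp [hdAv, hdSum_flip]

lemma hdAv_add (F G : (B → Bool) → ℝ) : hdAv (fun ε => F ε + G ε) = hdAv F + hdAv G := by
  simp [hdAv, Finset.sum_add_distrib, add_div]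

lemma hdAv_mul (c : ℝ) (F : (B → Bool) → ℝ) : hdAv (fun ε => c * F ε) = c * hdAv F := by
  simp [hdAv, ← Finset.mul_sum, mul_div_assoc]

lemma hdAv_sum {ι : Type*} (s : Finset ι) (F : ι → (B → Bool) → ℝ) :
    hdAv (fun ε => ∑ i ∈ s, F i ε) = ∑ i ∈ s, hdAv (F i) := by
  simp only [hdAv]
  rw [Finset.sum_comm, Finset.sum_div]

lemma hdAv_const (c : ℝ) : hdAv (fun _ : B → Bool => c) = c := by
  simp [hdAv]

lemma hdAv_chi_chi {S T : Finset B} (h : S ≠ T) :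
    hdAv (fun ε => hdChi S ε * hdChi T ε) = 0 := by
  have key : ∀ S T : Finset B, (∃ a, a ∈ S ∧ a ∉ T) →
      hdAv (fun ε => hdChi S ε * hdChi T ε) = 0 := by
    rintro S T ⟨a, ha, hb⟩
    have h1 := hdAv_flip a (fun ε => hdChi S ε * hdChi T ε)
    simp only [hdChi_flip_mem ha, hdChi_flip_not_mem hb, neg_mul] at h1
    have h2 := hdAv_mul (-1) (fun ε => hdChi S ε * hdChi T ε)
    simp only [neg_mul, one_mul] at h2
    linarith
  by_cases h1 : S ⊆ T
  · have h2 : ¬ T ⊆ S := fun h2 => h (Finset.Subset.antisymm h1 h2)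
    obtain ⟨a, ha, hb⟩ := Finset.not_subset.1 h2
    have := key T S ⟨a, ha, hb⟩
    simpa [mul_comm] using this
  · obtain ⟨a, ha, hb⟩ := Finset.not_subset.1 h1
    exact key S T ⟨a, ha, hb⟩

lemma hd_two_point (N : ℕ) (g h : ℝ) : ∀ k ≤ N,
    ((g + h) ^ (2 * k) + (g - h) ^ (2 * k)) / 2 ≤ (g ^ 2 + (4 * N + 1) * h ^ 2) ^ k ∧
    g * h * (((g + h) ^ (2 * k) - (g - h) ^ (2 * k)) / 2)
      ≤ (2 * k) * h ^ 2 * (g ^ 2 + (4 * N + 1) * h ^ 2) ^ k := by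
  intro k
  induction k with
  | zero => intro _; simp
  | succ k ih =>
    intro hk
    obtain ⟨h1, h2⟩ := ih (by omega)
    have hkN : (k : ℝ) + 1 ≤ N := by exact_mod_cast hk
    set W := (g ^ 2 + (4 * N + 1) * h ^ 2) with hW
    set X := (g + h) ^ (2 * k) with hX
    set Y := (g - h) ^ (2 * k) with hY
    have eX : (g + h) ^ (2 * (k + 1)) = X * (g + h) ^ 2 := by rw [hX]; ring
    have eY : (g - h) ^ (2 * (k + 1)) = Y * (g - h) ^ 2 := by rw [hY]; ring
    have hW0 : 0 ≤ W := by positivity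
    have hWk : 0 ≤ W ^ k := by positivity
    have hWge : g ^ 2 + h ^ 2 ≤ W := by
      rw [hW]; nlinarith [sq_nonneg h, mul_nonneg (Nat.cast_nonneg (α := ℝ) N) (sq_nonneg h)]
    rw [eX, eY, pow_succ W k]
    push_cast
    constructor
    · have e : (X * (g + h) ^ 2 + Y * (g - h) ^ 2) / 2
          = (g ^ 2 + h ^ 2) * ((X + Y) / 2) + 2 * (g * h * ((X - Y) / 2)) := by ring
      rw [e]
      have a1 : (g ^ 2 + h ^ 2) * ((X + Y) / 2) ≤ (g ^ 2 + h ^ 2) * W ^ k := by gcongr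
      have a2 : (g ^ 2 + h ^ 2) * W ^ k + 2 * (2 * k * h ^ 2 * W ^ k) ≤ W ^ k * W := by
        have : (g ^ 2 + h ^ 2) + 4 * k * h ^ 2 ≤ W := by
          rw [hW]; nlinarith [sq_nonneg h, mul_le_mul_of_nonneg_right hkN (sq_nonneg h)]
        nlinarith
      linarith
    · have e : g * h * ((X * (g + h) ^ 2 - Y * (g - h) ^ 2) / 2)
          = (g ^ 2 + h ^ 2) * (g * h * ((X - Y) / 2)) + 2 * g ^ 2 * h ^ 2 * ((X + Y) / 2) := by ring
      rw [e]
      have a1 : (g ^ 2 + h ^ 2) * (g * h * ((X - Y) / 2))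
        ≤ (g ^ 2 + h ^ 2) * (2 * k * h ^ 2 * W ^ k) := by gcongr
      have a2 : 2 * g ^ 2 * h ^ 2 * ((X + Y) / 2) ≤ 2 * g ^ 2 * h ^ 2 * W ^ k := by gcongr
      have a3 : 2 * g ^ 2 * h ^ 2 * W ^ k ≤ 2 * (h ^ 2 * W ^ k) * W := by
        have : g ^ 2 ≤ W := by nlinarith [sq_nonneg h]
        have h3 : 0 ≤ h ^ 2 * W ^ k := by positivity
        nlinarith
      have a4 : (g ^ 2 + h ^ 2) * (2 * k * h ^ 2 * W ^ k) ≤ W * (2 * k * h ^ 2 * W ^ k) := by gcongr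
      nlinarith

/-- A finite Minkowski inequality with natural powers. -/
lemma hd_mink {k : ℕ} {u v : (B → Bool) → ℝ} (hu : ∀ ε, 0 ≤ u ε) (hv : ∀ ε, 0 ≤ v ε)
    {a b : ℝ} (ha : 0 ≤ a) (hb : 0 ≤ b)
    (hua : hdAv (fun ε => u ε ^ k) ≤ a ^ k) (hvb : hdAv (fun ε => v ε ^ k) ≤ b ^ k) :
    hdAv (fun ε => (u ε + v ε) ^ k) ≤ (a + b) ^ k := by
  -- strict positive perturbation
  have key : ∀ a b : ℝ, 0 < a → 0 < b → hdAv (fun ε => u ε ^ k) ≤ a ^ k →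
      hdAv (fun ε => v ε ^ k) ≤ b ^ k → hdAv (fun ε => (u ε + v ε) ^ k) ≤ (a + b) ^ k := by
    intro a b ha hb hua hvb
    have hpt : ∀ ε, (u ε + v ε) ^ k ≤ (a + b) ^ k *
        (a / (a + b) * ((a ^ k)⁻¹ * u ε ^ k) + b / (a + b) * ((b ^ k)⁻¹ * v ε ^ k)) := by
      intro ε
      have hc := (convexOn_pow (𝕜 := ℝ) k).2
        (Set.mem_Ici.2 (div_nonneg (hu ε) ha.le)) (Set.mem_Ici.2 (div_nonneg (hv ε) hb.le))
        (show 0 ≤ a / (a + b) by positivity) (show 0 ≤ b / (a + b) by positivity)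
        (by field_simp)
      simp only [smul_eq_mul] at hc
      have e : a / (a + b) * (u ε / a) + b / (a + b) * (v ε / b) = (u ε + v ε) / (a + b) := by
        field_simp
      rw [e, div_pow, div_le_iff₀ (by positivity), div_pow, div_pow] at hc
      calc _ ≤ _ := hc
        _ = _ := by field_simp
    refine (hdAv_mono hpt).trans ?_
    rw [hdAv_mul, hdAv_add, hdAv_mul, hdAv_mul, hdAv_mul, hdAv_mul]
    have h1 : (a ^ k)⁻¹ * hdAv (fun ε => u ε ^ k) ≤ 1 := by
      rw [inv_mul_le_iff₀ (by positivity)]; simpa using hua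
    have h2 : (b ^ k)⁻¹ * hdAv (fun ε => v ε ^ k) ≤ 1 := by
      rw [inv_mul_le_iff₀ (by positivity)]; simpa using hvb
    have : a / (a + b) * ((a ^ k)⁻¹ * hdAv (fun ε => u ε ^ k))
      + b / (a + b) * ((b ^ k)⁻¹ * hdAv (fun ε => v ε ^ k)) ≤ a / (a + b) * 1 + b / (a + b) * 1 := by
      gcongr
    have e : a / (a + b) * 1 + b / (a + b) * 1 = 1 := by field_simp
    rw [e] at this
    calc _ ≤ (a + b) ^ k * 1 := by gcongr
      _ = _ := mul_one _
  have hlim : Filter.Tendsto (fun t : ℝ => ((a + t) + (b + t)) ^ k) (nhdsWithin 0 (Set.Ioi 0))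
      (nhds ((a + b) ^ k)) := by
    have : Continuous (fun t : ℝ => ((a + t) + (b + t)) ^ k) := by fun_prop
    have h := this.tendsto 0
    simp only [add_zero] at h
    exact h.mono_left nhdsWithin_le_nhds
  refine ge_of_tendsto hlim ?_
  filter_upwards [self_mem_nhdsWithin] with t ht
  have ht : 0 < t := ht
  refine key _ _ (by positivity) (by positivity) (hua.trans ?_) (hvb.trans ?_)
  · gcongr; linarith
  · gcongr; linarith

lemma hd_bonami (k : ℕ) (T : Finset B) : ∀ c : Finset B → ℝ,
    hdAv (fun ε => (∑ S ∈ T.powerset, c S * hdChi S ε) ^ (2 * k))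
      ≤ (∑ S ∈ T.powerset, (4 * k + 1 : ℝ) ^ S.card * c S ^ 2) ^ k := by
  induction T using Finset.induction_on with
  | empty =>
    intro c
    simp [hdChi, hdAv_const, pow_mul]
  | insert a T haT ih =>
    intro c
    set c' : Finset B → ℝ := fun S => c (insert a S) with hc'
    set G : (B → Bool) → ℝ := fun ε => ∑ S ∈ T.powerset, c S * hdChi S ε with hG
    set H : (B → Bool) → ℝ := fun ε => ∑ S ∈ T.powerset, c' S * hdChi S ε with hH
    have hF : ∀ ε, ∑ S ∈ (insert a T).powerset, c S * hdChi S ε = G ε + hdSgn (ε a) * H ε := by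
      intro ε
      rw [Finset.sum_powerset_insert haT, hG, hH]
      simp only [Finset.mul_sum]
      congr 1
      refine Finset.sum_congr rfl fun S hS => ?_
      have : a ∉ S := fun h => haT (Finset.mem_powerset.1 hS h)
      simp only [hc', hdChi, Finset.prod_insert this]
      ring
    have hGf : ∀ ε, G (hdFlip a ε) = G ε := by
      intro ε
      simp only [hG]
      refine Finset.sum_congr rfl fun S hS => ?_
      rw [hdChi_flip_not_mem fun h => haT (Finset.mem_powerset.1 hS h)]
    have hHf : ∀ ε, H (hdFlip a ε) = H ε := by
      intro ε
      simp only [hH]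
      refine Finset.sum_congr rfl fun S hS => ?_
      rw [hdChi_flip_not_mem fun h => haT (Finset.mem_powerset.1 hS h)]
    have hsf : ∀ ε : B → Bool, hdSgn (hdFlip a ε a) = - hdSgn (ε a) := by
      intro ε
      simp only [hdFlip, hdSgn, Function.update_self]
      cases ε a <;> simp
    have step : hdAv (fun ε => (G ε + hdSgn (ε a) * H ε) ^ (2 * k))
        ≤ hdAv (fun ε => (G ε ^ 2 + (4 * k + 1) * H ε ^ 2) ^ k) := by
      have h1 := hdAv_flip a (fun ε => (G ε + hdSgn (ε a) * H ε) ^ (2 * k))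
      simp only [hGf, hHf, hsf] at h1
      have h2 : hdAv (fun ε => (G ε + hdSgn (ε a) * H ε) ^ (2 * k))
        = hdAv (fun ε => (1 / 2 : ℝ) * ((G ε + hdSgn (ε a) * H ε) ^ (2 * k)
          + (G ε + -hdSgn (ε a) * H ε) ^ (2 * k))) := by
        rw [hdAv_mul, hdAv_add, h1]; ring
      rw [h2]
      refine hdAv_mono fun ε => ?_
      have := (hd_two_point k (G ε) (H ε) k le_rfl).1
      have e : (1 / 2 : ℝ) * ((G ε + hdSgn (ε a) * H ε) ^ (2 * k)
          + (G ε + -hdSgn (ε a) * H ε) ^ (2 * k))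
          = ((G ε + H ε) ^ (2 * k) + (G ε - H ε) ^ (2 * k)) / 2 := by
        unfold hdSgn; split_ifs
        · ring
        · ring
      rw [e]; exact this
    simp only [hF]
    refine step.trans ?_
    rw [Finset.sum_powerset_insert haT]
    have e2 : ∑ S ∈ T.powerset, (4 * k + 1 : ℝ) ^ (insert a S).card * c (insert a S) ^ 2
        = (4 * k + 1) * ∑ S ∈ T.powerset, (4 * k + 1 : ℝ) ^ S.card * c' S ^ 2 := by
      rw [Finset.mul_sum]
      refine Finset.sum_congr rfl fun S hS => ?_
      have : a ∉ S := fun h => haT (Finset.mem_powerset.1 hS h)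
      rw [Finset.card_insert_of_notMem this, pow_succ]; ring
    rw [e2]
    refine hd_mink (fun ε => by positivity) (fun ε => by positivity)
      (Finset.sum_nonneg fun S _ => by positivity)
      (mul_nonneg (by positivity) (Finset.sum_nonneg fun S _ => by positivity)) ?_ ?_
    · have := ih c
      simpa only [pow_mul] using this
    · have := ih c'
      simp only [mul_pow]
      rw [hdAv_mul]
      refine mul_le_mul_of_nonneg_left ?_ (by positivity)
      simpa only [pow_mul] using this
end Cube

section CubeB
variable {B : Type*} [Fintype B] [DecidableEq B]

lemma hdAv_nonneg {F : (B → Bool) → ℝ} (h : ∀ ε, 0 ≤ F ε) : 0 ≤ hdAv F := by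
  have := hdAv_mono h
  rwa [hdAv_const] at this

lemma hdAv_rpow {G : (B → Bool) → ℝ} (h : ∀ ε, 0 ≤ G ε) {q : ℝ} (hq : 1 ≤ q) :
    (hdAv G) ^ q ≤ hdAv (fun ε => G ε ^ q) := by
  have := Real.rpow_arith_mean_le_arith_mean_rpow Finset.univ
    (fun _ : B → Bool => ((Fintype.card (B → Bool) : ℝ))⁻¹) G (fun _ _ => by positivity)
    (by simp) (fun ε _ => h ε) hq
  simpa [hdAv, ← Finset.mul_sum, div_eq_inv_mul] using this

lemma hd_coeff (c : Finset B → ℝ) (T : Finset B) :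
    hdAv (fun ε => (∑ S, c S * hdChi S ε) * hdChi T ε) = c T := by
  simp only [Finset.sum_mul, mul_assoc]
  rw [hdAv_sum]
  simp only [hdAv_mul]
  rw [Finset.sum_eq_single T]
  · simp [hdChi_sq, hdAv_const]
  · intro S _ hS; rw [hdAv_chi_chi hS, mul_zero]
  · simp

lemma hd_parseval (c : Finset B → ℝ) :
    hdAv (fun ε => (∑ S, c S * hdChi S ε) ^ 2) = ∑ S, c S ^ 2 := by
  have : ∀ ε, (∑ S, c S * hdChi S ε) ^ 2
      = ∑ T, c T * ((∑ S, c S * hdChi S ε) * hdChi T ε) := by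
    intro ε
    rw [sq]
    conv_lhs => rw [Finset.mul_sum]
    exact Finset.sum_congr rfl fun T _ => by ring
  simp only [this]
  rw [hdAv_sum]
  simp only [hdAv_mul, hd_coeff, sq]

lemma hd_bonami_deg (k d : ℕ) (c : Finset B → ℝ) (hc : ∀ S, d < S.card → c S = 0) :
    hdAv (fun ε => (∑ S, c S * hdChi S ε) ^ (2 * k))
      ≤ ((4 * k + 1 : ℝ) ^ d * ∑ S, c S ^ 2) ^ k := by
  have h := hd_bonami k (Finset.univ : Finset B) c
  rw [Finset.powerset_univ] at h
  refine h.trans ?_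
  have h1 : ∑ S, (4 * k + 1 : ℝ) ^ S.card * c S ^ 2 ≤ (4 * k + 1 : ℝ) ^ d * ∑ S, c S ^ 2 := by
    rw [Finset.mul_sum]
    refine Finset.sum_le_sum fun S _ => ?_
    by_cases hS : d < S.card
    · simp [hc S hS]
    · gcongr
      · have : (0 : ℝ) ≤ k := Nat.cast_nonneg k
        linarith
      · omega
  have h0 : 0 ≤ ∑ S, (4 * k + 1 : ℝ) ^ S.card * c S ^ 2 :=
    Finset.sum_nonneg fun S _ => by positivity
  gcongr

lemma hd_kh_upper {k d : ℕ} {p : ℝ} (hp : 1 ≤ p) (hk : p ≤ 2 * k) {ι : Type*} [Fintype ι]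
    (S : ι → Finset B) (hS : Function.Injective S) (hd : ∀ i, (S i).card ≤ d) (c : ι → ℝ) :
    hdAv (fun ε => |∑ i, c i * hdChi (S i) ε| ^ p)
      ≤ ((4 * k + 1 : ℝ) ^ d) ^ (p / 2) * (∑ i, c i ^ 2) ^ (p / 2) := by
  classical
  set c' : Finset B → ℝ := Function.extend S c 0 with hc'
  have hne : ∀ T, T ∉ Set.range S → c' T = 0 := by
    intro T hT
    rw [hc', Function.extend_apply' _ _ _ (by simpa using hT)]; rfl
  have heq : ∀ i, c' (S i) = c i := fun i => hS.extend_apply _ _ _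
  have e1 : ∀ ε, ∑ i, c i * hdChi (S i) ε = ∑ T, c' T * hdChi T ε := by
    intro ε
    refine Fintype.sum_of_injective S hS _ _ ?_ ?_
    · intro T hT; rw [hne T hT, zero_mul]
    · intro i; rw [heq]
  have e2 : ∑ i, c i ^ 2 = ∑ T, c' T ^ 2 := by
    refine Fintype.sum_of_injective S hS _ _ ?_ ?_
    · intro T hT; rw [hne T hT]; simp
    · intro i; rw [heq]
  have hc0 : ∀ T : Finset B, d < T.card → c' T = 0 := by
    intro T hT
    refine hne T ?_
    rintro ⟨i, rfl⟩
    exact absurd (hd i) (by omega)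
  have hb := hd_bonami_deg k d c' hc0
  simp only [e1]
  rw [e2]
  set F : (B → Bool) → ℝ := fun ε => ∑ T, c' T * hdChi T ε with hF
  set s := ∑ T, c' T ^ 2 with hs
  have hs0 : 0 ≤ s := Finset.sum_nonneg fun _ _ => sq_nonneg _
  have hp0 : 0 < p := by linarith
  have hq : 1 ≤ 2 * k / p := by rw [le_div_iff₀ hp0]; linarith
  have hk0 : (0 : ℝ) < k := by linarith
  have h1 := hdAv_rpow (G := fun ε => |F ε| ^ p) (fun ε => by positivity) hq
  have h2 : ∀ ε, (|F ε| ^ p) ^ (2 * k / p) = F ε ^ (2 * k) := by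
    intro ε
    rw [← Real.rpow_mul (abs_nonneg _), mul_div_cancel₀ _ hp0.ne']
    have : (2 * k : ℝ) = ((2 * k : ℕ) : ℝ) := by push_cast; ring
    rw [this, Real.rpow_natCast, pow_mul, sq_abs, ← pow_mul]
  simp only [h2] at h1
  have h3 := h1.trans hb
  have hA0 : 0 ≤ hdAv (fun ε => |F ε| ^ p) := hdAv_nonneg fun ε => by positivity
  have h4 := Real.rpow_le_rpow (by positivity) h3 (show 0 ≤ p / (2 * k) by positivity)
  rw [← Real.rpow_mul hA0, div_mul_div_cancel₀ (by positivity), div_self (by positivity), Real.rpow_one,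
    ← Real.rpow_natCast, ← Real.rpow_mul (by positivity)] at h4
  have e3 : (k : ℝ) * (p / (2 * k)) = p / 2 := by field_simp
  rw [e3, Real.mul_rpow (by positivity) hs0] at h4
  exact h4

lemma hd_kh_lower_sq {d : ℕ} (c : Finset B → ℝ) (hc : ∀ S, d < S.card → c S = 0) :
    ∑ S, c S ^ 2 ≤ (8 * 81 ^ d) * (hdAv (fun ε => |∑ S, c S * hdChi S ε|)) ^ 2 := by
  have hb := hd_bonami_deg 2 d c hc
  have hpv := hd_parseval c
  set F : (B → Bool) → ℝ := fun ε => ∑ T, c T * hdChi T ε with hF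
  set s := ∑ T, c T ^ 2 with hs
  have hs0 : 0 ≤ s := Finset.sum_nonneg fun _ _ => sq_nonneg _
  rcases hs0.eq_or_lt with h0 | hpos
  · rw [← h0]; positivity
  set b : ℝ := 81 ^ d with hbdef
  have hb0 : 0 < b := by positivity
  have hb' : hdAv (fun ε => F ε ^ 4) ≤ b * s ^ 2 := by
    refine hb.trans (le_of_eq ?_)
    rw [mul_pow, ← pow_mul, mul_comm d 2, pow_mul, hbdef]; norm_num
  set l := Real.sqrt (2 * b * s) with hl
  have hl2 : l ^ 2 = 2 * b * s := Real.sq_sqrt (by positivity)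
  have hl0 : 0 < l := Real.sqrt_pos.2 (by positivity)
  have hpt : ∀ ε, l ^ 2 * F ε ^ 2 ≤ l ^ 3 * |F ε| + F ε ^ 4 := by
    intro ε
    have e2 : F ε ^ 2 = |F ε| ^ 2 := (sq_abs _).symm
    have e4 : F ε ^ 4 = |F ε| ^ 4 := by
      rw [show 4 = 2 * 2 by norm_num, pow_mul, e2, ← pow_mul]
    rw [e2, e4]
    have hu := abs_nonneg (F ε)
    generalize |F ε| = u at hu
    rcases le_total u l with h | h
    · have : 0 ≤ l ^ 2 * u * (l - u) := by
        have := sub_nonneg.2 h; positivity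
      have h4 : 0 ≤ u ^ 4 := by positivity
      nlinarith
    · have : 0 ≤ u ^ 2 * ((u - l) * (u + l)) := by
        have := sub_nonneg.2 h; positivity
      have h4 : 0 ≤ l ^ 3 * u := by positivity
      nlinarith
  have hav := hdAv_mono hpt
  rw [hdAv_mul, hdAv_add, hdAv_mul, hpv] at hav
  set A := hdAv (fun ε => |F ε|) with hA
  have hA0 : 0 ≤ A := hdAv_nonneg fun _ => abs_nonneg _
  have h1 : b * s ^ 2 ≤ l ^ 3 * A := by
    rw [hl2] at hav; nlinarith
  have h2 : s ≤ 2 * l * A := by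
    have : (b * s) * s ≤ (b * s) * (2 * l * A) := by
      calc (b * s) * s = b * s ^ 2 := by ring
        _ ≤ l ^ 3 * A := h1
        _ = l ^ 2 * l * A := by ring
        _ = _ := by rw [hl2]; ring
    exact le_of_mul_le_mul_left this (by positivity)
  have h3 : s * s ≤ s * (8 * b * A ^ 2) := by
    calc s * s ≤ (2 * l * A) * (2 * l * A) := by gcongr
      _ = 4 * l ^ 2 * A ^ 2 := by ring
      _ = _ := by rw [hl2]; ring
  exact le_of_mul_le_mul_left h3 hpos

def hdLow (d : ℕ) (F : (B → Bool) → ℝ) : Prop :=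
  ∃ c : Finset B → ℝ, (∀ S, d < S.card → c S = 0) ∧ ∀ ε, F ε = ∑ S, c S * hdChi S ε

def hdSub (T : Finset B) (F : (B → Bool) → ℝ) : Prop :=
  ∃ c : Finset B → ℝ, (∀ S, ¬ S ⊆ T → c S = 0) ∧ ∀ ε, F ε = ∑ S, c S * hdChi S ε

lemma hdSub.low {T : Finset B} {F : (B → Bool) → ℝ} (h : hdSub T F) {d : ℕ} (hT : T.card ≤ d) :
    hdLow d F := by
  obtain ⟨c, hc, hF⟩ := h
  refine ⟨c, fun S hS => hc S fun h => ?_, hF⟩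
  have := Finset.card_le_card h
  omega

lemma hdLow.sum {ι : Type*} (s : Finset ι) (a : ι → ℝ) {d : ℕ} {F : ι → (B → Bool) → ℝ}
    (h : ∀ i ∈ s, hdLow d (F i)) : hdLow d (fun ε => ∑ i ∈ s, a i * F i ε) := by
  classical
  induction s using Finset.induction_on with
  | empty => exact ⟨0, by simp, by simp⟩
  | insert i s hi ih =>
    obtain ⟨c, hc, hF⟩ := ih fun j hj => h j (Finset.mem_insert_of_mem hj)
    obtain ⟨c', hc', hF'⟩ := h i (Finset.mem_insert_self _ _)
    refine ⟨fun S => a i * c' S + c S, fun S hS => by simp [hc S hS, hc' S hS], fun ε => ?_⟩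
    beta_reduce at hF ⊢
    rw [Finset.sum_insert hi, hF, hF', Finset.mul_sum, ← Finset.sum_add_distrib]
    exact Finset.sum_congr rfl fun S _ => by ring

lemma hdSub.sum {ι : Type*} (s : Finset ι) (a : ι → ℝ) {T : Finset B} {F : ι → (B → Bool) → ℝ}
    (h : ∀ i ∈ s, a i ≠ 0 → hdSub T (F i)) : hdSub T (fun ε => ∑ i ∈ s, a i * F i ε) := by
  classical
  induction s using Finset.induction_on with
  | empty => exact ⟨0, by simp, by simp⟩
  | insert i s hi ih =>
    obtain ⟨c, hc, hF⟩ := ih fun j hj => h j (Finset.mem_insert_of_mem hj)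
    by_cases hai : a i = 0
    · exact ⟨c, hc, fun ε => by
        beta_reduce at hF ⊢
        rw [Finset.sum_insert hi, hai, zero_mul, zero_add, hF]⟩
    obtain ⟨c', hc', hF'⟩ := h i (Finset.mem_insert_self _ _) hai
    refine ⟨fun S => a i * c' S + c S, fun S hS => by simp [hc S hS, hc' S hS], fun ε => ?_⟩
    beta_reduce at hF ⊢
    rw [Finset.sum_insert hi, hF, hF', Finset.mul_sum, ← Finset.sum_add_distrib]
    exact Finset.sum_congr rfl fun S _ => by ring

lemma hdSub_chi {S T : Finset B} (h : S ⊆ T) : hdSub T (hdChi S) := by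
  refine ⟨fun S' => if S' = S then 1 else 0, fun S' hS' => ?_, fun ε => by simp⟩
  refine if_neg ?_; rintro rfl; exact hS' h

lemma hdSub_junta (T : Finset B) : ∀ F : (B → Bool) → ℝ,
    (∀ ε ε', (∀ b ∈ T, ε b = ε' b) → F ε = F ε') → hdSub T F := by
  induction T using Finset.induction_on with
  | empty =>
    intro F hF
    refine ⟨fun S => if S = ∅ then F (fun _ => true) else 0, fun S hS => ?_, fun ε => ?_⟩
    · refine if_neg ?_; rintro rfl; exact hS (Finset.Subset.refl _)
    · simp [hdChi]; exact hF _ _ (by simp)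
  | insert a T ha ih =>
    intro F hF
    set G : (B → Bool) → ℝ := fun ε =>
      (F (Function.update ε a true) + F (Function.update ε a false)) / 2 with hG
    set H : (B → Bool) → ℝ := fun ε =>
      (F (Function.update ε a true) - F (Function.update ε a false)) / 2 with hH
    have key : ∀ (v : Bool) (ε ε' : B → Bool), (∀ b ∈ T, ε b = ε' b) →
        F (Function.update ε a v) = F (Function.update ε' a v) := by
      intro v ε ε' h
      refine hF _ _ fun b hb => ?_
      by_cases hba : b = a
      · subst hba; simp
      · simp [hba, h b ((Finset.mem_insert.1 hb).resolve_left hba)]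
    obtain ⟨c, hc, hcG⟩ := ih G fun ε ε' h => by simp only [hG, key _ ε ε' h]
    obtain ⟨c', hc', hcH⟩ := ih H fun ε ε' h => by simp only [hH, key _ ε ε' h]
    have hFe : ∀ ε, F ε = G ε + hdSgn (ε a) * H ε := by
      intro ε
      have : ε = Function.update ε a (ε a) := by simp
      simp only [hG, hH, hdSgn]
      rcases hv : ε a with _ | _
      · rw [hv] at this
        rw [← this]; simp; ring
      · rw [hv] at this
        rw [← this]; simp; ring
    have h1 : hdSub (insert a T) (fun ε => ∑ S, c S * hdChi S ε) := by
      refine hdSub.sum _ _ fun S _ hS => hdSub_chi ?_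
      by_contra hST
      exact hS (hc S fun h => hST (h.trans (Finset.subset_insert _ _)))
    have h2 : hdSub (insert a T) (fun ε => ∑ S, c' S * hdChi (insert a S) ε) := by
      refine hdSub.sum _ _ fun S _ hS => hdSub_chi ?_
      by_contra hST
      exact hS (hc' S fun h => hST (Finset.insert_subset_insert _ h))
    have h3 := hdSub.sum (T := insert a T) (Finset.univ : Finset Bool) (fun _ => 1)
      (F := fun b => if b then (fun ε => ∑ S, c S * hdChi S ε) else
        (fun ε => ∑ S, c' S * hdChi (insert a S) ε)) (by
          intro b _ _; cases b
          · simpa using h2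
          · simpa using h1)
    convert h3 using 2 with ε
    rw [hFe, hcG, hcH]
    simp only [Fintype.sum_bool, one_mul, if_true, Bool.false_eq_true, if_false]
    rw [Finset.mul_sum]
    congr 1
    refine Finset.sum_congr rfl fun S _ => ?_
    by_cases hS : S ⊆ T
    · have : a ∉ S := fun h => ha (hS h)
      simp only [hdChi, Finset.prod_insert this]; ring
    · simp [hc' S hS]

lemma hd_kh_lower {d : ℕ} {p : ℝ} (hp : 1 ≤ p) {ι : Type*} [Fintype ι]
    (S : ι → Finset B) (hS : Function.Injective S) {F : (B → Bool) → ℝ} (hF : hdLow d F) :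
    (∑ i, hdAv (fun ε => F ε * hdChi (S i) ε) ^ 2) ^ (p / 2)
      ≤ (8 * 81 ^ d : ℝ) ^ (p / 2) * hdAv (fun ε => |F ε| ^ p) := by
  obtain ⟨c, hc, hFc⟩ := hF
  obtain rfl : F = fun ε => ∑ S, c S * hdChi S ε := funext hFc
  simp only [hd_coeff]
  have h1 : ∑ i, c (S i) ^ 2 ≤ ∑ T, c T ^ 2 := by
    classical
    rw [← Finset.sum_image (f := fun T => c T ^ 2) (s := Finset.univ) (g := S) (fun _ _ _ _ h => hS h)]
    exact Finset.sum_le_sum_of_subset_of_nonneg (Finset.subset_univ _) fun _ _ _ => sq_nonneg _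
  have h2 := hd_kh_lower_sq c hc
  have h3 := hdAv_rpow (G := fun ε => |∑ S, c S * hdChi S ε|) (fun _ => abs_nonneg _) hp
  set A := hdAv (fun ε => |∑ S, c S * hdChi S ε|) with hA
  have hA0 : 0 ≤ A := hdAv_nonneg fun _ => abs_nonneg _
  calc (∑ i, c (S i) ^ 2) ^ (p / 2) ≤ ((8 * 81 ^ d) * A ^ 2) ^ (p / 2) := by
        refine Real.rpow_le_rpow (Finset.sum_nonneg fun _ _ => sq_nonneg _) (h1.trans h2) (by linarith)
    _ = (8 * 81 ^ d : ℝ) ^ (p / 2) * A ^ p := by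
        rw [Real.mul_rpow (by positivity) (by positivity), ← Real.rpow_natCast A 2, ← Real.rpow_mul hA0]
        congr 2
        push_cast; ring
    _ ≤ _ := by gcongr
end CubeB

section Meas
variable {Ω : Type u} [MeasurableSpace Ω] (μ : Measure Ω) [IsProbabilityMeasure μ]

noncomputable abbrev hdP (J : Type) [Fintype J] : Measure (J → Ω) := Measure.pi fun _ : J => μ

variable {I J : Type} [Fintype I] [Fintype J] [DecidableEq I] [DecidableEq J]

lemma hd_mp_comp {e : I → J} (he : Function.Injective e) :
    MeasurePreserving (fun (x : J → Ω) (i : I) => x (e i)) (hdP μ J) (hdP μ I) := by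
  refine ⟨by fun_prop, ?_⟩
  symm
  refine Measure.pi_eq fun s hs => ?_
  rw [Measure.map_apply (by fun_prop) (MeasurableSet.univ_pi hs)]
  have : (fun (x : J → Ω) (i : I) => x (e i)) ⁻¹' (Set.univ.pi s)
      = Set.univ.pi (Function.extend e s (fun _ => Set.univ)) := by
    ext x
    simp only [Set.mem_preimage, Set.mem_univ_pi]
    constructor
    · intro h j
      by_cases hj : ∃ i, e i = j
      · obtain ⟨i, rfl⟩ := hj
        rw [he.extend_apply]; exact h i
      · rw [Function.extend_apply' _ _ _ hj]; trivial
    · intro h i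
      have := h (e i)
      rwa [he.extend_apply] at this
  rw [this, Measure.pi_pi]
  symm
  refine Fintype.prod_of_injective e he _ _ ?_ ?_
  · intro j hj
    rw [Function.extend_apply' _ _ _ (by simpa using hj)]; simp
  · intro i; rw [he.extend_apply]

lemma hd_mp_update (j : J) :
    MeasurePreserving (fun q : (J → Ω) × Ω => Function.update q.1 j q.2)
      ((hdP μ J).prod μ) (hdP μ J) := by
  have hm : Measurable (fun q : (J → Ω) × Ω => Function.update q.1 j q.2) :=
    measurable_update'
  refine ⟨hm, ?_⟩
  symm
  refine Measure.pi_eq fun s hs => ?_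
  rw [Measure.map_apply hm (MeasurableSet.univ_pi hs)]
  have : (fun q : (J → Ω) × Ω => Function.update q.1 j q.2) ⁻¹' (Set.univ.pi s)
      = (Set.univ.pi (Function.update s j Set.univ)) ×ˢ (s j) := by
    ext ⟨x, z⟩
    simp only [Set.mem_preimage, Set.mem_univ_pi, Set.mem_prod]
    constructor
    · intro h
      refine ⟨fun i => ?_, by simpa using h j⟩
      by_cases hi : i = j
      · subst hi; simp
      · simpa [hi] using h i
    · rintro ⟨h, h'⟩ i
      by_cases hi : i = j
      · subst hi; simpa using h'
      · simpa [hi] using h i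
  rw [this, Measure.prod_prod, Measure.pi_pi, ← Finset.mul_prod_erase _ _ (Finset.mem_univ j),
    ← Finset.mul_prod_erase _ (fun i => μ (s i)) (Finset.mem_univ j)]
  rw [Function.update_self, measure_univ, one_mul, mul_comm]
  congr 1
  refine Finset.prod_congr rfl fun i hi => ?_
  rw [Function.update_of_ne (Finset.ne_of_mem_erase hi)]

lemma hd_mp_uncurry (m n : ℕ) :
    MeasurePreserving (fun (x : Fin m → Fin n → Ω) (b : Fin m × Fin n) => x b.1 b.2)
      (Measure.pi fun _ : Fin m => Measure.pi fun _ : Fin n => μ) (hdP μ (Fin m × Fin n)) := by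
  refine ⟨by fun_prop, ?_⟩
  symm
  refine Measure.pi_eq fun s hs => ?_
  rw [Measure.map_apply (by fun_prop) (MeasurableSet.univ_pi hs)]
  have : (fun (x : Fin m → Fin n → Ω) (b : Fin m × Fin n) => x b.1 b.2) ⁻¹' (Set.univ.pi s)
      = Set.univ.pi (fun k => Set.univ.pi fun i => s (k, i)) := by
    ext x
    simp [Prod.forall]
  rw [this, Measure.pi_pi]
  simp only [Measure.pi_pi]
  rw [Fintype.prod_prod_type]

lemma hd_jensen {N : Type*} [Fintype N] {p : ℝ} (hp : 1 ≤ p) (v : Ω → N → ℝ)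
    (hv : ∀ ν, Integrable (fun z => v z ν) μ) :
    ENNReal.ofReal ((∑ ν, (∫ z, v z ν ∂μ) ^ 2) ^ (p / 2))
      ≤ ∫⁻ z, ENNReal.ofReal ((∑ ν, v z ν ^ 2) ^ (p / 2)) ∂μ := by
  set w : Ω → EuclideanSpace ℝ N := fun z => WithLp.toLp 2 (v z) with hw
  have hwi : Integrable w μ := by
    rw [integrable_piLp_iff]
    exact hv
  have hp0 : 0 < p := by linarith
  have hn : ∀ y : EuclideanSpace ℝ N, ENNReal.ofReal ((∑ ν, y ν ^ 2) ^ (p / 2)) = ‖y‖ₑ ^ p := by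
    intro y
    have h0 : 0 ≤ ∑ ν, y ν ^ 2 := Finset.sum_nonneg fun _ _ => sq_nonneg _
    rw [← ofReal_norm, ENNReal.ofReal_rpow_of_nonneg (norm_nonneg _) hp0.le,
      EuclideanSpace.norm_eq]
    congr 1
    simp only [Real.norm_eq_abs, sq_abs]
    rw [Real.sqrt_eq_rpow, ← Real.rpow_mul h0]
    congr 1; ring
  have h1 : ∀ ν, (∫ z, w z ∂μ) ν = ∫ z, v z ν ∂μ := fun ν => by
    rw [eval_integral_piLp hv]
  have h2 := hn (∫ z, w z ∂μ)
  simp only [h1] at h2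
  have h3 : ∀ z, ENNReal.ofReal ((∑ ν, v z ν ^ 2) ^ (p / 2)) = ‖w z‖ₑ ^ p := fun z => hn (w z)
  rw [h2]
  simp only [h3]
  have h4 := eLpNorm'_le_eLpNorm'_of_exponent_le (f := w) one_pos hp μ hwi.aestronglyMeasurable
  simp only [eLpNorm'_eq_lintegral_enorm, ENNReal.rpow_one, div_one] at h4
  calc ‖∫ z, w z ∂μ‖ₑ ^ p ≤ (∫⁻ z, ‖w z‖ₑ ∂μ) ^ p := by
        gcongr; exact enorm_integral_le_lintegral_enorm _
    _ ≤ ((∫⁻ z, ‖w z‖ₑ ^ p ∂μ) ^ (1 / p)) ^ p := by gcongr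
    _ = _ := by rw [← ENNReal.rpow_mul, one_div, inv_mul_cancel₀ hp0.ne', ENNReal.rpow_one]

/-- `g` is integrable, depends only on the coordinates in `s`, and has mean zero in each of them. -/
structure hdMZ (s : Finset J) (g : (J → Ω) → ℝ) : Prop where
  meas : Measurable g
  int : Integrable g (hdP μ J)
  out : ∀ j, j ∉ s → ∀ x z, g (Function.update x j z) = g x
  mz : ∀ j, j ∈ s → ∀ᵐ x ∂(hdP μ J), ∫ z, g (Function.update x j z) ∂μ = 0

variable {μ}

lemma hdMZ_comp {f : (I → Ω) → ℝ} (hf : Measurable f) (hi : Integrable f (hdP μ I))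
    (h0 : ∀ k, ∀ᵐ y ∂(hdP μ I), ∫ z, f (Function.update y k z) ∂μ = 0)
    {e : I → J} (he : Function.Injective e) :
    hdMZ μ (Finset.univ.image e) (fun x => f (fun k => x (e k))) where
  meas := by fun_prop
  int := (hd_mp_comp μ he).integrable_comp_of_integrable hi
  out := by
    intro j hj x z
    congr 1
    funext k
    rw [Function.update_of_ne]
    rintro rfl
    exact hj (Finset.mem_image_of_mem _ (Finset.mem_univ _))
  mz := by
    intro j hj
    obtain ⟨k, _, rfl⟩ := Finset.mem_image.1 hj
    have := (hd_mp_comp μ he).quasiMeasurePreserving.ae (h0 k)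
    filter_upwards [this] with x hx
    rw [← hx]
    congr 1
    funext z
    congr 1
    exact Function.update_comp_eq_of_injective x he k z

lemma hdMZ_zero (s : Finset J) : hdMZ μ s (fun _ : J → Ω => (0 : ℝ)) :=
  ⟨measurable_const, integrable_zero _ _ _, by simp, by simp⟩

lemma hd_ce_one {N R : Type*} [Fintype N] [Fintype R] {p : ℝ} (hp : 1 ≤ p)
    (s : R → Finset J) (g : R → (J → Ω) → ℝ) (hg : ∀ r, hdMZ μ (s r) (g r)) (a : N → R → ℝ) (j : J) :
    ∫⁻ x, ENNReal.ofReal ((∑ ν, (∑ r, (if j ∉ s r then a ν r else 0) * g r x) ^ 2) ^ (p / 2))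
        ∂(hdP μ J)
      ≤ ∫⁻ x, ENNReal.ofReal ((∑ ν, (∑ r, a ν r * g r x) ^ 2) ^ (p / 2)) ∂(hdP μ J) := by
  have hmp := hd_mp_update μ j
  have hgm := fun r => (hg r).meas
  have hIntg : ∀ᵐ x ∂(hdP μ J), ∀ r, Integrable (fun z => g r (Function.update x j z)) μ := by
    rw [ae_all_iff]
    intro r
    have h1 := hmp.integrable_comp_of_integrable (hg r).int
    exact h1.prod_right_ae
  have hval : ∀ᵐ x ∂(hdP μ J), ∀ r, ∫ z, g r (Function.update x j z) ∂μ
      = if j ∉ s r then g r x else 0 := by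
    rw [ae_all_iff]
    intro r
    by_cases hj : j ∈ s r
    · simpa [hj] using (hg r).mz j hj
    · simp [hj, (hg r).out j hj]
  have hmeas : Measurable fun x : J → Ω =>
      ENNReal.ofReal ((∑ ν, (∑ r, a ν r * g r x) ^ 2) ^ (p / 2)) := by fun_prop
  have hR := hmp.lintegral_comp hmeas
  have hm2 := hmeas.comp hmp.measurable
  simp only [Function.comp_def] at hm2
  rw [← hR, lintegral_prod _ hm2.aemeasurable]
  refine lintegral_mono_ae ?_
  filter_upwards [hIntg, hval] with x hx1 hx2
  have hJ := hd_jensen μ hp (fun z ν => ∑ r, a ν r * g r (Function.update x j z))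
    (fun ν => integrable_finsetSum _ fun r _ => (hx1 r).const_mul _)
  refine le_trans (le_of_eq ?_) hJ
  congr 2
  refine Finset.sum_congr rfl fun ν _ => ?_
  congr 1
  rw [integral_finsetSum _ fun r _ => (hx1 r).const_mul _]
  refine Finset.sum_congr rfl fun r _ => ?_
  rw [integral_const_mul, hx2 r]
  split_ifs <;> simp

lemma hd_ce {N R : Type*} [Fintype N] [Fintype R] {p : ℝ} (hp : 1 ≤ p)
    (s : R → Finset J) (g : R → (J → Ω) → ℝ) (hg : ∀ r, hdMZ μ (s r) (g r)) (a : N → R → ℝ)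
    (D : Finset J) :
    ∫⁻ x, ENNReal.ofReal ((∑ ν, (∑ r, (if Disjoint (s r) D then a ν r else 0) * g r x) ^ 2) ^ (p / 2))
        ∂(hdP μ J)
      ≤ ∫⁻ x, ENNReal.ofReal ((∑ ν, (∑ r, a ν r * g r x) ^ 2) ^ (p / 2)) ∂(hdP μ J) := by
  induction D using Finset.induction_on with
  | empty => simp
  | insert j D hj ih =>
    refine le_trans ?_ ih
    have := hd_ce_one hp s g hg (fun ν r => if Disjoint (s r) D then a ν r else 0) j
    refine le_trans (le_of_eq ?_) this
    congr 1
    funext x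
    congr 2
    refine Finset.sum_congr rfl fun ν _ => ?_
    congr 1
    refine Finset.sum_congr rfl fun r _ => ?_
    congr 1
    simp only [Finset.disjoint_insert_right]
    by_cases h1 : j ∈ s r <;> by_cases h2 : Disjoint (s r) D <;> simp [h1, h2]

/-- finite convexity -/
lemma hd_avg {A : Type*} [Fintype A] [Nonempty A] {p : ℝ} (hp : 1 ≤ p) (y : A → ℝ) :
    |(Fintype.card A : ℝ)⁻¹ * ∑ a, y a| ^ p ≤ (Fintype.card A : ℝ)⁻¹ * ∑ a, |y a| ^ p := by
  have := Real.rpow_arith_mean_le_arith_mean_rpow Finset.univ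
    (fun _ : A => ((Fintype.card A : ℝ))⁻¹) (fun a => |y a|) (fun _ _ => by positivity)
    (by simp) (fun ε _ => abs_nonneg _) hp
  simp only [← Finset.mul_sum] at this
  refine le_trans ?_ this
  rw [abs_mul, abs_of_nonneg (show (0 : ℝ) ≤ (Fintype.card A : ℝ)⁻¹ by positivity)]
  gcongr
  exact Finset.abs_sum_le_sum_abs _ _

/-- The average of functions each having the `p`-th moment at most `V` has `p`-th moment at most `V`. -/
lemma hd_avg_int {A : Type*} [Fintype A] [Nonempty A] {p : ℝ} (hp : 1 ≤ p)
    (H : A → (J → Ω) → ℝ) (hH : ∀ a, Measurable (H a)) :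
    ∫⁻ x, ENNReal.ofReal (|(Fintype.card A : ℝ)⁻¹ * ∑ a, H a x| ^ p) ∂(hdP μ J)
      ≤ ENNReal.ofReal (Fintype.card A : ℝ)⁻¹ *
        ∑ a, ∫⁻ x, ENNReal.ofReal (|H a x| ^ p) ∂(hdP μ J) := by
  rw [← lintegral_finsetSum _ (fun a _ => by fun_prop), ← lintegral_const_mul _ (by fun_prop)]
  refine lintegral_mono fun x => ?_
  rw [← ENNReal.ofReal_sum_of_nonneg (fun a _ => by positivity), ← ENNReal.ofReal_mul (by positivity)]
  exact ENNReal.ofReal_le_ofReal (hd_avg hp _)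

lemma hd_count {m : ℕ} {X Y : Type*} [Fintype X] [Fintype Y] [DecidableEq X] [DecidableEq Y]
    (e : Fin m → X) (he : Function.Injective e) (y : Fin m → Y) :
    (Finset.univ.filter fun c : X → Y => ∀ k, c (e k) = y k).card * Fintype.card Y ^ m
      = Fintype.card (X → Y) := by
  have h1 : (Finset.univ.filter fun c : X → Y => ∀ k, c (e k) = y k)
      = Fintype.piFinset (fun x => Finset.univ.filter fun v : Y => ∀ k, e k = x → v = y k) := by
    ext c
    simp only [Finset.mem_filter, Finset.mem_univ, true_and, Fintype.mem_piFinset]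
    constructor
    · rintro h x k rfl; exact h k
    · intro h k; exact h _ k rfl
  have h2 : ∀ k, (Finset.univ.filter fun v : Y => ∀ k', e k' = e k → v = y k').card = 1 := by
    intro k
    rw [Finset.card_eq_one]
    refine ⟨y k, ?_⟩
    ext v
    simp only [Finset.mem_filter, Finset.mem_univ, true_and, Finset.mem_singleton]
    constructor
    · intro h; exact h k rfl
    · intro h k' hk'; rw [he hk', h]
  have h3 : ∀ x, x ∉ Finset.univ.image e →
      (Finset.univ.filter fun v : Y => ∀ k', e k' = x → v = y k').card = Fintype.card Y := by
    intro x hx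
    rw [Finset.filter_true_of_mem, Finset.card_univ]
    intro v _ k' hk'
    exact absurd (Finset.mem_image.2 ⟨k', Finset.mem_univ _, hk'⟩) hx
  rw [h1, Fintype.card_piFinset, ← Finset.prod_mul_prod_compl (Finset.univ.image e)]
  rw [Finset.prod_image (fun _ _ _ _ h => he h)]
  simp only [h2, Finset.prod_const_one, one_mul]
  rw [Finset.prod_congr rfl (fun x hx => h3 x (Finset.mem_compl.1 hx)), Finset.prod_const, ← pow_add,
    Fintype.card_fun, Finset.card_compl, Finset.card_image_of_injective _ he, Finset.card_univ,
    Fintype.card_fin]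
  congr 1
  have := Fintype.card_le_of_injective e he
  rw [Fintype.card_fin] at this
  omega
end Meas


lemma hd_sq_rpow (y p : ℝ) : (y ^ 2) ^ (p / 2) = |y| ^ p := by
  rw [← sq_abs, ← Real.rpow_natCast, ← Real.rpow_mul (abs_nonneg _)]
  congr 1; push_cast; ring

abbrev hdA (m n : ℕ) : Type := (Fin n → Option (Fin m)) × (Fin m × Fin n → Bool)

def hdS {m n : ℕ} (i : Fin m → Fin n) : Finset (Fin m × Fin n) := Finset.univ.image fun k => (k, i k)

lemma hdS_inj {m n : ℕ} : Function.Injective (hdS (m := m) (n := n)) := by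
  intro i i' h
  funext k
  have : (k, i k) ∈ hdS i' := h ▸ Finset.mem_image_of_mem _ (Finset.mem_univ k)
  obtain ⟨k', _, hk⟩ := Finset.mem_image.1 this
  simp only [Prod.mk.injEq] at hk
  obtain ⟨rfl, h2⟩ := hk
  exact h2.symm

lemma hdS_card {m n : ℕ} (i : Fin m → Fin n) : (hdS i).card ≤ m := by
  refine Finset.card_image_le.trans ?_
  simp

lemma hdChi_S_true {m n : ℕ} (i : Fin m → Fin n) (ε : Fin m × Fin n → Bool)
    (h : ∀ k, ε (k, i k) = true) : hdChi (hdS i) ε = 1 := by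
  refine Finset.prod_eq_one fun b hb => ?_
  obtain ⟨k, _, rfl⟩ := Finset.mem_image.1 hb
  simp [hdSgn, h k]

lemma hd_count2 {m n : ℕ} (i : Fin m → Fin n) (hi : Function.Injective i) :
    (Fintype.card (hdA m n) : ℝ)⁻¹ * ∑ a : hdA m n,
      (if (∀ k, a.1 (i k) = some k) ∧ (∀ k, a.2 (k, i k) = true) then (1 : ℝ) else 0)
      = (((m + 1) * 2 : ℝ) ^ m)⁻¹ := by
  have h1 := hd_count i hi (fun k => some k)
  have h2 := hd_count (fun k => (k, i k)) (fun k k' h => (Prod.mk.inj h).1) (fun _ => true)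
  set N1 := (Finset.univ.filter fun c : Fin n → Option (Fin m) => ∀ k, c (i k) = some k).card
  set N2 := (Finset.univ.filter fun c : Fin m × Fin n → Bool => ∀ k, c (k, i k) = true).card
  have h3 : ∑ a : hdA m n,
      (if (∀ k, a.1 (i k) = some k) ∧ (∀ k, a.2 (k, i k) = true) then (1 : ℝ) else 0)
      = N1 * N2 := by
    rw [Finset.sum_boole, ← Nat.cast_mul, ← Finset.card_product]
    congr 2
    ext a
    simp
  have h4 : (Fintype.card (hdA m n) : ℝ) = (N1 * (m + 1) ^ m) * (N2 * 2 ^ m) := by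
    rw [Fintype.card_prod, ← h1, ← h2]
    simp
  have hpos : (0 : ℝ) < Fintype.card (hdA m n) := by
    exact_mod_cast Fintype.card_pos
  rw [h4] at hpos
  have hN1 : (N1 : ℝ) ≠ 0 := by rintro h; rw [h] at hpos; simp at hpos
  have hN2 : (N2 : ℝ) ≠ 0 := by rintro h; rw [h] at hpos; simp at hpos
  rw [h3, h4, mul_pow]
  field_simp

lemma hdAv_prod {X B : Type*} [Fintype X] [Nonempty X] [Fintype B] [DecidableEq B] (G : (B → Bool) → ℝ) :
    (Fintype.card (X × (B → Bool)) : ℝ)⁻¹ * ∑ a : X × (B → Bool), G a.2 = hdAv G := by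
  have hc1 : (Fintype.card X : ℝ) ≠ 0 := by
    exact_mod_cast Fintype.card_ne_zero
  rw [Fintype.sum_prod_type, Fintype.card_prod, hdAv]
  simp only [Finset.sum_const, Finset.card_univ, nsmul_eq_mul, Nat.cast_mul]
  have hc2 : (Fintype.card (B → Bool) : ℝ) ≠ 0 := by
    exact_mod_cast Fintype.card_ne_zero
  field_simp

section Upper
variable {Ω : Type u} [MeasurableSpace Ω] (μ : Measure Ω) [IsProbabilityMeasure μ]

structure hdGood {m n : ℕ} (F : (Fin m → Fin n) → (Fin m → Ω) → ℝ) : Prop where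
  meas : ∀ i, Measurable (F i)
  supp : ∀ i, ¬ StrictMono i → F i = 0
  mz : ∀ i k, ∀ᵐ y ∂(hdP μ (Fin m)), ∫ z, F i (Function.update y k z) ∂μ = 0
  int : ∀ i, Integrable (F i) (hdP μ (Fin m))

variable {μ}

lemma hdGood.MZ {m n : ℕ} {F : (Fin m → Fin n) → (Fin m → Ω) → ℝ} (hF : hdGood μ F)
    {J : Type} [Fintype J] [DecidableEq J] (i : Fin m → Fin n) (e : Fin m → J)
    (he : StrictMono i → Function.Injective e) :
    hdMZ μ (Finset.univ.image e) (fun x => F i (fun k => x (e k))) := by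
  by_cases h : StrictMono i
  · exact hdMZ_comp (hF.meas i) (hF.int i) (hF.mz i) (he h)
  · rw [hF.supp i h]; exact hdMZ_zero _

def hdE {m n : ℕ} (a : hdA m n) (b : Fin m × Fin n) : Option (Fin m) × Fin n :=
  (if a.1 b.2 = some b.1 ∧ a.2 b = true then none else some b.1, b.2)

lemma hdE_inj {m n : ℕ} (a : hdA m n) : Function.Injective (hdE a) := by
  rintro ⟨k, i⟩ ⟨k', i'⟩ h
  simp only [hdE, Prod.mk.injEq] at h
  obtain ⟨h1, rfl⟩ := h
  split_ifs at h1 with h2 h3 h3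
  · have := h2.1.symm.trans h3.1
    simpa using this
  · simpa using h1

noncomputable def hdSq (μ : Measure Ω) [IsProbabilityMeasure μ] (p : ℝ) {m n : ℕ}
    (F : (Fin m → Fin n) → (Fin m → Ω) → ℝ) : ℝ≥0∞ :=
  ∫⁻ y, ENNReal.ofReal ((∑ i, F i (fun k => y (k, i k)) ^ 2) ^ (p / 2)) ∂(hdP μ (Fin m × Fin n))

lemma hd_upper {m n K : ℕ} {p : ℝ} (hp : 1 ≤ p) (hK : p ≤ 2 * K)
    {F : (Fin m → Fin n) → (Fin m → Ω) → ℝ} (hF : hdGood μ F) :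
    ∫⁻ x, ENNReal.ofReal (|∑ i, F i (fun k => x (i k))| ^ p) ∂(hdP μ (Fin n))
      ≤ ENNReal.ofReal ((((m + 1) * 2 : ℝ) ^ m) ^ p * ((4 * K + 1 : ℝ) ^ m) ^ (p / 2))
        * hdSq μ p F := by
  classical
  have hFm := hF.meas
  set q : ℝ := (((m + 1) * 2 : ℝ) ^ m) with hq
  have hq0 : 0 < q := by positivity
  set NA : ℝ := (Fintype.card (hdA m n) : ℝ)⁻¹ with hNA
  have hce := hd_ce (N := Unit) (R := hdA m n × (Fin m → Fin n)) (μ := μ) hp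
    (fun r => Finset.univ.image fun k => hdE r.1 (k, r.2 k))
    (fun r x => F r.2 (fun k => x (hdE r.1 (k, r.2 k))))
    (fun r => hF.MZ r.2 (fun k => hdE r.1 (k, r.2 k))
      (fun _ k k' h => (Prod.mk.inj (hdE_inj r.1 h)).1))
    (fun _ r => NA * hdChi (hdS r.2) r.1.2)
    (Finset.univ.filter fun j : Option (Fin m) × Fin n => j.1 ≠ none)
  simp only [Finset.univ_unique, Finset.sum_singleton, hd_sq_rpow] at hce
  -- left side
  have hL : ∀ x : Option (Fin m) × Fin n → Ω,
      ∑ r : hdA m n × (Fin m → Fin n),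
        (if Disjoint (Finset.univ.image fun k => hdE r.1 (k, r.2 k))
          (Finset.univ.filter fun j : Option (Fin m) × Fin n => j.1 ≠ none)
          then NA * hdChi (hdS r.2) r.1.2 else 0) * F r.2 (fun k => x (hdE r.1 (k, r.2 k)))
      = q⁻¹ * ∑ i, F i (fun k => x (none, i k)) := by
    intro x
    rw [Fintype.sum_prod_type, Finset.sum_comm, Finset.mul_sum]
    refine Finset.sum_congr rfl fun i _ => ?_
    by_cases hi : StrictMono i
    · rw [hq, ← hd_count2 i hi.injective, Finset.mul_sum, Finset.sum_mul]
      refine Finset.sum_congr rfl fun a _ => ?_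
      have hiff : Disjoint (Finset.univ.image fun k => hdE a (k, i k))
          (Finset.univ.filter fun j : Option (Fin m) × Fin n => j.1 ≠ none) ↔
          ((∀ k, a.1 (i k) = some k) ∧ (∀ k, a.2 (k, i k) = true)) := by
        rw [Finset.disjoint_left, ← forall_and]
        constructor
        · intro h k
          have h1 := h (Finset.mem_image_of_mem _ (Finset.mem_univ k))
          by_contra h2
          simp [hdE, h2] at h1
        · intro h j hj
          obtain ⟨k, _, rfl⟩ := Finset.mem_image.1 hj
          simp [hdE, h k]
      simp only [hiff]
      split_ifs with h
      · rw [hdChi_S_true i a.2 h.2]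
        congr 2
        funext k
        simp [hdE, h.1 k, h.2 k]
      · simp
    · simp [hF.supp i hi]
  simp only [hL] at hce
  have hce2 := hce.trans (b := _) (c := ENNReal.ofReal (((4 * K + 1 : ℝ) ^ m) ^ (p / 2)) * hdSq μ p F) ?_
  · have h0 := (hd_mp_comp μ (e := fun i : Fin n => ((none : Option (Fin m)), i))
      (fun i i' h => (Prod.mk.inj h).2)).lintegral_comp
      (f := fun x => ENNReal.ofReal (|∑ i, F i (fun k => x (i k))| ^ p)) (by fun_prop)
    have h1 : ∀ x : Option (Fin m) × Fin n → Ω,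
        ENNReal.ofReal (|∑ i, F i (fun k => x (none, i k))| ^ p)
        = ENNReal.ofReal (q ^ p) * ENNReal.ofReal (|q⁻¹ * ∑ i, F i (fun k => x (none, i k))| ^ p) := by
      intro x
      rw [← ENNReal.ofReal_mul (by positivity), abs_mul, abs_of_pos (inv_pos.2 hq0),
        Real.mul_rpow (by positivity) (by positivity), ← mul_assoc,
        ← Real.mul_rpow (by positivity) (by positivity), mul_inv_cancel₀ hq0.ne', Real.one_rpow, one_mul]
    rw [← h0]
    simp only [h1]
    rw [lintegral_const_mul _ (by fun_prop), ENNReal.ofReal_mul (by positivity), mul_assoc]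
    gcongr
  have hR : ∀ x : Option (Fin m) × Fin n → Ω,
      ∑ r : hdA m n × (Fin m → Fin n),
        NA * hdChi (hdS r.2) r.1.2 * F r.2 (fun k => x (hdE r.1 (k, r.2 k)))
      = NA * ∑ a : hdA m n, ∑ i, hdChi (hdS i) a.2 * F i (fun k => x (hdE a (k, i k))) := by
    intro x
    rw [Fintype.sum_prod_type, Finset.mul_sum]
    refine Finset.sum_congr rfl fun a _ => ?_
    rw [Finset.mul_sum]
    refine Finset.sum_congr rfl fun i _ => ?_
    ring
  simp only [hR]
  refine (hd_avg_int hp (fun (a : hdA m n) x => ∑ i, hdChi (hdS i) a.2 * F i (fun k => x (hdE a (k, i k))))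
    (fun a => by fun_prop)).trans ?_
  have hT : ∀ a : hdA m n,
      ∫⁻ x, ENNReal.ofReal (|∑ i, hdChi (hdS i) a.2 * F i (fun k => x (hdE a (k, i k)))| ^ p)
        ∂(hdP μ (Option (Fin m) × Fin n))
      = ∫⁻ y, ENNReal.ofReal (|∑ i, hdChi (hdS i) a.2 * F i (fun k => y (k, i k))| ^ p)
        ∂(hdP μ (Fin m × Fin n)) := fun a =>
    (hd_mp_comp μ (hdE_inj a)).lintegral_comp
      (f := fun y => ENNReal.ofReal (|∑ i, hdChi (hdS i) a.2 * F i (fun k => y (k, i k))| ^ p))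
      (by fun_prop)
  simp only [hT]
  rw [← lintegral_finsetSum _ (fun a _ => by fun_prop), ← lintegral_const_mul _ (by fun_prop),
    hdSq, ← lintegral_const_mul _ (by fun_prop)]
  refine lintegral_mono fun y => ?_
  rw [← ENNReal.ofReal_sum_of_nonneg (fun a _ => by positivity), ← ENNReal.ofReal_mul (by positivity),
    ← ENNReal.ofReal_mul (by positivity)]
  refine ENNReal.ofReal_le_ofReal ?_
  have hkh := hd_kh_upper hp hK (hdS (m := m) (n := n)) hdS_inj hdS_card (fun i => F i (fun k => y (k, i k)))
  refine le_trans (le_of_eq ?_) hkh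
  simp only [mul_comm (hdChi _ _)]
  exact hdAv_prod (fun ε => |∑ i, (F i fun k => y (k, i k)) * hdChi (hdS i) ε| ^ p)
end Upper


section Lower

def hdPhi {M n : ℕ} (a : hdA M n) (i : Fin n) : Option (Fin M) × Fin n :=
  ((a.1 i).bind fun k => if a.2 (k, i) = true then some k else none, i)

lemma hdPhi_inj {M n : ℕ} (a : hdA M n) : Function.Injective (hdPhi a) :=
  fun _ _ h => (Prod.mk.inj h).2

abbrev hdR (M n : ℕ) : Type := Σ m : Fin (M + 1), (Fin m → Fin n)

lemma hd_sum_R {M n : ℕ} (G : (m : ℕ) → (Fin m → Fin n) → ℝ) :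
    ∑ m ∈ Finset.range (M + 1), ∑ i : Fin m → Fin n, G m i = ∑ r : hdR M n, G r.1 r.2 := by
  rw [Finset.sum_range, Fintype.sum_sigma]

lemma hdPhi_congr {M n : ℕ} (κ : Fin n → Option (Fin M)) (ε ε' : Fin M × Fin n → Bool) (i : Fin n)
    (h : ∀ k, κ i = some k → ε (k, i) = ε' (k, i)) : hdPhi (κ, ε) i = hdPhi (κ, ε') i := by
  unfold hdPhi
  cases hk : κ i with
  | none => simp [hk]
  | some k => simp [hk, h k hk]

lemma hd_term0 {M n m : ℕ} {X : Type*} (i : Fin M → Fin n) (i' : Fin m → Fin n)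
    (κ : Fin n → Option (Fin M)) (g : (Fin m → X) → ℝ) (c : ℝ) (x : Option (Fin M) × Fin n → X)
    (D : Finset (Option (Fin M) × Fin n))
    (k0 : Fin M) (hk : ∀ l, i' l = i k0 → κ (i' l) ≠ some k0) :
    ∑ ε : Fin M × Fin n → Bool,
      (if Disjoint (Finset.univ.image fun l => hdPhi (κ, ε) (i' l)) D
        then c * hdChi (hdS i) ε else 0) * g (fun l => x (hdPhi (κ, ε) (i' l))) = 0 := by
  have hfl : ∀ ε l, hdPhi (κ, hdFlip (k0, i k0) ε) (i' l) = hdPhi (κ, ε) (i' l) := by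
    intro ε l
    refine hdPhi_congr _ _ _ _ fun k hkk => ?_
    unfold hdFlip
    rw [Function.update_of_ne]
    intro h
    obtain ⟨rfl, h2⟩ := Prod.mk.inj h
    exact hk l h2 hkk
  have hmem : (k0, i k0) ∈ hdS i := Finset.mem_image_of_mem _ (Finset.mem_univ k0)
  have := hdSum_flip (k0, i k0) (fun ε : Fin M × Fin n → Bool =>
      (if Disjoint (Finset.univ.image fun l => hdPhi (κ, ε) (i' l)) D
        then c * hdChi (hdS i) ε else 0) * g (fun l => x (hdPhi (κ, ε) (i' l))))
  simp only [hfl, hdChi_flip_mem hmem] at this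
  have h2 : ∀ ε : Fin M × Fin n → Bool, (if Disjoint (Finset.univ.image fun l => hdPhi (κ, ε) (i' l)) D
        then c * -hdChi (hdS i) ε else 0) * g (fun l => x (hdPhi (κ, ε) (i' l)))
      = -((if Disjoint (Finset.univ.image fun l => hdPhi (κ, ε) (i' l)) D
        then c * hdChi (hdS i) ε else 0) * g (fun l => x (hdPhi (κ, ε) (i' l)))) := by
    intro ε
    split_ifs <;> ring
  simp only [h2, Finset.sum_neg_distrib] at this
  linarith

lemma hd_exists_k0 {M n m : ℕ} {i : Fin M → Fin n} {i' : Fin m → Fin n} (hi : StrictMono i)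
    (hi' : StrictMono i') (hm : m ≤ M) (h : ∀ k, ∃ l, i' l = i k) :
    (⟨m, i'⟩ : Σ m : ℕ, (Fin m → Fin n)) = ⟨M, i⟩ := by
  choose e he using h
  have hei : Function.Injective e := fun k k' hkk => hi.injective (by rw [← he, ← he, hkk])
  have := Fintype.card_le_of_injective e hei
  simp only [Fintype.card_fin] at this
  obtain rfl : m = M := le_antisymm hm this
  have hsurj := Finite.surjective_of_injective hei
  congr 1
  refine (hi'.range_inj hi).1 ?_
  ext v
  constructor
  · rintro ⟨l, rfl⟩
    obtain ⟨k, rfl⟩ := hsurj l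
    exact ⟨k, (he k).symm⟩
  · rintro ⟨k, rfl⟩
    exact ⟨e k, he k⟩

variable {Ω : Type u} [MeasurableSpace Ω] {μ : Measure Ω} [IsProbabilityMeasure μ]

lemma hd_comp {M n : ℕ} {fm : (m : ℕ) → (Fin m → Fin n) → (Fin m → Ω) → ℝ}
    (hsupp : ∀ m i, ¬ StrictMono i → fm m i = 0) (i : Fin M → Fin n) (hi : StrictMono i)
    (x : Option (Fin M) × Fin n → Ω) :
    ∑ r : hdA M n × hdR M n,
      (if Disjoint (Finset.univ.image fun l => hdPhi r.1 (r.2.2 l))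
          (Finset.univ.filter fun j : Option (Fin M) × Fin n => j.1 = none)
        then (Fintype.card (hdA M n) : ℝ)⁻¹ * hdChi (hdS i) r.1.2 else 0)
        * fm r.2.1 r.2.2 (fun l => x (hdPhi r.1 (r.2.2 l)))
      = (((M + 1) * 2 : ℝ) ^ M)⁻¹ * fm M i (fun k => x (some k, i k)) := by
  rw [Fintype.sum_prod_type, Finset.sum_comm]
  rw [Fintype.sum_eq_single (⟨Fin.last M, i⟩ : hdR M n)]
  · change ∑ a : hdA M n, (if Disjoint (Finset.univ.image fun l => hdPhi a (i l))
          (Finset.univ.filter fun j : Option (Fin M) × Fin n => j.1 = none)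
        then (Fintype.card (hdA M n) : ℝ)⁻¹ * hdChi (hdS i) a.2 else 0)
        * fm M i (fun l => x (hdPhi a (i l))) = _
    rw [← hd_count2 i hi.injective, Finset.mul_sum, Finset.sum_mul, Fintype.sum_prod_type,
      Fintype.sum_prod_type]
    refine Finset.sum_congr rfl fun κ _ => ?_
    by_cases hκ : ∀ k, κ (i k) = some k
    · refine Finset.sum_congr rfl fun ε _ => ?_
      have hiff : Disjoint (Finset.univ.image fun l => hdPhi (κ, ε) (i l))
          (Finset.univ.filter fun j : Option (Fin M) × Fin n => j.1 = none) ↔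
          ∀ k, ε (k, i k) = true := by
        rw [Finset.disjoint_left]
        constructor
        · intro h k
          have h1 := h (Finset.mem_image_of_mem _ (Finset.mem_univ k))
          by_contra h2
          simp [hdPhi, h2, hκ k] at h1
        · intro h j hj
          obtain ⟨k, _, rfl⟩ := Finset.mem_image.1 hj
          simp [hdPhi, h k, hκ k]
      simp only [hiff]
      by_cases h : ∀ k, ε (k, i k) = true
      · rw [if_pos h, if_pos ⟨hκ, h⟩, hdChi_S_true i ε h]
        congr 2
        funext k
        simp [hdPhi, hκ k, h k]
      · rw [if_neg h, if_neg (fun h' => h h'.2)]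
        simp
    · push Not at hκ
      obtain ⟨k0, hk0⟩ := hκ
      rw [hd_term0 i i κ (fm M i) _ x _ k0 (fun l hl => by rw [hl]; exact hk0)]
      symm
      refine Finset.sum_eq_zero fun ε _ => ?_
      rw [if_neg (fun h' => hk0 (h'.1 k0))]
      simp
  · rintro ⟨⟨m, hm⟩, i'⟩ hne
    by_cases hi' : StrictMono i'
    · rw [Fintype.sum_prod_type]
      refine Finset.sum_eq_zero fun κ _ => ?_
      have : ∃ k0, ∀ l, i' l = i k0 → κ (i' l) ≠ some k0 := by
        by_contra hcon
        push Not at hcon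
        have := hd_exists_k0 hi hi' (Nat.lt_succ_iff.1 hm) (fun k => (hcon k).imp fun l h => h.1)
        simp only [Sigma.mk.injEq] at this
        obtain ⟨h1, h2⟩ := this
        have h1' : m = M := h1
        subst h1'
        have h3 := eq_of_heq h2
        subst h3
        exact hne rfl
      obtain ⟨k0, hk0⟩ := this
      exact hd_term0 i i' κ (fm m i') _ x _ k0 hk0
    · refine Finset.sum_eq_zero fun a _ => ?_
      simp [hsupp m i' hi']

lemma hd_term_low {M n m : ℕ} {X : Type*} (hm : m ≤ M) (i' : Fin m → Fin n)
    (κ : Fin n → Option (Fin M)) (g : (Fin m → X) → ℝ) (x : Option (Fin M) × Fin n → X) :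
    hdLow M (fun ε : Fin M × Fin n → Bool => g (fun l => x (hdPhi (κ, ε) (i' l)))) := by
  classical
  set T : Finset (Fin M × Fin n) :=
    Finset.univ.filter fun b => ∃ l, κ (i' l) = some b.1 ∧ i' l = b.2 with hT
  refine hdSub.low (T := T) (hdSub_junta T _ ?_) ?_
  · intro ε ε' h
    congr 1
    funext l
    congr 1
    refine hdPhi_congr _ _ _ _ fun k hk => h _ ?_
    simp only [hT, Finset.mem_filter, Finset.mem_univ, true_and]
    exact ⟨l, hk, rfl⟩
  · have h1 : T.card = (T.image fun b => (some b.1, b.2)).card := by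
      rw [Finset.card_image_of_injective]
      rintro ⟨a, b⟩ ⟨a', b'⟩ h
      simpa using h
    rw [h1]
    have h2 : (T.image fun b => (some b.1, b.2)) ⊆ Finset.univ.image fun l => (κ (i' l), i' l) := by
      intro b hb
      obtain ⟨b', hb', rfl⟩ := Finset.mem_image.1 hb
      simp only [hT, Finset.mem_filter, Finset.mem_univ, true_and] at hb'
      obtain ⟨l, hl1, hl2⟩ := hb'
      refine Finset.mem_image.2 ⟨l, Finset.mem_univ _, ?_⟩
      rw [hl1, hl2]
    refine (Finset.card_le_card h2).trans (Finset.card_image_le.trans ?_)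
    simpa using hm

/-- The full function, as a function on `Ω^n`. -/
def hdF (M : ℕ) {n : ℕ} (fm : (m : ℕ) → (Fin m → Fin n) → (Fin m → Ω) → ℝ) (x : Fin n → Ω) : ℝ :=
  ∑ m ∈ Finset.range (M + 1), ∑ i : Fin m → Fin n, fm m i fun k => x (i k)

lemma hd_top {M n : ℕ} {p : ℝ} (hp : 1 ≤ p)
    {fm : (m : ℕ) → (Fin m → Fin n) → (Fin m → Ω) → ℝ} (hg : ∀ m, hdGood μ (fm m)) :
    hdSq μ p (fm M) ≤ ENNReal.ofReal ((((M + 1) * 2 : ℝ) ^ M) ^ p * (8 * 81 ^ M : ℝ) ^ (p / 2))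
      * ∫⁻ x, ENNReal.ofReal (|hdF M fm x| ^ p) ∂(hdP μ (Fin n)) := by
  classical
  have hFm : ∀ m i, Measurable (fm m i) := fun m => (hg m).meas
  have hfmeas : Measurable (hdF M fm) := by unfold hdF; fun_prop
  set q : ℝ := (((M + 1) * 2 : ℝ) ^ M) with hq
  have hq0 : 0 < q := by positivity
  set NA : ℝ := (Fintype.card (hdA M n) : ℝ)⁻¹ with hNA
  have hce := hd_ce (N := Fin M → Fin n) (R := hdA M n × hdR M n) (μ := μ) hp
    (fun r => Finset.univ.image fun l => hdPhi r.1 (r.2.2 l))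
    (fun r x => fm r.2.1 r.2.2 (fun l => x (hdPhi r.1 (r.2.2 l))))
    (fun r => (hg r.2.1).MZ r.2.2 (fun l => hdPhi r.1 (r.2.2 l))
      (fun h => (hdPhi_inj r.1).comp h.injective))
    (fun i r => NA * hdChi (hdS i) r.1.2)
    (Finset.univ.filter fun j : Option (Fin M) × Fin n => j.1 = none)
  have h0 := (hd_mp_comp μ (e := fun b : Fin M × Fin n => (some b.1, b.2))
      (by rintro ⟨a, b⟩ ⟨a', b'⟩ h; simpa using h)).lintegral_comp
      (f := fun y => ENNReal.ofReal ((∑ i, fm M i (fun k => y (k, i k)) ^ 2) ^ (p / 2))) (by fun_prop)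
  rw [hdSq, ← h0, ENNReal.ofReal_mul (by positivity), mul_assoc]
  refine le_trans ?_ ((mul_le_mul_right (hce.trans ?_) (ENNReal.ofReal (q ^ p))))
  · rw [← lintegral_const_mul _ (by fun_prop)]
    refine lintegral_mono fun x => ?_
    rw [← ENNReal.ofReal_mul (by positivity)]
    refine ENNReal.ofReal_le_ofReal ?_
    have hqp : q ^ p = (q ^ 2) ^ (p / 2) := by rw [hd_sq_rpow, abs_of_pos hq0]
    rw [hqp, ← Real.mul_rpow (by positivity) (by positivity), Finset.mul_sum]
    refine Real.rpow_le_rpow (by positivity) (Finset.sum_le_sum fun i _ => ?_) (by positivity)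
    by_cases hi : StrictMono i
    · rw [hd_comp (fun m => (hg m).supp) i hi x, ← mul_pow, ← mul_assoc, mul_inv_cancel₀ hq0.ne', one_mul]
    · rw [(hg M).supp i hi]
      simp only [Pi.zero_apply, ne_eq, OfNat.ofNat_ne_zero, not_false_eq_true, zero_pow]
      positivity
  · -- the Khinchine step
    set Φ : (Option (Fin M) × Fin n → Ω) → (Fin M × Fin n → Bool) → ℝ := fun x ε =>
      (Fintype.card (Fin n → Option (Fin M)) : ℝ)⁻¹ *
        ∑ κ : Fin n → Option (Fin M), hdF M fm (fun i => x (hdPhi (κ, ε) i)) with hΦ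
    have hcK : (Fintype.card (Fin n → Option (Fin M)) : ℝ) ≠ 0 := by
      exact_mod_cast Fintype.card_ne_zero
    have hcB : (Fintype.card (Fin M × Fin n → Bool) : ℝ) ≠ 0 := by
      exact_mod_cast Fintype.card_ne_zero
    have hNA2 : NA = (Fintype.card (Fin M × Fin n → Bool) : ℝ)⁻¹ *
        (Fintype.card (Fin n → Option (Fin M)) : ℝ)⁻¹ := by
      rw [hNA, Fintype.card_prod, Nat.cast_mul, mul_inv, mul_comm]
    have hco : ∀ x i, ∑ r : hdA M n × hdR M n,
        NA * hdChi (hdS i) r.1.2 * fm r.2.1 r.2.2 (fun l => x (hdPhi r.1 (r.2.2 l)))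
        = hdAv (fun ε => Φ x ε * hdChi (hdS i) ε) := by
      intro x i
      rw [Fintype.sum_prod_type, Fintype.sum_prod_type, Finset.sum_comm, hdAv, div_eq_inv_mul,
        Finset.mul_sum]
      refine Finset.sum_congr rfl fun ε _ => ?_
      rw [hΦ]
      simp only
      rw [Finset.mul_sum, Finset.sum_mul, Finset.mul_sum]
      refine Finset.sum_congr rfl fun κ _ => ?_
      rw [← Finset.mul_sum, hdF, hd_sum_R (fun m i => fm m i fun k => x (hdPhi (κ, ε) (i k))), hNA2]
      ring
    have hlow : ∀ x, hdLow M (Φ x) := by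
      intro x
      have := hdLow.sum (Finset.univ : Finset ((Fin n → Option (Fin M)) × hdR M n))
        (fun _ => (Fintype.card (Fin n → Option (Fin M)) : ℝ)⁻¹)
        (F := fun s ε => fm s.2.1 s.2.2 (fun l => x (hdPhi (s.1, ε) (s.2.2 l)))) (d := M)
        (fun s _ => hd_term_low (Nat.lt_succ_iff.1 s.2.1.2) s.2.2 s.1 (fm s.2.1 s.2.2) x)
      convert this using 1
      funext ε
      rw [hΦ, ← Finset.mul_sum, Fintype.sum_prod_type]
      simp only
      congr 1
      refine Finset.sum_congr rfl fun κ _ => ?_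
      rw [hdF, hd_sum_R (fun m i => fm m i fun k => x (hdPhi (κ, ε) (i k)))]
    simp only [hco]
    have hpt : ∀ x, ENNReal.ofReal ((∑ i, hdAv (fun ε => Φ x ε * hdChi (hdS i) ε) ^ 2) ^ (p / 2))
        ≤ ENNReal.ofReal ((8 * 81 ^ M : ℝ) ^ (p / 2)) * (ENNReal.ofReal NA *
          ∑ a : hdA M n, ENNReal.ofReal (|hdF M fm (fun i => x (hdPhi a i))| ^ p)) := by
      intro x
      rw [← ENNReal.ofReal_sum_of_nonneg (fun a _ => by positivity),
        ← ENNReal.ofReal_mul (by positivity), ← ENNReal.ofReal_mul (by positivity)]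
      refine ENNReal.ofReal_le_ofReal ((hd_kh_lower hp hdS hdS_inj (hlow x)).trans ?_)
      gcongr
      rw [hdAv, div_eq_inv_mul, hNA2, mul_assoc, Fintype.sum_prod_type, Finset.sum_comm]
      gcongr
      rw [Finset.mul_sum]
      exact Finset.sum_le_sum fun ε _ => hd_avg hp _
    refine (lintegral_mono hpt).trans ?_
    rw [lintegral_const_mul _ (by fun_prop), lintegral_const_mul _ (by fun_prop),
      lintegral_finsetSum _ (fun a _ => by fun_prop)]
    gcongr
    have hT : ∀ a : hdA M n,
        ∫⁻ x, ENNReal.ofReal (|hdF M fm (fun i => x (hdPhi a i))| ^ p)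
          ∂(hdP μ (Option (Fin M) × Fin n))
        = ∫⁻ x, ENNReal.ofReal (|hdF M fm x| ^ p) ∂(hdP μ (Fin n)) := fun a =>
      (hd_mp_comp μ (hdPhi_inj a)).lintegral_comp
        (f := fun x => ENNReal.ofReal (|hdF M fm x| ^ p)) (by fun_prop)
    simp only [hT, Finset.sum_const, Finset.card_univ, nsmul_eq_mul]
    rw [← mul_assoc, hNA, ← ENNReal.ofReal_natCast, ← ENNReal.ofReal_mul (by positivity),
      inv_mul_cancel₀ (by exact_mod_cast Fintype.card_ne_zero), ENNReal.ofReal_one, one_mul]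

end Lower


section Final

lemma hd_pow_add {p : ℝ} (hp : 1 ≤ p) (a b : ℝ) : |a + b| ^ p ≤ 2 ^ p * (|a| ^ p + |b| ^ p) := by
  have hp0 : 0 ≤ p := by linarith
  have ha : 0 ≤ |a| ^ p := by positivity
  have hb : 0 ≤ |b| ^ p := by positivity
  have h1 : |a + b| ≤ 2 * max |a| |b| := by
    have := abs_add_le a b
    have := le_max_left |a| |b|
    have := le_max_right |a| |b|
    linarith
  calc |a + b| ^ p ≤ (2 * max |a| |b|) ^ p := Real.rpow_le_rpow (abs_nonneg _) h1 hp0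
    _ = 2 ^ p * (max |a| |b|) ^ p := Real.mul_rpow (by positivity) (by positivity)
    _ ≤ _ := by
      gcongr
      rcases max_choice |a| |b| with h | h <;> rw [h] <;> linarith

variable {Ω : Type u} [MeasurableSpace Ω] {μ : Measure Ω} [IsProbabilityMeasure μ]

lemma hd_int_add {p : ℝ} (hp : 1 ≤ p) {n : ℕ} {f g h : (Fin n → Ω) → ℝ} (hf : Measurable f)
    (hg : Measurable g) (hh : ∀ x, h x = f x + g x) :
    ∫⁻ x, ENNReal.ofReal (|h x| ^ p) ∂(hdP μ (Fin n))
      ≤ ENNReal.ofReal (2 ^ p) * (∫⁻ x, ENNReal.ofReal (|f x| ^ p) ∂(hdP μ (Fin n))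
        + ∫⁻ x, ENNReal.ofReal (|g x| ^ p) ∂(hdP μ (Fin n))) := by
  rw [← lintegral_add_left (by fun_prop), ← lintegral_const_mul _ (by fun_prop)]
  refine lintegral_mono fun x => ?_
  rw [← ENNReal.ofReal_add (by positivity) (by positivity), ← ENNReal.ofReal_mul (by positivity), hh]
  exact ENNReal.ofReal_le_ofReal (hd_pow_add hp _ _)

lemma hd_upper' (m : ℕ) {p : ℝ} (hp : 1 ≤ p) : ∃ C : ℝ, 0 ≤ C ∧
    ∀ (Ω : Type u) [MeasurableSpace Ω] (μ : Measure Ω) [IsProbabilityMeasure μ] (n : ℕ)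
      (F : (Fin m → Fin n) → (Fin m → Ω) → ℝ), hdGood μ F →
      ∫⁻ x, ENNReal.ofReal (|∑ i, F i (fun k => x (i k))| ^ p) ∂(hdP μ (Fin n))
        ≤ ENNReal.ofReal C * hdSq μ p F := by
  have h1 : p ≤ 2 * (⌈p⌉₊ : ℝ) := by have := Nat.le_ceil p; linarith
  refine ⟨(((m + 1) * 2 : ℝ) ^ m) ^ p * ((4 * (⌈p⌉₊ : ℝ) + 1 : ℝ) ^ m) ^ (p / 2), by positivity, ?_⟩
  intro Ω _ μ _ n F hF
  exact hd_upper hp h1 hF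

lemma hdF_succ (M : ℕ) {n : ℕ} (fm : (m : ℕ) → (Fin m → Fin n) → (Fin m → Ω) → ℝ) (x : Fin n → Ω) :
    hdF (M + 1) fm x = hdF M fm x + ∑ i : Fin (M + 1) → Fin n, fm (M + 1) i fun k => x (i k) := by
  rw [hdF, Finset.sum_range_succ, hdF]

lemma hd_upper_all (M : ℕ) {p : ℝ} (hp : 1 ≤ p) : ∃ C : ℝ, 0 ≤ C ∧
    ∀ (Ω : Type u) [MeasurableSpace Ω] (μ : Measure Ω) [IsProbabilityMeasure μ] (n : ℕ)
      (fm : (m : ℕ) → (Fin m → Fin n) → (Fin m → Ω) → ℝ), (∀ m, hdGood μ (fm m)) →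
      ∫⁻ x, ENNReal.ofReal (|hdF M fm x| ^ p) ∂(hdP μ (Fin n))
        ≤ ENNReal.ofReal C * ∑ m ∈ Finset.range (M + 1), hdSq μ p (fm m) := by
  induction M with
  | zero =>
    obtain ⟨C, hC, h⟩ := hd_upper'.{u} 0 hp
    refine ⟨C, hC, fun Ω _ μ _ n fm hg => ?_⟩
    simpa [hdF] using h Ω μ n (fm 0) (hg 0)
  | succ M ih =>
    obtain ⟨C, hC, h⟩ := hd_upper'.{u} (M + 1) hp
    obtain ⟨D, hD, ih⟩ := ih
    refine ⟨2 ^ p * (D + C), by positivity, fun Ω _ μ _ n fm hg => ?_⟩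
    have hFm : ∀ m i, Measurable (fm m i) := fun m => (hg m).meas
    have hfmeas : Measurable (hdF M fm) := by unfold hdF; fun_prop
    refine (hd_int_add hp hfmeas (by fun_prop) (hdF_succ M fm)).trans ?_
    rw [ENNReal.ofReal_mul (by positivity), mul_assoc, ENNReal.ofReal_add hD hC, add_mul]
    gcongr
    · refine (ih Ω μ n fm hg).trans ?_
      rw [Finset.sum_range_succ _ (M + 1)]
      gcongr
      exact le_self_add
    · refine (h Ω μ n _ (hg (M + 1))).trans ?_
      rw [Finset.sum_range_succ _ (M + 1)]
      gcongr
      exact le_add_self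

lemma hd_lower_all (M : ℕ) {p : ℝ} (hp : 1 ≤ p) : ∃ C : ℝ, 0 ≤ C ∧
    ∀ (Ω : Type u) [MeasurableSpace Ω] (μ : Measure Ω) [IsProbabilityMeasure μ] (n : ℕ)
      (fm : (m : ℕ) → (Fin m → Fin n) → (Fin m → Ω) → ℝ), (∀ m, hdGood μ (fm m)) →
      ∑ m ∈ Finset.range (M + 1), hdSq μ p (fm m)
        ≤ ENNReal.ofReal C * ∫⁻ x, ENNReal.ofReal (|hdF M fm x| ^ p) ∂(hdP μ (Fin n)) := by
  induction M with
  | zero =>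
    refine ⟨((((0 : ℕ) + 1) * 2 : ℝ) ^ 0) ^ p * (8 * 81 ^ 0 : ℝ) ^ (p / 2), by positivity,
      fun Ω _ μ _ n fm hg => ?_⟩
    rw [Finset.sum_range_one]
    exact hd_top hp hg
  | succ M ih =>
    obtain ⟨B, hB, hu⟩ := hd_upper'.{u} (M + 1) hp
    obtain ⟨D, hD, ih⟩ := ih
    set A : ℝ := (((((M + 1 : ℕ) : ℝ) + 1) * 2 : ℝ) ^ (M + 1)) ^ p * (8 * 81 ^ (M + 1) : ℝ) ^ (p / 2)
    have hA : 0 ≤ A := by positivity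
    refine ⟨D * (2 ^ p * (1 + B * A)) + A, by positivity, fun Ω _ μ _ n fm hg => ?_⟩
    have hFm : ∀ m i, Measurable (fm m i) := fun m => (hg m).meas
    have hfmeas : ∀ M, Measurable (hdF M fm) := by intro M; unfold hdF; fun_prop
    have htop := hd_top (M := M + 1) hp hg
    rw [Finset.sum_range_succ _ (M + 1), ENNReal.ofReal_add (by positivity) hA, add_mul]
    refine add_le_add ((ih Ω μ n fm hg).trans ?_) htop
    rw [ENNReal.ofReal_mul hD, mul_assoc]
    gcongr
    refine (hd_int_add hp (f := hdF (M + 1) fm)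
      (g := fun x => -∑ i : Fin (M + 1) → Fin n, fm (M + 1) i fun k => x (i k)) (hfmeas _) (by fun_prop)
      (fun x => by rw [hdF_succ]; ring)).trans ?_
    rw [ENNReal.ofReal_mul (by positivity), mul_assoc, ENNReal.ofReal_add (by positivity) (by positivity),
      add_mul, ENNReal.ofReal_one, one_mul]
    gcongr
    simp only [abs_neg]
    refine (hu Ω μ n _ (hg (M + 1))).trans ?_
    rw [ENNReal.ofReal_mul hB, mul_assoc]
    gcongr

end Final

/-- **Decoupled square function estimate for Hoeffding decompositions**
(Corollary `sqfndecoup` of the paper): for `f ∈ V^p_{≤M}(Ω^n)` with Hoeffding components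
`fm m i` (mean zero in each variable, supported on increasing tuples `i`),
`‖f‖_{L^p(Ω^n)}^p` is equivalent, with constants depending only on `M` and `p`, to
`∑_{m ≤ M} ∫⋯∫ (∑_i fm m i (x^{(1)}_{i 1}, …, x^{(m)}_{i m})²)^{p/2}`. -/
theorem hoeffding_decoupled_square_function (M : ℕ) (p : ℝ) (hp : 1 ≤ p) :
    ∃ c C : ℝ, 0 < c ∧ 0 < C ∧
      ∀ (Ω : Type u) [MeasurableSpace Ω] (μ : Measure Ω) [IsProbabilityMeasure μ]
        (n : ℕ) (fm : (m : ℕ) → (Fin m → Fin n) → (Fin m → Ω) → ℝ),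
        (∀ m i, Measurable (fm m i)) →
        (∀ m i, ¬ StrictMono i → fm m i = 0) →
        (∀ m (i : Fin m → Fin n) (k : Fin m),
          ∀ᵐ y ∂(Measure.pi fun _ : Fin m => μ),
            ∫ z, fm m i (Function.update y k z) ∂μ = 0) →
        (∀ m i, (∫⁻ y, ENNReal.ofReal (|fm m i y| ^ p)
            ∂Measure.pi fun _ : Fin m => μ) < ⊤) →
        (ENNReal.ofReal c *
            (∑ m ∈ Finset.range (M + 1),
              ∫⁻ x : Fin m → Fin n → Ω,
                ENNReal.ofReal ((∑ i : Fin m → Fin n, fm m i (fun k => x k (i k)) ^ 2)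
                  ^ (p/2))
                ∂Measure.pi fun _ : Fin m => Measure.pi fun _ : Fin n => μ)
          ≤ ∫⁻ x : Fin n → Ω,
              ENNReal.ofReal (|∑ m ∈ Finset.range (M + 1),
                ∑ i : Fin m → Fin n, fm m i fun k => x (i k)| ^ p)
              ∂Measure.pi fun _ : Fin n => μ) ∧
        ((∫⁻ x : Fin n → Ω,
              ENNReal.ofReal (|∑ m ∈ Finset.range (M + 1),
                ∑ i : Fin m → Fin n, fm m i fun k => x (i k)| ^ p)
              ∂Measure.pi fun _ : Fin n => μ)
          ≤ ENNReal.ofReal C *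
            ∑ m ∈ Finset.range (M + 1),
              ∫⁻ x : Fin m → Fin n → Ω,
                ENNReal.ofReal ((∑ i : Fin m → Fin n, fm m i (fun k => x k (i k)) ^ 2)
                  ^ (p/2))
                ∂Measure.pi fun _ : Fin m => Measure.pi fun _ : Fin n => μ) := by
  obtain ⟨C, hC, hup⟩ := hd_upper_all.{u} M hp
  obtain ⟨D, hD, hlo⟩ := hd_lower_all.{u} M hp
  refine ⟨(D + 1)⁻¹, C + 1, by positivity, by positivity, ?_⟩
  intro Ω _ μ _ n fm hmeas hsupp hmz hIntg
  have hg : ∀ m, hdGood μ (fm m) := by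
    intro m
    refine ⟨hmeas m, hsupp m, hmz m, fun i => ⟨(hmeas m i).aestronglyMeasurable, ?_⟩⟩
    have h1 : ∀ y, ‖fm m i y‖ₑ ≤ 1 + ENNReal.ofReal (|fm m i y| ^ p) := by
      intro y
      rw [← ofReal_norm, Real.norm_eq_abs, ← ENNReal.ofReal_one,
        ← ENNReal.ofReal_add zero_le_one (by positivity)]
      refine ENNReal.ofReal_le_ofReal ?_
      rcases le_total |fm m i y| 1 with h | h
      · have : 0 ≤ |fm m i y| ^ p := by positivity
        linarith
      · have := Real.self_le_rpow_of_one_le h hp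
        linarith
    refine (lintegral_mono h1).trans_lt ?_
    rw [lintegral_add_left measurable_const]
    simpa using hIntg m i
  have hsq : ∀ m, ∫⁻ x : Fin m → Fin n → Ω,
      ENNReal.ofReal ((∑ i : Fin m → Fin n, fm m i (fun k => x k (i k)) ^ 2) ^ (p/2))
        ∂(Measure.pi fun _ : Fin m => Measure.pi fun _ : Fin n => μ) = hdSq μ p (fm m) := fun m =>
    (hd_mp_uncurry μ m n).lintegral_comp
      (f := fun y => ENNReal.ofReal ((∑ i, fm m i (fun k => y (k, i k)) ^ 2) ^ (p / 2)))
      (by have := hmeas m; fun_prop)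
  simp only [hsq]
  constructor
  · have h := hlo Ω μ n fm hg
    calc ENNReal.ofReal (D + 1)⁻¹ * ∑ m ∈ Finset.range (M + 1), hdSq μ p (fm m)
        ≤ ENNReal.ofReal (D + 1)⁻¹ * (ENNReal.ofReal D *
          ∫⁻ x, ENNReal.ofReal (|hdF M fm x| ^ p) ∂(hdP μ (Fin n))) := by gcongr
      _ ≤ 1 * ∫⁻ x, ENNReal.ofReal (|hdF M fm x| ^ p) ∂(hdP μ (Fin n)) := by
        rw [← mul_assoc, ← ENNReal.ofReal_mul (by positivity)]
        gcongr
        rw [← ENNReal.ofReal_one]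
        refine ENNReal.ofReal_le_ofReal ?_
        rw [inv_mul_le_iff₀ (by positivity)]
        linarith
      _ = _ := by rw [one_mul]; rfl
  · refine (hup Ω μ n fm hg).trans ?_
    gcongr
    linarith
end
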